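/- arXiv:2010.01468 — 15 statements merged into one kernel-verified Lean document; each statement's English description precedes it below -/
import Mathlib

section
/- Let G be a connected simple graph on n vertices whose adjacency matrix has characteristic polynomial (X − λ)·X^(n−t−1)·(X − μ)^t, where 1 ≤ t ≤ n−2 and λ > 0 > μ are real numbers. Then μ = −λ if and only if G is isomorphic to a complete bipartite graph K_{p,q} for some integers p, q ≥ 1 with p + q = n. -/
open Polynomial
namespace Matrix

variable {V : Type*} [Fintype V] [DecidableEq V]

theorem IsSymm.eq_zero_of_pow_two_pow_eq_zero {B : Matrix V V ℝ} (hB : B.IsSymm) (k : ℕ)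
    (h : B ^ 2 ^ k = 0) : B = 0 := by
  induction k with
  | zero => simpa using h
  | succ k ih =>
    apply ih
    rw [← conjTranspose_mul_self_eq_zero, conjTranspose_eq_transpose_of_trivial, transpose_pow,
      hB.eq, ← pow_add, ← two_mul, ← pow_succ']
    exact h

theorem IsSymm.eq_zero_of_isNilpotent {B : Matrix V V ℝ} (hB : B.IsSymm)
    (h : IsNilpotent B) : B = 0 := by
  obtain ⟨m, hm⟩ := h
  exact hB.eq_zero_of_pow_two_pow_eq_zero m (pow_eq_zero_of_le Nat.lt_two_pow_self.le hm)

/-- A real symmetric matrix with spectrum contained in `{c, 0, -c}` satisfies `A³ = c² A`. -/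
theorem IsSymm.pow_three_eq_smul {A : Matrix V V ℝ} (hA : A.IsSymm) {c : ℝ} {a b : ℕ}
    (h : A.charpoly = (X - C c) * X ^ a * (X - C (-c)) ^ b) : A ^ 3 = c ^ 2 • A := by
  have hdvd : A.charpoly ∣ (X ^ 3 - C (c ^ 2) * X) ^ (a + b + 1) := by
    have e : (X ^ 3 - C (c ^ 2) * X : ℝ[X]) = (X - C c) * X * (X - C (-c)) := by
      simp only [C_pow, C_neg]; ring
    rw [h, e, mul_pow, mul_pow]
    exact mul_dvd_mul (mul_dvd_mul (dvd_pow_self _ (by omega)) (pow_dvd_pow _ (by omega)))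
      (pow_dvd_pow _ (by omega))
  have hnil : IsNilpotent (A ^ 3 - c ^ 2 • A) := by
    refine ⟨a + b + 1, ?_⟩
    obtain ⟨r, hr⟩ := hdvd
    have := congrArg (aeval A) hr
    rw [map_mul, aeval_self_charpoly, zero_mul] at this
    simpa [Algebra.smul_def] using this
  have hsymm : (A ^ 3 - c ^ 2 • A).IsSymm := by
    rw [IsSymm, transpose_sub, transpose_pow, transpose_smul, hA.eq]
  exact sub_eq_zero.mp (hsymm.eq_zero_of_isNilpotent hnil)

end Matrix

namespace SimpleGraph

variable {V : Type*} {G : SimpleGraph V}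

/-- In a connected graph in which the ends of every walk of length three are adjacent, adjacency
is determined by adjacency to a fixed vertex. -/
theorem Connected.adj_iff_of_adj_of_walk_three (hconn : G.Connected)
    (h : ∀ ⦃i a b j⦄, G.Adj i a → G.Adj a b → G.Adj b j → G.Adj i j) (v x y : V) :
    G.Adj x y ↔ (¬ G.Adj v x ∧ G.Adj v y) ∨ (G.Adj v x ∧ ¬ G.Adj v y) := by
  have twin : ∀ u, G.Adj v u ∨ ∀ k, G.Adj v k ↔ G.Adj u k := by
    intro u
    obtain ⟨p⟩ := (hconn.preconnected v u).symm
    induction p with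
    | nil => exact Or.inr fun _ ↦ Iff.rfl
    | cons hadj _ ih =>
      rcases ih with ih | ih
      · exact Or.inr fun k ↦ ⟨fun hk ↦ h hadj ih.symm hk, fun hk ↦ h ih hadj.symm hk⟩
      · exact Or.inl ((ih _).mpr hadj.symm)
  by_cases hx : G.Adj v x <;> by_cases hy : G.Adj v y
  · simp only [hx, hy, not_true_eq_false, false_and, and_false, or_self, iff_false]
    exact fun hxy ↦ G.irrefl (h hx hxy hy.symm)
  · have := (twin y).resolve_left hy x
    simpa [hx, hy, G.adj_comm x y] using this.mp hx
  · have := (twin x).resolve_left hx y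
    simpa [hx, hy] using this.mp hy
  · have := (twin x).resolve_left hx y
    simpa [hx, hy] using this

/-- If adjacency means lying on different sides of a partition of the vertices, the graph is
complete bipartite. -/
theorem nonempty_iso_completeBipartiteGraph_of_adj_iff [Fintype V] (P : V → Prop)
    [DecidablePred P]
    (h : ∀ x y, G.Adj x y ↔ (P x ∧ ¬ P y) ∨ (¬ P x ∧ P y)) :
    Nonempty (G ≃g completeBipartiteGraph (Fin (Fintype.card {x // P x}))
      (Fin (Fintype.card {x // ¬ P x}))) := by
  let e : completeBipartiteGraph {x // P x} {x // ¬ P x} ≃g G :=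
    { toEquiv := Equiv.sumCompl P
      map_rel_iff' := by
        rintro (⟨x, hx⟩ | ⟨x, hx⟩) (⟨y, hy⟩ | ⟨y, hy⟩) <;> simp [h, hx, hy] }
  exact ⟨e.symm.trans (completeBipartiteGraphCongr (Fintype.equivFin _) (Fintype.equivFin _))⟩

variable [Fintype V] [DecidableEq V] [DecidableRel G.Adj]

theorem adj_of_adjMatrix_pow_three_eq_smul {c : ℝ}
    (hA : G.adjMatrix ℝ ^ 3 = c • G.adjMatrix ℝ) {i a b j : V}
    (hia : G.Adj i a) (hab : G.Adj a b) (hbj : G.Adj b j) : G.Adj i j := by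
  by_contra hij
  have hentry := congrFun (congrFun hA i) j
  rw [adjMatrix_pow_apply_eq_card_walk, Matrix.smul_apply, adjMatrix_apply, if_neg hij,
    smul_zero, Nat.cast_eq_zero, Fintype.card_eq_zero_iff] at hentry
  exact hentry.elim ⟨.cons hia (.cons hab (.cons hbj .nil)), rfl⟩

/-- The spectrum of a bipartite graph is symmetric about zero. -/
theorem isRoot_charpoly_adjMatrix_neg (s : V → Prop) [DecidablePred s]
    (hs : ∀ ⦃x y⦄, G.Adj x y → (s x ↔ ¬ s y)) {c : ℝ}
    (h : (G.adjMatrix ℝ).charpoly.IsRoot c) : (G.adjMatrix ℝ).charpoly.IsRoot (-c) := by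
  rw [IsRoot.def, Matrix.eval_charpoly] at h ⊢
  set D : Matrix V V ℝ := Matrix.diagonal fun x ↦ if s x then 1 else -1
  have hD : D.det ≠ 0 := by
    rw [Matrix.det_diagonal, Finset.prod_ne_zero_iff]
    intro x _
    split_ifs <;> norm_num
  have hcomm : D * (Matrix.scalar V (-c) - G.adjMatrix ℝ) =
      -(Matrix.scalar V c - G.adjMatrix ℝ) * D := by
    ext x y
    rw [Matrix.diagonal_mul, Matrix.mul_diagonal]
    by_cases hxy : G.Adj x y
    · by_cases hy : s y <;> simp [hxy, hxy.ne, hs hxy, hy]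
    · obtain rfl | hne := eq_or_ne x y <;> simp [*, mul_comm]
  have hdet := congrArg Matrix.det hcomm
  rw [Matrix.det_mul, Matrix.det_mul, Matrix.det_neg, h, mul_zero, zero_mul] at hdet
  exact (mul_eq_zero.mp hdet).resolve_left hD

end SimpleGraph

/-- Let `G` be a connected simple graph on `n` vertices whose adjacency
matrix has characteristic polynomial `(X - λ) * X^(n-t-1) * (X - μ)^t`, where `1 ≤ t ≤ n-2`
and `λ > 0 > μ`.  Then `μ = -λ` iff `G` is isomorphic to a complete bipartite graph
`K_{p,q}` with `p, q ≥ 1` and `p + q = n`. -/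
theorem stmt0 {n t : ℕ} (G : SimpleGraph (Fin n)) [DecidableRel G.Adj]
    (hconn : G.Connected) (lam mu : ℝ) (hlam : 0 < lam) (hmu : mu < 0)
    (ht1 : 1 ≤ t) (ht2 : t ≤ n - 2)
    (hchar : (G.adjMatrix ℝ).charpoly =
      (X - C lam) * X ^ (n - t - 1) * (X - C mu) ^ t) :
    mu = -lam ↔
      ∃ p q : ℕ, 1 ≤ p ∧ 1 ≤ q ∧ p + q = n ∧
        Nonempty (G ≃g completeBipartiteGraph (Fin p) (Fin q)) := by
  constructor
  · rintro rfl
    have hthree := (G.isSymm_adjMatrix (α := ℝ)).pow_three_eq_smul hchar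
    have : Nontrivial (Fin n) := Fin.nontrivial_iff_two_le.mpr (by omega)
    obtain ⟨v⟩ := hconn.nonempty
    obtain ⟨w, hw⟩ := hconn.preconnected.exists_adj_of_nontrivial v
    have hadj := hconn.adj_iff_of_adj_of_walk_three
      (fun _ _ _ _ ↦ SimpleGraph.adj_of_adjMatrix_pow_three_eq_smul hthree) v
    refine ⟨_, _, Fintype.card_pos_iff.mpr ⟨⟨w, hw⟩⟩,
      Fintype.card_pos_iff.mpr ⟨⟨v, G.irrefl⟩⟩, ?_,
      SimpleGraph.nonempty_iso_completeBipartiteGraph_of_adj_iff (G.Adj v)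
        fun x y ↦ (hadj x y).trans or_comm⟩
    rw [← Fintype.card_sum, Fintype.card_congr (Equiv.sumCompl _), Fintype.card_fin]
  · rintro ⟨p, q, -, -, -, ⟨e⟩⟩
    have hroot : (G.adjMatrix ℝ).charpoly.IsRoot (-lam) := by
      refine SimpleGraph.isRoot_charpoly_adjMatrix_neg (fun x ↦ (e x).isLeft = true) ?_
        (by simp [hchar])
      intro x y hxy
      have := e.map_adj_iff.mpr hxy
      rcases hx : e x <;> rcases hy : e y <;> simp_all
    rw [hchar, IsRoot.def] at hroot
    simp only [eval_mul, eval_pow, eval_sub, eval_X, eval_C, mul_eq_zero] at hroot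
    rcases hroot with (h | h) | h
    · linarith
    · linarith [pow_eq_zero_iff (by omega) |>.mp h]
    · linarith [pow_eq_zero_iff (by omega) |>.mp h]
end

section
/- Let G be a connected simple graph on n vertices whose adjacency matrix has characteristic polynomial (X − λ)·X^(n−t−1)·(X − μ)^t, where 1 ≤ t ≤ n−2 and λ > 0 > μ are real numbers, and suppose μ ≠ −λ. Then t ≥ 2, μ is an integer, λ = −tμ, n = (t+1)·(−μ), and G is isomorphic to the complete (t+1)-partite graph with all t+1 parts of size −μ. -/
open Polynomial

namespace Matrix.IsHermitian

variable {V : Type*} [Fintype V] [DecidableEq V] {A : Matrix V V ℝ}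

lemma pow_apply_eq_sum_eigenvalues (hA : A.IsHermitian) (k : ℕ) (i j : V) :
    (A ^ k) i j = ∑ l, hA.eigenvalues l ^ k *
      (hA.eigenvectorBasis l i * hA.eigenvectorBasis l j) := by
  conv_lhs => rw [hA.spectral_theorem, ← map_pow, Unitary.conjStarAlgAut_apply, diagonal_pow,
    mul_apply]
  refine Finset.sum_congr rfl fun l _ => ?_
  simp [mul_diagonal, star_apply]
  ring

lemma trace_pow_eq_sum_eigenvalues (hA : A.IsHermitian) (k : ℕ) :
    (A ^ k).trace = ∑ l, hA.eigenvalues l ^ k := by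
  conv_lhs => rw [hA.spectral_theorem, ← map_pow, Unitary.conjStarAlgAut_apply, trace_mul_cycle,
    diagonal_pow]
  simp [trace]

/-- If every eigenvalue but one is a root of `x ^ 2 - mu * x`, then `A ^ 2 - mu • A` has rank one
and is positive semidefinite as soon as the remaining value is nonnegative. -/
lemma exists_sq_sub_mul_eq_mul (hA : A.IsHermitian) {mu lam : ℝ} (l₀ : V)
    (h₀ : hA.eigenvalues l₀ = lam) (hnonneg : 0 ≤ lam ^ 2 - mu * lam)
    (h : ∀ l ≠ l₀, hA.eigenvalues l = 0 ∨ hA.eigenvalues l = mu) :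
    ∃ w : V → ℝ, ∀ i j, (A ^ 2) i j - mu * A i j = w i * w j := by
  refine ⟨fun i => √(lam ^ 2 - mu * lam) * hA.eigenvectorBasis l₀ i, fun i j => ?_⟩
  have h1 := hA.pow_apply_eq_sum_eigenvalues 1 i j
  rw [pow_one] at h1
  rw [hA.pow_apply_eq_sum_eigenvalues, h1, Finset.mul_sum, ← Finset.sum_sub_distrib,
    Finset.sum_eq_single l₀]
  · rw [h₀]
    linear_combination (-(hA.eigenvectorBasis l₀ i * hA.eigenvectorBasis l₀ j)) *
      Real.mul_self_sqrt hnonneg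
  · intro l _ hl
    rcases h l hl with h | h <;> rw [h] <;> ring
  · simp

/-- The sum of a function over the eigenvalues, for a characteristic polynomial with roots
`lam` (simple), `0` and `mu`. -/
lemma sum_eigenvalues_of_charpoly (hA : A.IsHermitian) {lam mu : ℝ} {s t : ℕ}
    (h : A.charpoly = (X - C lam) * X ^ s * (X - C mu) ^ t) (f : ℝ → ℝ) :
    ∑ l, f (hA.eigenvalues l) = f lam + s * f 0 + t * f mu := by
  have hroots := hA.roots_charpoly_eq_eigenvalues
  have h1 : (X - C lam : ℝ[X]) * X ^ s * (X - C mu) ^ t ≠ 0 := h ▸ A.charpoly_monic.ne_zero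
  rw [h, roots_mul h1, roots_mul (left_ne_zero_of_mul h1), roots_X_sub_C, roots_X_pow, roots_pow,
    roots_X_sub_C] at hroots
  have h2 := congrArg (fun m => (m.map f).sum) hroots
  simp only [Multiset.map_map] at h2
  change _ = ∑ l, f (hA.eigenvalues l) at h2
  rw [← h2]
  simp [Multiset.nsmul_singleton, add_assoc]

lemma exists_eigenvalue_of_charpoly (hA : A.IsHermitian) {lam mu : ℝ} {s t : ℕ}
    (h : A.charpoly = (X - C lam) * X ^ s * (X - C mu) ^ t) (h0 : lam ≠ 0) (hmu : lam ≠ mu) :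
    ∃ l₀, hA.eigenvalues l₀ = lam ∧
      ∀ l ≠ l₀, hA.eigenvalues l = 0 ∨ hA.eigenvalues l = mu := by
  have h1 := hA.sum_eigenvalues_of_charpoly h fun x => if x = lam then 1 else 0
  have h2 := hA.sum_eigenvalues_of_charpoly h
    fun x => if x = lam ∨ x = 0 ∨ x = mu then 0 else 1
  simp only [↓reduceIte, h0.symm, hmu.symm, mul_zero, add_zero, Finset.sum_boole] at h1
  have h3 : (Finset.univ.filter fun l => hA.eigenvalues l = lam).card = 1 := by exact_mod_cast h1
  obtain ⟨l₀, hl₀⟩ := Finset.card_eq_one.1 h3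
  have hiff : ∀ l, hA.eigenvalues l = lam ↔ l = l₀ := fun l => by
    simpa using Finset.ext_iff.1 hl₀ l
  refine ⟨l₀, (hiff _).2 rfl, fun l hl => ?_⟩
  simp only [true_or, or_true, ↓reduceIte, mul_zero, add_zero] at h2
  rw [Finset.sum_eq_zero_iff_of_nonneg (fun _ _ => by positivity)] at h2
  have := h2 l (Finset.mem_univ _)
  grind

end Matrix.IsHermitian

namespace SimpleGraph

/-- A complete multipartite graph with `r` parts, all of size `p`, up to relabelling. -/
lemma completeMultipartiteGraph_iso_fin {ι : Type*} {W : ι → Type*} {r p : ℕ}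
    (e : ι ≃ Fin r) (f : ∀ i, W i ≃ Fin p) :
    Nonempty (completeMultipartiteGraph W ≃g
      completeMultipartiteGraph fun _ : Fin r => Fin p) :=
  ⟨⟨Equiv.sigmaCongr e f, by simp [Equiv.sigmaCongr]⟩⟩

variable {V : Type*} [Fintype V] [DecidableEq V] (G : SimpleGraph V) [DecidableRel G.Adj]

lemma adjMatrix_sq_apply (i j : V) :
    (G.adjMatrix ℝ ^ 2) i j = (G.neighborFinset i ∩ G.neighborFinset j).card := by
  simp only [pow_two, adjMatrix_mul_apply, adjMatrix_apply, Finset.sum_boole]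
  congr 2
  ext k
  simp [G.adj_comm k j]

lemma IsCompleteMultipartite.nonempty_iso_of_card_part_eq {G : SimpleGraph V} [DecidableRel G.Adj]
    (h : G.IsCompleteMultipartite) {p : ℕ} (hp : ∀ v, (G.neighborFinset v)ᶜ.card = p) {r : ℕ}
    (hr : Fintype.card V = r * p) (hp0 : 0 < p) :
    Nonempty (G ≃g completeMultipartiteGraph fun _ : Fin r => Fin p) := by
  classical
  have hcard : ∀ c : Quotient h.setoid, Fintype.card {x // h.setoid.r c.out x} = p := by
    intro c
    rw [← hp c.out, Fintype.card_subtype]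
    congr 1
    ext x
    simp only [Finset.mem_filter, Finset.mem_univ, true_and, Finset.mem_compl, mem_neighborFinset]
    rfl
  have hq : Fintype.card (Quotient h.setoid) = r := by
    have := Fintype.card_congr h.iso.toEquiv
    rw [hr, Fintype.card_sigma, Finset.sum_congr rfl fun c _ => hcard c, Finset.sum_const,
      smul_eq_mul, Finset.card_univ] at this
    exact (Nat.eq_of_mul_eq_mul_right hp0 this).symm
  obtain ⟨φ⟩ := completeMultipartiteGraph_iso_fin (Fintype.equivFinOfCardEq hq)
    fun c => Fintype.equivFinOfCardEq (hcard c)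
  exact ⟨h.iso.trans φ⟩

section RankOne

variable {G} {w : V → ℝ} {mu : ℝ}
  (hw : ∀ i j, (G.adjMatrix ℝ ^ 2) i j - mu * G.adjMatrix ℝ i j = w i * w j)

include hw

lemma sq_eq_degree_of_rank_one (i : V) : w i ^ 2 = G.degree i := by
  have := hw i i
  rw [adjMatrix_sq_apply] at this
  simp at this
  linarith

lemma neighborFinset_eq_of_not_adj (hpos : ∀ i, 0 < w i) {i j : V} (h : ¬ G.Adj i j) :
    G.neighborFinset i = G.neighborFinset j := by
  have hc := hw i j
  rw [adjMatrix_sq_apply] at hc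
  simp only [adjMatrix_apply, h, if_false, mul_zero, sub_zero] at hc
  have hi := sq_eq_degree_of_rank_one hw i
  have hj := sq_eq_degree_of_rank_one hw j
  have hci : ((G.neighborFinset i ∩ G.neighborFinset j).card : ℝ) ≤ G.degree i := by
    exact_mod_cast Finset.card_le_card Finset.inter_subset_left
  have hcj : ((G.neighborFinset i ∩ G.neighborFinset j).card : ℝ) ≤ G.degree j := by
    exact_mod_cast Finset.card_le_card Finset.inter_subset_right
  have hij : w i = w j := by
    apply le_antisymm
    · exact le_of_mul_le_mul_right (by nlinarith) (hpos j)
    · exact le_of_mul_le_mul_left (by nlinarith) (hpos i)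
  have e1 : G.neighborFinset i ∩ G.neighborFinset j = G.neighborFinset i := by
    refine Finset.eq_of_subset_of_card_le Finset.inter_subset_left ?_
    rw [card_neighborFinset_eq_degree, ← Nat.cast_le (α := ℝ), hc, ← hi, ← hij, pow_two]
  have e2 : G.neighborFinset i ∩ G.neighborFinset j = G.neighborFinset j := by
    refine Finset.eq_of_subset_of_card_le Finset.inter_subset_right ?_
    rw [card_neighborFinset_eq_degree, ← Nat.cast_le (α := ℝ), hc, ← hj, ← hij, pow_two]
  exact e1.symm.trans e2

lemma isCompleteMultipartite_of_rank_one (hpos : ∀ i, 0 < w i) : G.IsCompleteMultipartite := by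
  refine ⟨fun i j k hij hjk hik => hjk ?_⟩
  rw [← mem_neighborFinset, ← neighborFinset_eq_of_not_adj hw hpos hij]
  simpa using hik

lemma sq_add_sq_of_adj (hpos : ∀ i, 0 < w i) {i j : V} (h : G.Adj i j) :
    w i ^ 2 + w j ^ 2 = Fintype.card V + mu + w i * w j := by
  have hG := isCompleteMultipartite_of_rank_one hw hpos
  have hc := hw i j
  rw [adjMatrix_sq_apply] at hc
  simp only [adjMatrix_apply, h, if_true, mul_one] at hc
  have hunion : G.neighborFinset i ∪ G.neighborFinset j = Finset.univ := by
    ext k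
    simp only [Finset.mem_union, mem_neighborFinset, Finset.mem_univ, iff_true]
    by_contra! hk
    exact hG.trans i k j hk.1 (fun h => hk.2 h.symm) h
  have hcard := Finset.card_union_add_card_inter (G.neighborFinset i) (G.neighborFinset j)
  rw [hunion, Finset.card_univ, card_neighborFinset_eq_degree,
    card_neighborFinset_eq_degree] at hcard
  have hcard' : (Fintype.card V : ℝ) + (G.neighborFinset i ∩ G.neighborFinset j).card =
    G.degree i + G.degree j := by exact_mod_cast hcard
  rw [sq_eq_degree_of_rank_one hw, sq_eq_degree_of_rank_one hw]
  linarith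

lemma degree_eq_of_rank_one (hpos : ∀ i, 0 < w i) {a b c : V} (hab : G.Adj a b)
    (hac : G.Adj a c) (hbc : G.Adj b c) (i : V) : (G.degree i : ℝ) = Fintype.card V + mu := by
  have hG := isCompleteMultipartite_of_rank_one hw hpos
  have hsymm : ∀ {u v}, ¬ G.Adj u v → ¬ G.Adj v u := fun h h' => h h'.symm
  have common : ∀ i j, G.Adj i j → ∃ k, G.Adj i k ∧ G.Adj j k := by
    intro i j hij
    by_contra! hk
    have ht := hG.trans
    have key : ∀ u v, G.Adj u v → ¬ (¬ G.Adj i u ∧ ¬ G.Adj i v) := fun u v huv h =>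
      ht u i v (hsymm h.1) h.2 huv
    have key' : ∀ u v, G.Adj u v → ¬ (¬ G.Adj j u ∧ ¬ G.Adj j v) := fun u v huv h =>
      ht u j v (hsymm h.1) h.2 huv
    have := key a b hab
    have := key a c hac
    have := key b c hbc
    have := key' a b hab
    have := key' a c hac
    have := key' b c hbc
    have := hk a
    have := hk b
    have := hk c
    tauto
  have hadj : ∀ i j, G.Adj i j → w i = w j := by
    intro i j hij
    obtain ⟨k, hik, hjk⟩ := common i j hij
    have h1 := sq_add_sq_of_adj hw hpos hij
    have h2 := sq_add_sq_of_adj hw hpos hik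
    have h3 := sq_add_sq_of_adj hw hpos hjk
    by_contra hne
    have hk : w i + w j = w k := by
      apply mul_left_cancel₀ (sub_ne_zero.2 hne)
      linear_combination h2 - h3
    have := hpos i
    have := hpos j
    have hkj : w k - w j ≠ 0 := by linarith
    have hi : w j + w k = w i := by
      apply mul_left_cancel₀ hkj
      linear_combination h2 - h1
    linarith
  have hex : ∃ j, G.Adj i j := by
    by_contra! h
    exact hG.trans a i b (hsymm (h a)) (h b) hab
  obtain ⟨j, hj⟩ := hex
  have h1 := sq_add_sq_of_adj hw hpos hj
  rw [← hadj i j hj] at h1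
  rw [← sq_eq_degree_of_rank_one hw]
  linarith

end RankOne

lemma exists_triangle_of_trace_ne_zero (h : (G.adjMatrix ℝ ^ 3).trace ≠ 0) :
    ∃ a b c, G.Adj a b ∧ G.Adj a c ∧ G.Adj b c := by
  contrapose! h
  refine Finset.sum_eq_zero fun i _ => ?_
  rw [Matrix.diag_apply, pow_succ, mul_adjMatrix_apply]
  refine Finset.sum_eq_zero fun j hj => ?_
  rw [mem_neighborFinset] at hj
  rw [adjMatrix_sq_apply, Nat.cast_eq_zero, Finset.card_eq_zero, Finset.eq_empty_iff_forall_notMem]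
  intro k hk
  simp only [Finset.mem_inter, mem_neighborFinset] at hk
  exact h i j k hj hk.1 hk.2

end SimpleGraph

/-- Let `G` be a connected simple graph on `n` vertices whose adjacency
matrix has characteristic polynomial `(X - λ) * X^(n-t-1) * (X - μ)^t`, where `1 ≤ t ≤ n-2`
and `λ > 0 > μ`, and suppose `μ ≠ -λ`.  Then `t ≥ 2`, `μ` is an integer, `λ = -tμ`,
`n = (t+1)·(-μ)`, and `G` is isomorphic to the complete `(t+1)`-partite graph with all
parts of size `-μ`. -/
theorem stmt1 {n t : ℕ} (G : SimpleGraph (Fin n)) [DecidableRel G.Adj]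
    (hconn : G.Connected) (lam mu : ℝ) (hlam : 0 < lam) (hmu : mu < 0)
    (ht1 : 1 ≤ t) (ht2 : t ≤ n - 2)
    (hchar : (G.adjMatrix ℝ).charpoly =
      (X - C lam) * X ^ (n - t - 1) * (X - C mu) ^ t)
    (hne : mu ≠ -lam) :
    2 ≤ t ∧ (∃ m : ℤ, mu = (m : ℝ)) ∧ lam = -(t : ℝ) * mu ∧
      ∃ p : ℕ, 1 ≤ p ∧ (p : ℝ) = -mu ∧ n = (t + 1) * p ∧
        Nonempty (G ≃g SimpleGraph.completeMultipartiteGraph fun _ : Fin (t + 1) => Fin p) := by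
  have hA : (G.adjMatrix ℝ).IsHermitian := by
    rw [Matrix.IsHermitian, Matrix.conjTranspose_eq_transpose_of_trivial, G.transpose_adjMatrix]
  have htr1 := hA.trace_pow_eq_sum_eigenvalues 1
  have htr2 := hA.trace_pow_eq_sum_eigenvalues 2
  have htr3 := hA.trace_pow_eq_sum_eigenvalues 3
  rw [hA.sum_eigenvalues_of_charpoly hchar (· ^ 1)] at htr1
  rw [hA.sum_eigenvalues_of_charpoly hchar (· ^ 2)] at htr2
  rw [hA.sum_eigenvalues_of_charpoly hchar (· ^ 3)] at htr3
  simp only [pow_one, SimpleGraph.trace_adjMatrix, mul_zero, add_zero] at htr1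
  have hlam_eq : lam = -(t : ℝ) * mu := by linarith
  have ht : 2 ≤ t := by
    by_contra hlt
    obtain rfl : t = 1 := by omega
    exact hne (by rw [hlam_eq]; simp)
  have ht' : (2 : ℝ) ≤ t := by exact_mod_cast ht
  have htri : (G.adjMatrix ℝ ^ 3).trace ≠ 0 := by
    rw [htr3, hlam_eq]
    have : (t : ℝ) * (1 - t) * (1 + t) * mu ^ 3 ≠ 0 := by
      refine mul_ne_zero (mul_ne_zero (mul_ne_zero ?_ ?_) ?_) (pow_ne_zero _ hmu.ne) <;> linarith
    convert this using 1
    ring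
  obtain ⟨a, b, c, hab, hac, hbc⟩ := G.exists_triangle_of_trace_ne_zero htri
  obtain ⟨l₀, hl₀, hl⟩ := hA.exists_eigenvalue_of_charpoly hchar hlam.ne' (by linarith)
  obtain ⟨v, hv⟩ := hA.exists_sq_sub_mul_eq_mul l₀ hl₀ (by nlinarith) hl
  have hw : ∀ i j, (G.adjMatrix ℝ ^ 2) i j - mu * G.adjMatrix ℝ i j = |v i| * |v j| := by
    intro i j
    rw [← abs_mul, ← hv, abs_of_nonneg]
    rw [G.adjMatrix_sq_apply, SimpleGraph.adjMatrix_apply]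
    split_ifs
    · have : (0 : ℝ) ≤ (G.neighborFinset i ∩ G.neighborFinset j).card := by positivity
      linarith
    · simp
  have : Nontrivial (Fin n) := ⟨a, b, hab.ne⟩
  have hpos : ∀ i, 0 < |v i| := by
    intro i
    have h1 := SimpleGraph.sq_eq_degree_of_rank_one hw i
    have h2 : (0 : ℝ) < G.degree i := by
      exact_mod_cast hconn.preconnected.degree_pos_of_nontrivial i
    rw [abs_pos]
    intro h0
    rw [h0, abs_zero] at h1
    linarith
  have hdeg := SimpleGraph.degree_eq_of_rank_one hw hpos hab hac hbc
  have hcompl : ∀ i, ((G.neighborFinset i)ᶜ.card : ℝ) = -mu := by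
    intro i
    have h1 := hdeg i
    have h2 := Finset.card_add_card_compl (G.neighborFinset i)
    rw [G.card_neighborFinset_eq_degree] at h2
    have h3 : (G.degree i : ℝ) + (G.neighborFinset i)ᶜ.card = Fintype.card (Fin n) := by
      exact_mod_cast h2
    linarith
  obtain ⟨p, hp⟩ : ∃ p : ℕ, (p : ℝ) = -mu := ⟨_, hcompl a⟩
  have hp0 : 0 < p := by
    rw [← Nat.cast_pos (α := ℝ)]
    linarith
  have hn : n = (t + 1) * p := by
    have h1 : (G.adjMatrix ℝ ^ 2).trace = n * (n + mu) := by
      rw [pow_two, Matrix.trace]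
      simp only [Matrix.diag_apply, G.adjMatrix_mul_self_apply_self, hdeg]
      simp [mul_add]
    obtain rfl : mu = -p := by linarith
    rw [h1, hlam_eq] at htr2
    have h2 : ((n : ℝ) - (t + 1) * p) * (n + t * p) = 0 := by linear_combination htr2
    have h3 : (n : ℝ) + t * p ≠ 0 := by positivity
    have h4 := (mul_eq_zero.1 h2).resolve_right h3
    have h5 : (n : ℝ) = (t + 1) * p := by linarith
    exact_mod_cast h5
  refine ⟨ht, ⟨-p, by push_cast; linarith⟩, hlam_eq, p, hp0, hp, hn, ?_⟩
  refine (SimpleGraph.isCompleteMultipartite_of_rank_one hw hpos).nonempty_iso_of_card_part_eq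
    (fun i => ?_) (by simpa using hn) hp0
  have := hcompl i
  rw [← hp] at this
  exact_mod_cast this
end

section
/- Let G be a connected bipartite simple graph whose adjacency matrix has exactly three distinct eigenvalues. Then G is isomorphic to a complete bipartite graph K_{p,q} for some integers p, q ≥ 1. -/
open Polynomial

namespace SimpleGraph

variable {V : Type*} [Fintype V] [DecidableEq V] {G : SimpleGraph V} [DecidableRel G.Adj]

/-- The spectrum of a bipartite graph is symmetric about zero. -/
lemma Coloring.isRoot_charpoly_neg (c : G.Coloring (Fin 2)) {x : ℝ}
    (hx : (G.adjMatrix ℝ).charpoly.IsRoot x) : (G.adjMatrix ℝ).charpoly.IsRoot (-x) := by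
  set s : V → ℝ := fun v => if c v = 0 then 1 else -1 with hs
  have hconj : Matrix.scalar V (-x) - G.adjMatrix ℝ =
      -(Matrix.diagonal s * (Matrix.scalar V x - G.adjMatrix ℝ) * Matrix.diagonal s) := by
    ext i j
    simp only [Matrix.neg_apply, Matrix.mul_diagonal, Matrix.diagonal_mul, Matrix.sub_apply,
      Matrix.scalar_apply, Matrix.diagonal_apply, adjMatrix_apply]
    by_cases hij : i = j
    · subst hij
      by_cases h : c i = 0 <;> simp [hs, h]
    · by_cases ha : G.Adj i j
      · have hc := c.valid ha
        by_cases h : c i = 0 <;> by_cases h' : c j = 0 <;> simp [hs, h, h', hij, ha] <;> omega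
      · simp [hij, ha]
  rw [Polynomial.IsRoot, Matrix.eval_charpoly] at hx ⊢
  rw [hconj, Matrix.det_neg, Matrix.det_mul, Matrix.det_mul, hx]
  simp

end SimpleGraph

/-- A three-element set of reals closed under negation has the form `{0, θ, -θ}`. -/
lemma Finset.exists_cube_eq_mul_of_neg_mem {S : Finset ℝ} (hS : S.card = 3)
    (hneg : ∀ x ∈ S, -x ∈ S) : ∃ t : ℝ, ∀ x ∈ S, x ^ 3 = t * x := by
  obtain ⟨a, b, c, hab, hac, hbc, rfl⟩ := Finset.card_eq_three.mp hS
  simp only [Finset.mem_insert, Finset.mem_singleton, forall_eq_or_imp, forall_eq] at hneg ⊢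
  refine ⟨(a ^ 2 + b ^ 2 + c ^ 2) / 2, ?_⟩
  obtain ⟨ha, hb, hc⟩ := hneg
  grind

/-- If every eigenvalue of a Hermitian matrix satisfies `x ^ 3 = t * x`, so does the matrix. -/
lemma Matrix.IsHermitian.pow_three_eq_smul {n : Type*} [Fintype n] [DecidableEq n]
    {A : Matrix n n ℝ} (hA : A.IsHermitian) {t : ℝ}
    (ht : ∀ x ∈ A.charpoly.roots, x ^ 3 = t * x) : A ^ 3 = t • A := by
  have hev (i : n) : hA.eigenvalues i ^ 3 = t * hA.eigenvalues i := by
    apply ht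
    rw [hA.roots_charpoly_eq_eigenvalues]
    simp
  rw [hA.spectral_theorem, ← map_pow, ← map_smul, Matrix.diagonal_pow]
  congr 1
  ext i j
  by_cases hij : i = j
  · subst hij
    simpa using hev i
  · simp [hij]

namespace SimpleGraph

variable {V : Type*} {G : SimpleGraph V}

/-- If walks of length three in a connected bipartite graph always join adjacent vertices, then
vertices of different colors are adjacent and distinct vertices of the same color have a common
neighbor. -/
lemma Coloring.adj_or_exists_common_neighbor (c : G.Coloring (Fin 2))
    (hG : ∀ u v w x, G.Adj u v → G.Adj v w → G.Adj w x → G.Adj u x) {u v : V}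
    (huv : G.Reachable u v) :
    (c u ≠ c v ∧ G.Adj u v) ∨ (c u = c v ∧ (u = v ∨ ∃ w, G.Adj u w ∧ G.Adj w v)) := by
  rw [reachable_iff_reflTransGen] at huv
  induction huv with
  | refl => simp
  | @tail y z _ hyz ih =>
    have hc := c.valid hyz
    rcases ih with ⟨h, ha⟩ | ⟨h, rfl | ⟨w, hw, hwy⟩⟩
    · exact Or.inr ⟨by omega, Or.inr ⟨y, ha, hyz⟩⟩
    · exact Or.inl ⟨hc, hyz⟩
    · exact Or.inl ⟨h ▸ hc, hG _ _ _ _ hw hwy hyz⟩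

/-- A graph whose edges are exactly the pairs of differently colored vertices is complete
bipartite. -/
lemma nonempty_iso_completeBipartiteGraph [Fintype V] (c : V → Fin 2)
    (hc : ∀ u v, G.Adj u v ↔ c u ≠ c v) :
    Nonempty (G ≃g completeBipartiteGraph (Fin (Fintype.card {v // c v = 0}))
      (Fin (Fintype.card {v // ¬ c v = 0}))) := by
  have e : completeBipartiteGraph {v // c v = 0} {v // ¬ c v = 0} ≃g G :=
    { toEquiv := Equiv.sumCompl fun v => c v = 0
      map_rel_iff' := by
        rintro (⟨a, ha⟩ | ⟨a, ha⟩) (⟨b, hb⟩ | ⟨b, hb⟩) <;> simp [hc] <;> omega }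
  exact ⟨e.symm.trans (completeBipartiteGraphCongr (Fintype.equivFin _) (Fintype.equivFin _))⟩

end SimpleGraph

/-- A connected bipartite simple graph whose adjacency matrix has exactly
three distinct eigenvalues is isomorphic to a complete bipartite graph `K_{p,q}`
with `p, q ≥ 1`. -/
theorem stmt3 {V : Type*} [Fintype V] [DecidableEq V] (G : SimpleGraph V)
    [DecidableRel G.Adj] (hconn : G.Connected) (hbip : G.Colorable 2)
    (h3 : (G.adjMatrix ℝ).charpoly.roots.toFinset.card = 3) :
    ∃ p q : ℕ, 1 ≤ p ∧ 1 ≤ q ∧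
      Nonempty (G ≃g completeBipartiteGraph (Fin p) (Fin q)) := by
  obtain ⟨c⟩ := hbip
  have hne : (G.adjMatrix ℝ).charpoly ≠ 0 := (Matrix.charpoly_monic _).ne_zero
  obtain ⟨t, ht⟩ := Finset.exists_cube_eq_mul_of_neg_mem h3 fun x hx => by
    rw [Multiset.mem_toFinset, mem_roots hne] at hx ⊢
    exact c.isRoot_charpoly_neg hx
  have hcube : G.adjMatrix ℝ ^ 3 = t • G.adjMatrix ℝ :=
    Matrix.IsHermitian.pow_three_eq_smul (by simp [Matrix.IsHermitian])
      fun x hx => ht x (Multiset.mem_toFinset.mpr hx)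
  have hwalk (u v w x : V) (huv : G.Adj u v) (hvw : G.Adj v w) (hwx : G.Adj w x) :
      G.Adj u x := by
    by_contra hux
    have hentry := congr_fun₂ hcube u x
    rw [SimpleGraph.adjMatrix_pow_apply_eq_card_walk] at hentry
    simp only [Matrix.smul_apply, SimpleGraph.adjMatrix_apply, hux, if_false, smul_zero,
      Nat.cast_eq_zero, Fintype.card_eq_zero_iff] at hentry
    exact hentry.false ⟨.cons huv (.cons hvw (.cons hwx .nil)), rfl⟩
  have hjoin (u v : V) := c.adj_or_exists_common_neighbor hwalk (hconn.preconnected u v)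
  have hadj (u v : V) : G.Adj u v ↔ c u ≠ c v :=
    ⟨fun h => c.valid h, fun h => by grind⟩
  have hcard : 1 < Fintype.card V := by
    have h1 := Multiset.toFinset_card_le (G.adjMatrix ℝ).charpoly.roots
    have h2 := (G.adjMatrix ℝ).charpoly.card_roots'
    rw [Matrix.charpoly_natDegree_eq_dim] at h2
    omega
  obtain ⟨u, v, huv⟩ := Fintype.one_lt_card_iff.mp hcard
  obtain ⟨a, b, hab⟩ : ∃ a b, c a ≠ c b := by
    rcases hjoin u v with ⟨h, -⟩ | ⟨-, h | ⟨w, h, -⟩⟩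
    · exact ⟨u, v, h⟩
    · exact absurd h huv
    · exact ⟨u, w, c.valid h⟩
  refine ⟨_, _, Fintype.card_pos_iff.mpr ?_, Fintype.card_pos_iff.mpr ?_,
    SimpleGraph.nonempty_iso_completeBipartiteGraph c hadj⟩
  · by_cases h : c a = 0
    · exact ⟨a, h⟩
    · exact ⟨b, by omega⟩
  · by_cases h : c a = 0
    · exact ⟨b, by omega⟩
    · exact ⟨a, h⟩
end

section
/- Let G be a connected simple graph whose adjacency matrix has exactly three distinct eigenvalues. Then the smallest eigenvalue of G is at most −√2. -/
open Polynomial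

/-- If every eigenvalue of a real symmetric matrix exceeds `-c`, then its quadratic form shifted
by `c` is positive definite. -/
theorem Matrix.IsHermitian.posDef_algebraMap_add {n : Type*} [Fintype n] [DecidableEq n]
    {A : Matrix n n ℝ} (hA : A.IsHermitian) {c : ℝ}
    (h : ∀ x ∈ A.charpoly.roots, -c < x) : (algebraMap ℝ (Matrix n n ℝ) c + A).PosDef := by
  have hB : (algebraMap ℝ (Matrix n n ℝ) c + A).IsHermitian := by
    refine Matrix.IsHermitian.add ?_ hA
    rw [Matrix.algebraMap_eq_diagonal]
    exact Matrix.isHermitian_diagonal _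
  rw [hB.posDef_iff_eigenvalues_pos]
  intro i
  have hi := hB.eigenvalues_mem_spectrum_real i
  rw [← sub_add_cancel (hB.eigenvalues i) c, spectrum.add_mem_add_iff,
    Matrix.mem_spectrum_iff_isRoot_charpoly] at hi
  have := h _ ((Polynomial.mem_roots A.charpoly_monic.ne_zero).2 hi)
  linarith

/-- A graph with an induced path on three vertices has an eigenvalue at most `-√2`. -/
theorem SimpleGraph.exists_charpoly_root_le_neg_sqrt_two {V : Type*} [Fintype V] [DecidableEq V]
    (G : SimpleGraph V) [DecidableRel G.Adj] {a b c : V} (hab : G.Adj a b) (hbc : G.Adj b c)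
    (hac : ¬ G.Adj a c) (hne : a ≠ c) :
    ∃ x ∈ (G.adjMatrix ℝ).charpoly.roots, x ≤ -Real.sqrt 2 := by
  by_contra! h
  have hpos := (G.isHermitian_adjMatrix ℝ).posDef_algebraMap_add h
  have hca : ¬ G.Adj c a := fun h ↦ hac h.symm
  have hx : (Pi.single a 1 + Pi.single c 1 - Pi.single b (Real.sqrt 2) : V → ℝ) ≠ 0 := by
    intro h0
    simpa [hne, hab.ne] using congrFun h0 a
  have := hpos.dotProduct_mulVec_pos hx
  have h2 : Real.sqrt 2 * Real.sqrt 2 = 2 := Real.mul_self_sqrt (by norm_num)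
  simp [Matrix.mulVec_add, Matrix.mulVec_sub, Matrix.algebraMap_eq_diagonal,
    Matrix.col_apply, hab, hab.symm, hbc, hbc.symm, hac, hca, hne, hne.symm, hab.ne, hab.ne',
    hbc.ne, hbc.ne'] at this
  nlinarith

/-- Every eigenvalue of the complete graph on `V` is `-1` or `|V| - 1`. -/
theorem SimpleGraph.eq_or_eq_of_mem_roots_charpoly_of_forall_adj {V : Type*} [Fintype V]
    [DecidableEq V] (G : SimpleGraph V) [DecidableRel G.Adj] (hG : ∀ u v, u ≠ v → G.Adj u v)
    {x : ℝ} (hx : x ∈ (G.adjMatrix ℝ).charpoly.roots) : x = -1 ∨ x = Fintype.card V - 1 := by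
  rw [Polynomial.mem_roots (Matrix.charpoly_monic _).ne_zero,
    ← Matrix.mem_spectrum_iff_isRoot_charpoly, ← Matrix.spectrum_toLin',
    ← Module.End.hasEigenvalue_iff_mem_spectrum] at hx
  obtain ⟨v, hv⟩ := hx.exists_hasEigenvector
  have key (i : V) : ∑ j, v j = (x + 1) * v i := by
    have hi := congrFun hv.apply_eq_smul i
    have hnb : G.neighborFinset i = Finset.univ.erase i := by
      ext j
      simpa using ⟨fun h ↦ h.ne', fun h ↦ hG i j (Ne.symm h)⟩
    rw [Matrix.toLin'_apply, SimpleGraph.adjMatrix_mulVec_apply, hnb, Pi.smul_apply,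
      smul_eq_mul] at hi
    rw [← Finset.sum_erase_add _ _ (Finset.mem_univ i), hi]
    ring
  rw [or_iff_not_imp_left]
  intro hx1
  have hx1 : x + 1 ≠ 0 := fun h ↦ hx1 (by linarith)
  have hs : ∑ j, v j ≠ 0 := by
    refine fun h0 ↦ hv.2 (funext fun i ↦ ?_)
    have := key i
    simp_all
  have hsum : (Fintype.card V : ℝ) * ∑ j, v j = (x + 1) * ∑ j, v j := by
    rw [Finset.mul_sum (a := x + 1), ← Finset.sum_congr rfl fun i _ ↦ key i]
    simp
  linarith [mul_right_cancel₀ hs hsum]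

/-- A connected simple graph whose adjacency matrix has exactly three
distinct eigenvalues has smallest eigenvalue at most `-√2`, i.e. it has an eigenvalue
which is at most `-√2`. -/
theorem stmt4 {V : Type*} [Fintype V] [DecidableEq V] (G : SimpleGraph V)
    [DecidableRel G.Adj] (hconn : G.Connected)
    (h3 : (G.adjMatrix ℝ).charpoly.roots.toFinset.card = 3) :
    ∃ x ∈ (G.adjMatrix ℝ).charpoly.roots, x ≤ -Real.sqrt 2 := by
  by_cases hG : ∀ u v, u ≠ v → G.Adj u v
  · have hsub : (G.adjMatrix ℝ).charpoly.roots.toFinset ⊆ {-1, (Fintype.card V - 1 : ℝ)} := by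
      intro x hx
      simpa using
        G.eq_or_eq_of_mem_roots_charpoly_of_forall_adj hG (Multiset.mem_toFinset.1 hx)
    have := (Finset.card_le_card hsub).trans Finset.card_le_two
    omega
  · push Not at hG
    obtain ⟨u, v, huv, hadj⟩ := hG
    obtain ⟨p, hp⟩ := hconn.exists_walk_length_eq_dist u v
    obtain ⟨a, b, c, hab, hbc, hac, hne⟩ := p.exists_adj_adj_not_adj_ne hp
      ((hconn u v).one_lt_dist_of_ne_of_not_adj huv hadj)
    exact G.exists_charpoly_root_le_neg_sqrt_two hab hbc hac hne
end

section
/- Let G be a connected simple graph on n vertices whose adjacency matrix has characteristic polynomial (X − λ)·(X − μ)^(n−t−1)·(X + μ)^t, where 1 ≤ t ≤ n−2 and λ > μ > 0 are real numbers. Then λ and μ are integers, λ = (2t − n + 1)·μ, and μ ≥ 2. -/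
open Polynomial

namespace Matrix.IsHermitian

variable {ι : Type*} [Fintype ι] [DecidableEq ι] {A : Matrix ι ι ℝ}

theorem aeval_eq_eigenvectorUnitary_mul (hA : A.IsHermitian) (p : ℝ[X]) :
    aeval A p = (hA.eigenvectorUnitary : Matrix ι ι ℝ) *
      diagonal (fun i => p.eval (hA.eigenvalues i)) *
        star (hA.eigenvectorUnitary : Matrix ι ι ℝ) := by
  have h : A = Unitary.conjStarAlgAut ℝ _ hA.eigenvectorUnitary (diagonal hA.eigenvalues) :=
    hA.spectral_theorem
  have h2 : aeval (diagonal hA.eigenvalues) p =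
      diagonal (fun i => p.eval (hA.eigenvalues i)) := by
    have h3 := aeval_algHom_apply (diagonalAlgHom ℝ (n := ι) (α := ℝ)) hA.eigenvalues p
    simp only [diagonalAlgHom_apply] at h3
    rw [h3]
    congr 1
    ext i
    rw [aeval_pi_apply]
    exact congrFun (coe_aeval_eq_eval _) p
  conv_lhs => rw [h]
  have h4 := aeval_algHom_apply
    (Unitary.conjStarAlgAut ℝ (Matrix ι ι ℝ) hA.eigenvectorUnitary) (diagonal hA.eigenvalues) p
  rw [h2] at h4
  exact h4.trans (Unitary.conjStarAlgAut_apply _ _)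

theorem trace_aeval (hA : A.IsHermitian) (p : ℝ[X]) :
    (aeval A p).trace = (A.charpoly.roots.map fun x => p.eval x).sum := by
  rw [hA.aeval_eq_eigenvectorUnitary_mul, trace_mul_cycle, Unitary.coe_star_mul_self, one_mul,
    trace_diagonal, hA.roots_charpoly_eq_eigenvalues, Multiset.map_map]
  rfl

/-- If `p` vanishes at all eigenvalues but one simple eigenvalue, then `p(A)` has rank at most
one. -/
theorem aeval_apply_mul_aeval_apply (hA : A.IsHermitian) {p : ℝ[X]} {a : ℝ} {s : Multiset ℝ}
    (hs : A.charpoly.roots = a ::ₘ s) (hp : ∀ x ∈ s, p.eval x = 0) (i j : ι) :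
    aeval A p i j * aeval A p j i = aeval A p i i * aeval A p j j := by
  rw [hA.roots_charpoly_eq_eigenvalues, ← Multiset.map_eq_cons] at hs
  obtain ⟨k, -, -, hk⟩ := hs
  have h0 : ∀ l, l ≠ k → p.eval (hA.eigenvalues l) = 0 := by
    intro l hl
    apply hp
    rw [← hk]
    exact Multiset.mem_map_of_mem _ ((Multiset.mem_erase_of_ne hl).2 (Finset.mem_univ l))
  have h1 : ∀ i j, aeval A p i j = (hA.eigenvectorUnitary : Matrix ι ι ℝ) i k *
      p.eval (hA.eigenvalues k) * (hA.eigenvectorUnitary : Matrix ι ι ℝ) j k := by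
    intro i j
    rw [hA.aeval_eq_eigenvectorUnitary_mul, mul_apply, Finset.sum_eq_single k]
    · rw [mul_diagonal, star_apply, star_trivial]
    · intro l _ hl
      rw [mul_diagonal, h0 l hl, mul_zero, zero_mul]
    · simp
  simp only [h1]
  ring

end Matrix.IsHermitian

namespace SimpleGraph

theorem Connected.eq_top_of_adj_trans {V : Type*} {G : SimpleGraph V} (hconn : G.Connected)
    (h : ∀ u v w, G.Adj u v → G.Adj v w → u ≠ w → G.Adj u w) : G = ⊤ := by
  have key : ∀ u v, G.Walk u v → u ≠ v → G.Adj u v := by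
    intro u v p
    induction p with
    | nil => exact fun h => absurd rfl h
    | @cons u v w huv p ih =>
      intro huw
      by_cases hvw : v = w
      · exact hvw ▸ huv
      · exact h u v w huv (ih hvw) huw
  ext u v
  rw [top_adj]
  exact ⟨Adj.ne, fun huv => key u v (hconn u v).some huv⟩

variable {V : Type*} [Fintype V] [DecidableEq V] (G : SimpleGraph V) [DecidableRel G.Adj]

theorem adjMatrix_mul_self_apply {R : Type*} [NonAssocSemiring R] (v w : V) :
    (G.adjMatrix R * G.adjMatrix R) v w =
      ((G.neighborFinset v ∩ G.neighborFinset w).card : R) := by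
  rw [adjMatrix_mul_apply]
  simp only [adjMatrix_apply, Finset.sum_boole]
  congr 2
  ext u
  simp [G.adj_comm u w]

variable {G}

/-- A connected graph is complete if `(A² - 1)` has vanishing principal minors of size two,
where `A` is the adjacency matrix. -/
theorem Connected.eq_top_of_sq_card_commonNeighbors (hconn : G.Connected)
    (h : ∀ u v, u ≠ v → ((G.neighborFinset u ∩ G.neighborFinset v).card : ℤ) ^ 2 =
      (G.degree u - 1) * (G.degree v - 1)) : G = ⊤ := by
  have hdeg : ∀ u v, G.Adj u v → 1 < G.degree u →
      G.degree u ≤ G.degree v → G.degree u = G.degree v := by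
    intro u v huv hu hle
    have hlt : (G.neighborFinset u ∩ G.neighborFinset v).card < G.degree u := by
      rw [← card_neighborFinset_eq_degree]
      apply Finset.card_lt_card
      refine ⟨Finset.inter_subset_left, fun hs => ?_⟩
      have := hs ((G.mem_neighborFinset u v).2 huv)
      simp at this
    have := h u v huv.ne
    zify at *
    nlinarith
  refine hconn.eq_top_of_adj_trans fun u v w huv hvw huw => ?_
  have hpos : 0 < (G.neighborFinset u ∩ G.neighborFinset w).card :=
    Finset.card_pos.2 ⟨v, by simp [huv, hvw.symm]⟩
  have hu0 : 0 < G.degree u := (G.degree_pos_iff_exists_adj u).2 ⟨v, huv⟩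
  have hu : 1 < G.degree u := by
    by_contra hcon
    have hu1 : G.degree u = 1 := by omega
    have := h u w huw
    rw [hu1] at this
    simp only [Nat.cast_one, sub_self, zero_mul, sq_eq_zero_iff] at this
    omega
  have hv : 1 < G.degree v := by
    rw [← card_neighborFinset_eq_degree, Finset.one_lt_card]
    exact ⟨u, by simpa using huv.symm, w, by simpa using hvw, huw⟩
  have hd : G.degree u = G.degree v := by
    rcases le_total (G.degree u) (G.degree v) with hle | hle
    · exact hdeg u v huv hu hle
    · exact (hdeg v u huv.symm hv hle).symm
  have hc : (G.neighborFinset u ∩ G.neighborFinset v).card = G.degree v - 1 := by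
    have h1 := h u v huv.ne
    rw [hd, ← sq] at h1
    have h2 := (sq_eq_sq₀ (by positivity) (by omega)).1 h1
    omega
  have hsub : G.neighborFinset u ∩ G.neighborFinset v ⊆ (G.neighborFinset v).erase u := by
    intro x hx
    simp only [Finset.mem_inter, mem_neighborFinset, Finset.mem_erase] at hx ⊢
    exact ⟨hx.1.ne', hx.2⟩
  have heq := Finset.eq_of_subset_of_card_le hsub (by
    rw [hc, Finset.card_erase_of_mem (by simpa using huv.symm), card_neighborFinset_eq_degree])
  have hw : w ∈ (G.neighborFinset v).erase u := by simp [huw.symm, hvw]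
  rw [← heq] at hw
  simpa using (Finset.mem_inter.1 hw).1

variable (G)

theorem map_adjMatrix {V R S : Type*} (G : SimpleGraph V) [DecidableRel G.Adj]
    [NonAssocSemiring R] [NonAssocSemiring S] (f : R →+* S) :
    (G.adjMatrix R).map f = G.adjMatrix S := by
  ext i j
  simp [adjMatrix_apply, apply_ite f]

theorem exists_trace_adjMatrix_pow_eq_intCast (k : ℕ) :
    ∃ z : ℤ, (G.adjMatrix ℝ ^ k).trace = z := by
  refine ⟨(G.adjMatrix ℤ ^ k).trace, ?_⟩
  rw [← map_adjMatrix G (Int.castRingHom ℝ), ← Matrix.map_pow, ← AddMonoidHom.map_trace]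
  rfl

variable {G}

/-- A rational eigenvalue of a graph is an integer. -/
theorem exists_intCast_of_isRoot_charpoly_adjMatrix {q : ℚ}
    (hq : (G.adjMatrix ℝ).charpoly.IsRoot q) : ∃ z : ℤ, (q : ℝ) = z := by
  rw [← map_adjMatrix G (Int.castRingHom ℝ), Matrix.charpoly_map] at hq
  have h0 : aeval q (G.adjMatrix ℤ).charpoly = 0 := by
    apply (algebraMap ℚ ℝ).injective
    rw [← aeval_algebraMap_apply, map_zero]
    simpa [IsRoot, eval_map, aeval_def] using hq
  obtain ⟨z, hz⟩ := exists_integer_of_is_root_of_monic (Matrix.charpoly_monic _) h0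
  refine ⟨z, ?_⟩
  rw [hz.1]
  simp

end SimpleGraph

/-- Let `G` be a connected simple graph on `n` vertices whose adjacency
matrix has characteristic polynomial `(X - λ)(X - μ)^(n-t-1)(X + μ)^t`, where
`1 ≤ t ≤ n-2` and `λ > μ > 0`.  Then `λ` and `μ` are integers,
`λ = (2t - n + 1)·μ`, and `μ ≥ 2`. -/
theorem stmt5 {n t : ℕ} (G : SimpleGraph (Fin n)) [DecidableRel G.Adj]
    (hconn : G.Connected) (lam mu : ℝ) (hlm : mu < lam) (hmu : 0 < mu)
    (ht1 : 1 ≤ t) (ht2 : t ≤ n - 2)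
    (hchar : (G.adjMatrix ℝ).charpoly =
      (X - C lam) * (X - C mu) ^ (n - t - 1) * (X + C mu) ^ t) :
    (∃ a : ℤ, lam = (a : ℝ)) ∧ (∃ b : ℤ, mu = (b : ℝ)) ∧
      lam = (2 * (t : ℝ) - n + 1) * mu ∧ 2 ≤ mu := by
  have hA : (G.adjMatrix ℝ).IsHermitian := by
    rw [Matrix.IsHermitian, Matrix.conjTranspose_eq_transpose_of_trivial]
    exact G.transpose_adjMatrix
  have hroots : (G.adjMatrix ℝ).charpoly.roots =
      lam ::ₘ (Multiset.replicate (n - t - 1) mu + Multiset.replicate t (-mu)) := by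
    have h1 : (X - C mu) ^ (n - t - 1) ≠ 0 := pow_ne_zero _ (X_sub_C_ne_zero mu)
    have h2 : (X + C mu) ^ t ≠ 0 := pow_ne_zero _ (X_add_C_ne_zero mu)
    have h3 := X_sub_C_ne_zero lam
    rw [hchar, roots_mul (mul_ne_zero (mul_ne_zero h3 h1) h2), roots_mul (mul_ne_zero h3 h1),
      roots_pow, roots_pow, roots_X_sub_C, roots_X_sub_C, roots_X_add_C,
      Multiset.nsmul_singleton, Multiset.nsmul_singleton, add_assoc, Multiset.singleton_add]
  have hcast : ((n - t - 1 : ℕ) : ℝ) = n - t - 1 := by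
    rw [Nat.cast_sub (by omega), Nat.cast_sub (by omega), Nat.cast_one]
  have htr : ∀ k, (G.adjMatrix ℝ ^ k).trace =
      lam ^ k + ((n - t - 1 : ℝ) * mu ^ k + t * (-mu) ^ k) := by
    intro k
    have := hA.trace_aeval (X ^ k)
    rw [hroots] at this
    simpa [hcast] using this
  have hlam : lam = (2 * (t : ℝ) - n + 1) * mu := by
    have := htr 1
    rw [pow_one, SimpleGraph.trace_adjMatrix] at this
    linarith
  set m : ℤ := 2 * t - n + 1 with hm
  have hmR : (m : ℝ) = 2 * (t : ℝ) - n + 1 := by simp [hm]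
  have hm1 : (1 : ℤ) < m := by
    have : (1 : ℝ) < m := by
      rw [hmR]
      by_contra! hcon
      nlinarith
    exact_mod_cast this
  obtain ⟨a, ha⟩ := G.exists_trace_adjMatrix_pow_eq_intCast 2
  obtain ⟨b, hb⟩ := G.exists_trace_adjMatrix_pow_eq_intCast 3
  rw [htr, hlam, ← hmR] at ha hb
  have ha' : mu ^ 2 * (m ^ 2 + (n - 1) : ℝ) = a := by rw [← ha]; ring
  have hb' : mu ^ 3 * (m ^ 3 - m : ℝ) = b := by rw [← hb]; linear_combination (mu ^ 3) * (- hmR)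
  have hn : (1 : ℝ) ≤ n := by exact_mod_cast (by omega : 1 ≤ n)
  have hmR1 : (1 : ℝ) < m := by exact_mod_cast hm1
  have hpos2 : (0 : ℝ) < m ^ 2 + (n - 1) := by nlinarith
  have hpos3 : (0 : ℝ) < m ^ 3 - m := by
    have : (0 : ℝ) < m * ((m - 1) * (m + 1)) := by
      apply mul_pos (by linarith) (mul_pos (by linarith) (by linarith))
    linarith
  have hapos : (0 : ℝ) < a := by rw [← ha']; positivity
  have hmuq : mu = ((b * (m ^ 2 + (n - 1)) / (a * (m ^ 3 - m)) : ℚ) : ℝ) := by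
    push_cast
    rw [eq_div_iff (by positivity), ← ha', ← hb']
    ring
  have hmuroot : (G.adjMatrix ℝ).charpoly.IsRoot mu := by
    have hk : n - t - 1 ≠ 0 := by omega
    simp [hchar, hk]
  obtain ⟨z, hz⟩ : ∃ z : ℤ, mu = z := by
    rw [hmuq] at hmuroot ⊢
    exact SimpleGraph.exists_intCast_of_isRoot_charpoly_adjMatrix hmuroot
  refine ⟨⟨m * z, by rw [hlam, ← hmR, hz]; push_cast; rfl⟩, ⟨z, hz⟩, hlam, ?_⟩
  by_contra! hlt
  have hz1 : z = 1 := by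
    rw [hz] at hlt hmu
    norm_cast at hlt hmu
    omega
  have hmu1 : mu = 1 := by rw [hz, hz1, Int.cast_one]
  have haeval : aeval (G.adjMatrix ℝ) (X ^ 2 - 1 : ℝ[X]) =
      G.adjMatrix ℝ * G.adjMatrix ℝ - 1 := by simp [sq]
  have htop : G = ⊤ := by
    refine hconn.eq_top_of_sq_card_commonNeighbors fun u v huv => ?_
    have := hA.aeval_apply_mul_aeval_apply (p := X ^ 2 - 1) hroots (by
      intro x hx
      rw [hmu1, Multiset.mem_add] at hx
      rcases hx with hx | hx <;> simp [Multiset.eq_of_mem_replicate hx]) u v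
    simp only [haeval, Matrix.sub_apply, Matrix.one_apply_eq, Matrix.one_apply_ne huv,
      Matrix.one_apply_ne huv.symm, SimpleGraph.adjMatrix_mul_self_apply, Finset.inter_self,
      SimpleGraph.card_neighborFinset_eq_degree, sub_zero] at this
    rw [Finset.inter_comm (G.neighborFinset v), ← sq] at this
    exact_mod_cast this
  have hsum : (G.adjMatrix ℝ ^ 2).trace = n * (n - 1 : ℝ) := by
    have hdeg : ∀ v, G.degree v = n - 1 := by
      intro v
      have hv : G.neighborFinset v = Finset.univ.erase v := by
        ext w
        simp [htop, eq_comm]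
      rw [← SimpleGraph.card_neighborFinset_eq_degree, hv, Finset.card_erase_of_mem (by simp),
        Finset.card_univ, Fintype.card_fin]
    rw [sq, Matrix.trace]
    simp only [Matrix.diag_apply, SimpleGraph.adjMatrix_mul_self_apply_self, hdeg,
      Finset.sum_const, Finset.card_univ, Fintype.card_fin, nsmul_eq_mul]
    rw [Nat.cast_sub (by omega), Nat.cast_one]
  rw [htr, hlam, hmu1] at hsum
  have htn : (t : ℝ) + 2 ≤ n := by exact_mod_cast (by omega : t + 2 ≤ n)
  rw [hmR] at hmR1
  nlinarith
end

section
/- Let G be a connected simple graph on n vertices whose adjacency matrix has characteristic polynomial (X − λ)·(X − μ)^(n−t−1)·(X + μ)^t, where 1 ≤ t ≤ n−2 and λ > μ > 0. Then G is a regular graph if and only if G is strongly regular with parameters (n, λ, λ − μ², λ − μ²) (in particular, if G is regular then its degree is λ and any two vertices, adjacent or not, have exactly λ − μ² common neighbors). -/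
open Polynomial

/-- A real polynomial vanishing on the eigenvalues of a Hermitian matrix annihilates it. -/
theorem Matrix.IsHermitian.aeval_eq_zero_of_forall_isRoot_charpoly {V : Type*} [Fintype V]
    [DecidableEq V] {A : Matrix V V ℝ} (hA : A.IsHermitian) (p : ℝ[X])
    (hp : ∀ x, A.charpoly.IsRoot x → p.eval x = 0) : aeval A p = 0 := by
  have hA' : IsSelfAdjoint A := hA
  rw [← cfc_polynomial p A hA', cfc_congr (g := fun _ => (0 : ℝ))]
  · exact cfc_const_zero ℝ A
  · intro x hx
    exact hp x (Matrix.mem_spectrum_iff_isRoot_charpoly.mp hx)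

namespace SimpleGraph

variable {V : Type*} [Fintype V] [DecidableEq V] {G : SimpleGraph V} [DecidableRel G.Adj] {d : ℕ}

theorem exists_adjMatrix_mulVec_eq_smul {x : ℝ} (hx : (G.adjMatrix ℝ).charpoly.IsRoot x) :
    ∃ v : V → ℝ, v ≠ 0 ∧ (G.adjMatrix ℝ).mulVec v = x • v := by
  rw [← Matrix.mem_spectrum_iff_isRoot_charpoly, ← Matrix.spectrum_toLin',
    ← Module.End.hasEigenvalue_iff_mem_spectrum] at hx
  obtain ⟨v, hv⟩ := hx.exists_hasEigenvector
  exact ⟨v, hv.2, by simpa using hv.apply_eq_smul⟩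

theorem IsRegularOfDegree.le_of_isRoot_charpoly (hd : G.IsRegularOfDegree d) {x : ℝ}
    (hx : (G.adjMatrix ℝ).charpoly.IsRoot x) : x ≤ d := by
  rw [← Matrix.mem_spectrum_iff_isRoot_charpoly, ← Matrix.spectrum_toLin',
    ← Module.End.hasEigenvalue_iff_mem_spectrum] at hx
  obtain ⟨k, hk⟩ := eigenvalue_mem_ball hx
  have hsum : ∑ j ∈ Finset.univ.erase k, ‖G.adjMatrix ℝ k j‖ = d := by
    rw [Finset.sum_erase _ (by simp), ← hd k, degree_eq_sum_if_adj]
    exact Finset.sum_congr rfl fun j _ => by by_cases h : G.Adj k j <;> simp [h]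
  rw [hsum, Metric.mem_closedBall, Real.dist_eq] at hk
  simpa using (abs_le.mp hk).2

theorem IsRegularOfDegree.isRoot_charpoly [Nonempty V] (hd : G.IsRegularOfDegree d) :
    (G.adjMatrix ℝ).charpoly.IsRoot d := by
  rw [← Matrix.mem_spectrum_iff_isRoot_charpoly, ← Matrix.spectrum_toLin',
    ← Module.End.hasEigenvalue_iff_mem_spectrum]
  refine Module.End.hasEigenvalue_of_hasEigenvector (x := Function.const V 1)
    (Module.End.hasEigenvector_iff.mpr ⟨?_, ?_⟩)
  · rw [Module.End.mem_eigenspace_iff]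
    ext v
    simp [hd v]
  · exact fun h => one_ne_zero (congrFun h (Classical.arbitrary V))

/-- On a connected regular graph, the eigenvectors for the degree are constant. -/
theorem IsRegularOfDegree.apply_eq_of_mulVec_eq_smul (hd : G.IsRegularOfDegree d)
    (hconn : G.Connected) {v : V → ℝ} (hv : (G.adjMatrix ℝ).mulVec v = (d : ℝ) • v) (i j : V) :
    v i = v j := by
  refine (lapMatrix_mulVec_eq_zero_iff_forall_reachable G).mp ?_ i j (hconn.preconnected i j)
  ext k
  have := congrFun hv k
  rw [adjMatrix_mulVec_apply] at this
  rw [lapMatrix_mulVec_apply, this, hd k]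
  simp

/-- The only positive adjacency eigenvalue of a complete graph is its degree. -/
theorem IsRegularOfDegree.eq_of_isRoot_charpoly_of_eq_top (hd : G.IsRegularOfDegree d)
    (htop : G = ⊤) {x : ℝ} (hx : (G.adjMatrix ℝ).charpoly.IsRoot x) (hpos : 0 < x) :
    x = d := by
  obtain ⟨v, hv0, hv⟩ := exists_adjMatrix_mulVec_eq_smul hx
  obtain ⟨i, hi⟩ := Function.ne_iff.mp hv0
  have hsum (k : V) : (x + 1) * v k = ∑ j, v j := by
    have h := congrFun hv k
    have hN : G.neighborFinset k = Finset.univ.erase k := by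
      ext j
      simp [htop, eq_comm]
    rw [adjMatrix_mulVec_apply, hN] at h
    rw [← Finset.add_sum_erase _ _ (Finset.mem_univ k), h]
    simp
    ring
  have hconst (k : V) : v k = v i :=
    mul_left_cancel₀ (by positivity : x + 1 ≠ 0) ((hsum k).trans (hsum i).symm)
  have h := congrFun hv i
  rw [show v = Function.const V (v i) from funext hconst, adjMatrix_mulVec_const_apply_of_regular hd] at h
  exact (mul_right_cancel₀ hi h).symm

theorem adjMatrix_sq_apply_eq_card_commonNeighbors (i j : V) :
    (G.adjMatrix ℝ ^ 2) i j = Fintype.card (G.commonNeighbors i j) := by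
  rw [sq, adjMatrix_mul_apply, ← Set.toFinset_card]
  simp only [adjMatrix_apply, Finset.sum_boole]
  congr 2
  ext k
  simp [mem_commonNeighbors, G.adj_comm k j]

end SimpleGraph

/-- Let `G` be a connected simple graph on `n` vertices whose adjacency
matrix has characteristic polynomial `(X - λ)(X - μ)^(n-t-1)(X + μ)^t`, where
`1 ≤ t ≤ n-2` and `λ > μ > 0`.  Then `G` is regular iff `G` is strongly regular with
parameters `(n, λ, λ - μ², λ - μ²)` (a strongly regular graph being, in particular,
neither complete nor empty). -/
theorem stmt6 {n t : ℕ} (G : SimpleGraph (Fin n)) [DecidableRel G.Adj]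
    (hconn : G.Connected) (lam mu : ℝ) (hlm : mu < lam) (hmu : 0 < mu)
    (ht1 : 1 ≤ t) (ht2 : t ≤ n - 2)
    (hchar : (G.adjMatrix ℝ).charpoly =
      (X - C lam) * (X - C mu) ^ (n - t - 1) * (X + C mu) ^ t) :
    (∃ d : ℕ, G.IsRegularOfDegree d) ↔
      (∃ d c : ℕ, (d : ℝ) = lam ∧ (c : ℝ) = lam - mu ^ 2 ∧
        G.IsSRGWith n d c c ∧ G ≠ ⊤ ∧ G ≠ ⊥) := by
  constructor
  · rintro ⟨d, hd⟩
    have hn : 3 ≤ n := by omega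
    have : NeZero n := ⟨by omega⟩
    have hroot (x : ℝ) : (G.adjMatrix ℝ).charpoly.IsRoot x ↔ x = lam ∨ x = mu ∨ x = -mu := by
      have h₁ : n - t - 1 ≠ 0 := by omega
      have h₂ : t ≠ 0 := by omega
      simp [hchar, IsRoot.def, h₁, h₂, sub_eq_zero, or_assoc, add_eq_zero_iff_eq_neg]
    have hdlam : (d : ℝ) = lam := by
      have hle := hd.le_of_isRoot_charpoly ((hroot lam).mpr (Or.inl rfl))
      rcases (hroot d).mp hd.isRoot_charpoly with h | h | h <;> linarith
    set A := G.adjMatrix ℝ with hA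
    set M := A ^ 2 - (mu ^ 2) • (1 : Matrix (Fin n) (Fin n) ℝ) with hM
    have hAM : A * M = (d : ℝ) • M := by
      have h := (G.isHermitian_adjMatrix ℝ).aeval_eq_zero_of_forall_isRoot_charpoly
        ((X - C lam) * (X ^ 2 - C (mu ^ 2))) (by
          intro x hx
          rcases (hroot x).mp hx with rfl | rfl | rfl <;> simp)
      rw [map_mul, map_sub, map_sub, aeval_X_pow, aeval_X, aeval_C, aeval_C, ← hA, ← hdlam,
        Algebra.algebraMap_eq_smul_one, Algebra.algebraMap_eq_smul_one, ← hM, sub_mul,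
        sub_eq_zero, smul_one_mul] at h
      exact h
    have hcol (i j k : Fin n) : M i k = M j k :=
      hd.apply_eq_of_mulVec_eq_smul hconn (v := fun i => M i k)
        (funext fun i => congrFun (congrFun hAM i) k) i j
    have hconst (i j : Fin n) : M i j = lam - mu ^ 2 := by
      rw [hcol i j j, ← hdlam]
      simp only [hM, hA, sq (G.adjMatrix ℝ), Matrix.sub_apply, Matrix.smul_apply,
        SimpleGraph.adjMatrix_mul_self_apply_self, hd j, Matrix.one_apply_eq, smul_eq_mul, mul_one]
    have hcard {i j : Fin n} (hij : i ≠ j) :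
        (Fintype.card (G.commonNeighbors i j) : ℝ) = lam - mu ^ 2 := by
      rw [← SimpleGraph.adjMatrix_sq_apply_eq_card_commonNeighbors, ← hconst i j]
      simp [hM, hA, hij]
    have h01 : (⟨0, by omega⟩ : Fin n) ≠ ⟨1, by omega⟩ := by simp
    have hc {i j : Fin n} (hij : i ≠ j) := Nat.cast_injective ((hcard hij).trans (hcard h01).symm)
    refine ⟨d, _, hdlam, hcard h01,
      ⟨by simp, hd, fun i j h => hc h.ne, fun i j h _ => hc h⟩, fun htop => ?_, ?_⟩
    · have := hd.eq_of_isRoot_charpoly_of_eq_top htop ((hroot mu).mpr (Or.inr (Or.inl rfl))) hmu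
      linarith
    · rintro rfl
      have h : d = 0 := (hd 0).symm.trans (by simp)
      rw [h, Nat.cast_zero] at hdlam
      linarith
  · rintro ⟨d, c, -, -, h, -⟩
    exact ⟨d, h.regular⟩
end

section
/- Let A be a real symmetric n×n matrix with eigenvalue multiset {λ_1, …, λ_n}, let m ≥ 1, let J_m be the m×m all-ones matrix and I_k the k×k identity matrix. Then the eigenvalue multiset of the nm×nm matrix (A + I_n) ⊗ J_m − I_{nm} is {m·λ_1 + m − 1, …, m·λ_n + m − 1} together with −1 repeated n(m−1) times. -/
open Polynomial Matrix

namespace Matrix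

/-- The characteristic polynomial of an affine function of a Hermitian matrix, in terms of the
eigenvalues of that matrix. -/
theorem IsHermitian.charpoly_smul_add_smul_one {ι : Type*} [Fintype ι] [DecidableEq ι]
    {A : Matrix ι ι ℝ} (hA : A.IsHermitian) (c d : ℝ) :
    (c • A + d • (1 : Matrix ι ι ℝ)).charpoly = ∏ i, (X - C (c * hA.eigenvalues i + d)) := by
  have key : c • A + d • (1 : Matrix ι ι ℝ) =
      Unitary.conjStarAlgAut ℝ _ hA.eigenvectorUnitary
        (diagonal fun i => c * hA.eigenvalues i + d) := by
    have hd : (diagonal fun i => c * hA.eigenvalues i + d) =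
        c • diagonal (RCLike.ofReal ∘ hA.eigenvalues) + d • (1 : Matrix ι ι ℝ) := by
      ext i j
      by_cases h : i = j <;> simp [h]
    rw [hd, map_add, map_smul, map_smul, map_one, ← hA.spectral_theorem]
  rw [key, Unitary.conjStarAlgAut_apply, charpoly_mul_comm, ← mul_assoc]
  simp [charpoly_diagonal]

/-- The characteristic polynomial of the Kronecker product of a matrix with an all-ones matrix. -/
theorem charpoly_kronecker_of_one {ι κ R : Type*} [Fintype ι] [DecidableEq ι] [Fintype κ]
    [DecidableEq κ] [Nonempty κ] [CommRing R] (B : Matrix ι ι R) :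
    (B.kronecker (Matrix.of fun _ _ => (1 : R) : Matrix κ κ R)).charpoly =
      X ^ (Fintype.card ι * (Fintype.card κ - 1)) * ((Fintype.card κ : R) • B).charpoly := by
  have hle : Fintype.card ι ≤ Fintype.card (ι × κ) := by
    rw [Fintype.card_prod]
    exact Nat.le_mul_of_pos_right _ Fintype.card_pos
  let U : Matrix (ι × κ) ι R := Matrix.of fun p j => B p.1 j
  let V : Matrix ι (ι × κ) R := Matrix.of fun i p => if i = p.1 then 1 else 0
  have hUV : B.kronecker (Matrix.of fun _ _ => (1 : R) : Matrix κ κ R) = U * V := by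
    ext p q
    simp [U, V, mul_apply, kronecker]
  have hVU : V * U = (Fintype.card κ : R) • B := by
    ext i j
    simp [U, V, mul_apply, Fintype.sum_prod_type]
  rw [hUV, charpoly_mul_comm_of_le U V hle, hVU, Fintype.card_prod, Nat.mul_sub, mul_one]

end Matrix

/-- If `A` is a real symmetric `n×n` matrix with eigenvalue multiset
`{λ_1, …, λ_n}` and `m ≥ 1`, then the eigenvalue multiset of the `nm×nm` matrix
`(A + Iₙ) ⊗ J_m - I_{nm}` is `{m·λ_1 + m - 1, …, m·λ_n + m - 1}` together with `-1`
repeated `n(m-1)` times. -/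
theorem stmt8 {n m : ℕ} (A : Matrix (Fin n) (Fin n) ℝ) (hA : A.IsSymm) (hm : 1 ≤ m) :
    ((A + 1).kronecker (Matrix.of fun _ _ => (1 : ℝ) : Matrix (Fin m) (Fin m) ℝ)
        - 1).charpoly.roots =
      A.charpoly.roots.map (fun r => (m : ℝ) * r + m - 1) +
        Multiset.replicate (n * (m - 1)) (-1) := by
  have hH : A.IsHermitian := by rwa [IsHermitian, conjTranspose_eq_transpose_of_trivial]
  have : Nonempty (Fin m) := ⟨⟨0, hm⟩⟩
  have hchar : ((A + 1).kronecker (Matrix.of fun _ _ => (1 : ℝ) : Matrix (Fin m) (Fin m) ℝ)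
      - 1).charpoly = (X - C (-1)) ^ (n * (m - 1)) *
        ∏ i, (X - C ((m : ℝ) * hH.eigenvalues i + m - 1)) := by
    rw [← map_one (scalar (Fin n × Fin m)), charpoly_sub_scalar, charpoly_kronecker_of_one,
      smul_add, Fintype.card_fin, Fintype.card_fin, hH.charpoly_smul_add_smul_one, mul_comp,
      prod_comp]
    congr 1
    · simp
    · refine Finset.prod_congr rfl fun i _ => ?_
      simp only [sub_comp, X_comp, C_comp, map_sub]
      ring
  have hprod : ∏ i, (X - C ((m : ℝ) * hH.eigenvalues i + m - 1)) ≠ 0 :=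
    Finset.prod_ne_zero_iff.mpr fun i _ => X_sub_C_ne_zero _
  rw [hchar, roots_mul (mul_ne_zero (pow_ne_zero _ (X_sub_C_ne_zero _)) hprod), roots_pow,
    roots_X_sub_C, Multiset.nsmul_singleton, roots_prod _ _ hprod,
    hH.roots_charpoly_eq_eigenvalues, add_comm]
  simp only [roots_X_sub_C, Multiset.bind_singleton, Multiset.map_map, Function.comp_def,
    RCLike.ofReal_real_eq_id, id_eq]
end

section
/- Let G be a connected simple graph on n vertices whose adjacency matrix has characteristic polynomial (X − λ)·(X − μ)^(n−k−t−1)·X^t·(X + μ)^k, where t, k ≥ 1, t + k ≤ n−2, and λ > μ > 0 are real numbers. Then λ and μ are integers (so G is integral) and λ = (2k + t − n + 1)·μ. -/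
open Polynomial

/-- The trace of a power of a real Hermitian matrix is the corresponding power sum of the roots of
the characteristic polynomial. -/
theorem Matrix.IsHermitian.trace_pow_eq_sum_roots {ι : Type*} [Fintype ι] [DecidableEq ι]
    {A : Matrix ι ι ℝ} (hA : A.IsHermitian) (r : ℕ) :
    (A ^ r).trace = (A.charpoly.roots.map (· ^ r)).sum := by
  rw [hA.roots_charpoly_eq_eigenvalues, Multiset.map_map]
  conv_lhs => rw [hA.spectral_theorem, ← map_pow, Matrix.diagonal_pow,
    Unitary.conjStarAlgAut_apply, Matrix.trace_mul_cycle]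
  simp [Matrix.trace_diagonal]

theorem SimpleGraph.exists_nat_trace_adjMatrix_pow {V : Type*} [Fintype V] [DecidableEq V]
    (G : SimpleGraph V) [DecidableRel G.Adj] (r : ℕ) :
    ∃ N : ℕ, (G.adjMatrix ℝ ^ r).trace = N := by
  refine ⟨∑ v, Fintype.card {p : G.Walk v v // p.length = r}, ?_⟩
  push_cast
  exact Finset.sum_congr rfl fun v _ => G.adjMatrix_pow_apply_eq_card_walk r v v

theorem SimpleGraph.isIntegral_of_isRoot_charpoly_adjMatrix {V : Type*} [Fintype V]
    [DecidableEq V] (G : SimpleGraph V) [DecidableRel G.Adj] {x : ℝ}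
    (hx : (G.adjMatrix ℝ).charpoly.IsRoot x) : IsIntegral ℤ x := by
  have hmap : G.adjMatrix ℝ = (G.adjMatrix ℤ).map (Int.castRingHom ℝ) := by
    ext i j
    simp [SimpleGraph.adjMatrix_apply, apply_ite]
  refine ⟨(G.adjMatrix ℤ).charpoly, Matrix.charpoly_monic _, ?_⟩
  rw [hmap, Matrix.charpoly_map, IsRoot.def, eval_map] at hx
  exact hx

/-- An algebraic integer whose square and cube have nonzero integer multiples that are integers
is itself an integer. -/
theorem exists_int_eq_of_isIntegral_of_sq_of_cube {x : ℝ} (hx : IsIntegral ℤ x) (hx0 : x ≠ 0)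
    {a b p q : ℤ} (ha : a ≠ 0) (hb : b ≠ 0) (h2 : a * x ^ 2 = (p : ℝ))
    (h3 : b * x ^ 3 = (q : ℝ)) : ∃ z : ℤ, x = z := by
  have ha' : (a : ℝ) ≠ 0 := by exact_mod_cast ha
  have hb' : (b : ℝ) ≠ 0 := by exact_mod_cast hb
  have hp : (p : ℝ) ≠ 0 := by rw [← h2]; positivity
  have hxq : x = algebraMap ℚ ℝ ((q * a : ℚ) / (p * b)) := by
    simp only [eq_ratCast]
    push_cast
    rw [eq_div_iff (mul_ne_zero hp hb'), ← h2, ← h3]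
    ring
  rw [hxq, isIntegral_algebraMap_iff (algebraMap ℚ ℝ).injective,
    IsIntegrallyClosed.isIntegral_iff] at hx
  obtain ⟨z, hz⟩ := hx
  exact ⟨z, by rw [hxq, ← hz]; simp⟩

/-- Let `G` be a connected simple graph on `n` vertices whose adjacency
matrix has characteristic polynomial `(X - λ)(X - μ)^(n-k-t-1) X^t (X + μ)^k`, where
`t, k ≥ 1`, `t + k ≤ n - 2` and `λ > μ > 0`.  Then `λ` and `μ` are integers (so `G` is
integral) and `λ = (2k + t - n + 1)·μ`. -/
theorem stmt9 {n t k : ℕ} (G : SimpleGraph (Fin n)) [DecidableRel G.Adj]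
    (hconn : G.Connected) (lam mu : ℝ) (hlm : mu < lam) (hmu : 0 < mu)
    (ht : 1 ≤ t) (hk : 1 ≤ k) (htk : t + k ≤ n - 2)
    (hchar : (G.adjMatrix ℝ).charpoly =
      (X - C lam) * (X - C mu) ^ (n - k - t - 1) * X ^ t * (X + C mu) ^ k) :
    (∃ a : ℤ, lam = (a : ℝ)) ∧ (∃ b : ℤ, mu = (b : ℝ)) ∧
      lam = (2 * (k : ℝ) + t - n + 1) * mu := by
  obtain ⟨m, hm⟩ : ∃ m, m = n - k - t - 1 := ⟨_, rfl⟩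
  have hn : n = m + k + t + 1 := by omega
  rw [← hm] at hchar
  have hroots : (G.adjMatrix ℝ).charpoly.roots =
      {lam} + m • {mu} + t • {0} + k • {-mu} := by
    have hneg : X + C mu = X - C (-mu) := by simp
    have hne := (G.adjMatrix ℝ).charpoly_monic.ne_zero
    rw [hchar] at hne
    rw [hchar, roots_mul hne, roots_mul (left_ne_zero_of_mul hne),
      roots_mul (left_ne_zero_of_mul (left_ne_zero_of_mul hne)), hneg]
    simp only [roots_pow, roots_X_sub_C, roots_X]
  have htrace (r : ℕ) (hr : r ≠ 0) :
      (G.adjMatrix ℝ ^ r).trace = lam ^ r + m * mu ^ r + k * (-mu) ^ r := by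
    have hA : (G.adjMatrix ℝ).IsHermitian := by
      rw [Matrix.IsHermitian, Matrix.conjTranspose_eq_transpose_of_trivial]
      exact G.isSymm_adjMatrix
    rw [hA.trace_pow_eq_sum_roots, hroots]
    simp [Multiset.map_nsmul, Multiset.sum_nsmul, hr, add_assoc]
  have h1 : lam = ((k : ℝ) - m) * mu := by
    have := htrace 1 one_ne_zero
    rw [pow_one, SimpleGraph.trace_adjMatrix] at this
    linarith
  obtain ⟨c, hc⟩ : ∃ c : ℤ, c = (k : ℤ) - m := ⟨_, rfl⟩
  have hcr : (c : ℝ) = (k : ℝ) - m := by simp [hc]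
  rw [← hcr] at h1
  have hc1 : 1 < c := by
    have : (1 : ℝ) < c := by
      by_contra! h
      nlinarith
    exact_mod_cast this
  have hint : ∃ b : ℤ, mu = b := by
    obtain ⟨p, hp⟩ := G.exists_nat_trace_adjMatrix_pow 2
    obtain ⟨q, hq⟩ := G.exists_nat_trace_adjMatrix_pow 3
    rw [htrace 2 two_ne_zero, h1] at hp
    rw [htrace 3 three_ne_zero, h1] at hq
    have hmuInt : IsIntegral ℤ mu := by
      have hroot : (G.adjMatrix ℝ).charpoly.IsRoot (-mu) := by
        rw [hchar, IsRoot.def]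
        simp [show k ≠ 0 by omega]
      simpa using (G.isIntegral_of_isRoot_charpoly_adjMatrix hroot).neg
    refine exists_int_eq_of_isIntegral_of_sq_of_cube hmuInt hmu.ne' (a := c ^ 2 + m + k)
      (b := c ^ 3 - c) (p := p) (q := q) (by positivity)
      (by nlinarith [mul_pos (by omega : 0 < c) (by nlinarith : 0 < c ^ 2 - 1)]) ?_ ?_
    · push_cast
      linear_combination hp
    · push_cast
      linear_combination hq - mu ^ 3 * hcr
  obtain ⟨b, hb⟩ := hint
  refine ⟨⟨c * b, by rw [h1, hb]; push_cast; rfl⟩, ⟨b, hb⟩, ?_⟩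
  rw [h1, hcr, hn]
  push_cast
  ring
end

section
/- Let G be a connected simple graph on n vertices whose adjacency matrix has characteristic polynomial (X − λ)·(X − μ)^(n−k−t−1)·X^t·(X + μ)^k, where t, k ≥ 1, t + k ≤ n−2, and λ > μ > 0. Then k ≥ 2, i.e., −μ is not a simple eigenvalue of G. -/
open Polynomial

/-- Let `G` be a connected simple graph on `n` vertices whose adjacency
matrix has characteristic polynomial `(X - λ)(X - μ)^(n-k-t-1) X^t (X + μ)^k`, where
`t, k ≥ 1`, `t + k ≤ n - 2` and `λ > μ > 0`.  Then `k ≥ 2`, i.e. `-μ` is not a simple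
eigenvalue of `G`. -/
theorem stmt10 {n t k : ℕ} (G : SimpleGraph (Fin n)) [DecidableRel G.Adj]
    (hconn : G.Connected) (lam mu : ℝ) (hlm : mu < lam) (hmu : 0 < mu)
    (ht : 1 ≤ t) (hk : 1 ≤ k) (htk : t + k ≤ n - 2)
    (hchar : (G.adjMatrix ℝ).charpoly =
      (X - C lam) * (X - C mu) ^ (n - k - t - 1) * X ^ t * (X + C mu) ^ k) :
    2 ≤ k := by
  have htrace := Matrix.trace_eq_neg_charpoly_nextCoeff (G.adjMatrix ℝ)
  have h₁ := monic_X_sub_C lam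
  have h₂ := (monic_X_sub_C mu).pow (n - k - t - 1)
  have h₃ := (monic_X (R := ℝ)).pow t
  have h₄ := (monic_X_add_C mu).pow k
  rw [SimpleGraph.trace_adjMatrix, hchar, ((h₁.mul h₂).mul h₃).nextCoeff_mul h₄,
    (h₁.mul h₂).nextCoeff_mul h₃, h₁.nextCoeff_mul h₂, (monic_X_sub_C mu).nextCoeff_pow,
    monic_X.nextCoeff_pow, (monic_X_add_C mu).nextCoeff_pow] at htrace
  have hX : (X : ℝ[X]).nextCoeff = 0 := by simpa using nextCoeff_X_add_C (0 : ℝ)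
  simp only [nextCoeff_X_sub_C, nextCoeff_X_add_C, hX, nsmul_eq_mul] at htrace
  by_contra hk₂
  obtain rfl : k = 1 := by omega
  have hm : (1 : ℝ) ≤ ((n - 1 - t - 1 : ℕ) : ℝ) := by
    exact_mod_cast (by omega : 1 ≤ n - 1 - t - 1)
  have hmul := mul_le_mul_of_nonneg_right hm hmu.le
  push_cast at htrace
  linarith
end

section
/- Let G be a connected regular simple graph on n vertices whose adjacency matrix has characteristic polynomial (X − λ)·(X − μ)^(n−k−t−1)·X^t·(X + μ)^k, where t, k ≥ 1, t + k ≤ n−2, and λ > μ > 0. Then t ≥ 2, i.e., 0 is not a simple eigenvalue of G. -/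
open Polynomial

namespace Matrix

/-- A real symmetric matrix is diagonalized by an orthogonal matrix, and the diagonal entries are
the roots of the characteristic polynomial. -/
lemma IsSymm.exists_orthogonal_diagonalization {V : Type*} [Fintype V] [DecidableEq V]
    {A : Matrix V V ℝ} (hA : A.IsSymm) :
    ∃ (U : Matrix V V ℝ) (e : V → ℝ), U * Uᵀ = 1 ∧ Uᵀ * U = 1 ∧ A * U = U * diagonal e ∧
      A.charpoly.roots = Finset.univ.val.map e := by
  have hH : A.IsHermitian := by
    rw [IsHermitian, conjTranspose_eq_transpose_of_trivial]
    exact hA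
  have h1 := Unitary.coe_mul_star_self hH.eigenvectorUnitary
  have h2 := Unitary.coe_star_mul_self hH.eigenvectorUnitary
  rw [Unitary.coe_star] at h1
  rw [star_eq_conjTranspose, conjTranspose_eq_transpose_of_trivial] at h1 h2
  refine ⟨hH.eigenvectorUnitary, hH.eigenvalues, h1, h2, ?_, ?_⟩
  · ext x i
    have := congrFun (hH.mulVec_eigenvectorBasis i) x
    rw [mul_diagonal]
    simpa [mul_apply, mulVec, dotProduct, mul_comm] using this
  · simpa using hH.roots_charpoly_eq_eigenvalues

end Matrix

namespace SimpleGraph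

open Matrix

variable {V : Type*} [Fintype V] {G : SimpleGraph V} [DecidableRel G.Adj]

lemma IsRegularOfDegree.sum_adjMatrix_apply {d : ℕ} (hd : G.IsRegularOfDegree d) (x : V) :
    ∑ y, G.adjMatrix ℝ x y = d := by
  simpa [mulVec, dotProduct] using
    adjMatrix_mulVec_const_apply_of_regular (α := ℝ) (a := 1) hd (v := x)

variable [DecidableEq V]

/-- Every eigenvalue of a `d`-regular graph is at most `d`. -/
lemma IsRegularOfDegree.eigenvalue_le {d : ℕ} (hd : G.IsRegularOfDegree d) {r : ℝ}
    (hr : r ∈ (G.adjMatrix ℝ).charpoly.roots) : r ≤ d := by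
  have hev : Module.End.HasEigenvalue (Matrix.toLin' (G.adjMatrix ℝ)) r := by
    rw [Module.End.hasEigenvalue_iff_isRoot_charpoly, Matrix.charpoly_toLin']
    exact isRoot_of_mem_roots hr
  obtain ⟨x, hx⟩ := eigenvalue_mem_ball hev
  have hsum : ∑ y ∈ Finset.univ.erase x, ‖G.adjMatrix ℝ x y‖ ≤ d := by
    calc _ ≤ ∑ y, ‖G.adjMatrix ℝ x y‖ :=
          Finset.sum_le_sum_of_subset_of_nonneg (Finset.erase_subset _ _)
            fun _ _ _ => norm_nonneg _
      _ = ∑ y, G.adjMatrix ℝ x y := by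
          refine Finset.sum_congr rfl fun y _ => ?_
          rw [adjMatrix_apply]
          split_ifs <;> simp
      _ = d := hd.sum_adjMatrix_apply x
  rw [Metric.mem_closedBall, Real.dist_eq] at hx
  have h0 : G.adjMatrix ℝ x x = 0 := by simp
  rw [h0, sub_zero] at hx
  exact (le_abs_self r).trans (hx.trans hsum)

/-- If a regular graph has largest eigenvalue `r` and eigenvalue `0`, both simple, and all other
eigenvalues equal `±m` with `m < r`, then the square of the adjacency matrix is a combination of
the identity, the all-ones matrix, and the projection to the kernel. -/
lemma IsRegularOfDegree.adjMatrix_mul_self_apply_of_eigenvalues {d : ℕ}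
    (hd : G.IsRegularOfDegree d) {r m : ℝ} (hm : 0 < m) (hmr : m < r) {e : V → ℝ}
    {U : Matrix V V ℝ} (hU : U * Uᵀ = 1) (hU' : Uᵀ * U = 1)
    (hAU : G.adjMatrix ℝ * U = U * diagonal e) (hrd : r ≤ d) {i j : V} (hi : e i = r)
    (hj : e j = 0) (he : ∀ l, l ≠ i → l ≠ j → e l = m ∨ e l = -m) :
    ∃ z : V → ℝ, ∑ x, z x = 0 ∧ ∑ x, z x ^ 2 = 1 ∧ ∀ x y, (G.adjMatrix ℝ * G.adjMatrix ℝ) x y =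
      m ^ 2 * (1 : Matrix V V ℝ) x y + (d ^ 2 - m ^ 2) / Fintype.card V - m ^ 2 * (z x * z y) := by
  have hij : i ≠ j := by rintro rfl; linarith
  have hd0 : (0 : ℝ) < d := by linarith
  set s : V → ℝ := fun l => ∑ x, U x l with hs
  have hse : ∀ l, s l * e l = d * s l := fun l => by
    calc s l * e l = ∑ x, (G.adjMatrix ℝ * U) x l := by
          simp only [hs, hAU, mul_diagonal, Finset.sum_mul]
      _ = ∑ y, (∑ x, G.adjMatrix ℝ y x) * U y l := by
          simp only [mul_apply, Finset.sum_mul]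
          rw [Finset.sum_comm]
          simp only [adjMatrix_apply, G.adj_comm]
      _ = d * s l := by
          simp only [hd.sum_adjMatrix_apply, hs, Finset.mul_sum]
  have hs0 : ∀ l, l ≠ i → s l = 0 := fun l hl => by
    have hlt : e l < d := by
      by_cases hlj : l = j
      · rw [hlj, hj]; exact hd0
      · rcases he l hl hlj with h | h <;> rw [h] <;> linarith
    have : s l * (e l - d) = 0 := by linarith [hse l]
    exact (mul_eq_zero.mp this).resolve_right (by linarith)
  have hu : ∀ x, U x i * s i = 1 := fun x => by
    have h : ∑ l, U x l * s l = 1 := by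
      simp only [hs, Finset.mul_sum]
      rw [Finset.sum_comm]
      have h' : ∀ y, ∑ l, U x l * U y l = (1 : Matrix V V ℝ) x y := fun y => by
        rw [← hU, mul_apply]; rfl
      simp [h', one_apply]
    rwa [Finset.sum_eq_single i (fun l _ hl => by rw [hs0 l hl, mul_zero]) (by simp)] at h
  have hnorm : ∀ l, ∑ x, U x l ^ 2 = 1 := fun l => by
    have h := congrFun (congrFun hU' l) l
    simpa [mul_apply, sq] using h
  have hsi : s i ≠ 0 := fun h => by simpa [h] using hu i
  have hui : ∀ x, U x i = (s i)⁻¹ := fun x => eq_inv_of_mul_eq_one_left (hu x)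
  have hcard : (s i)⁻¹ * (s i)⁻¹ = (Fintype.card V : ℝ)⁻¹ := by
    have h := hnorm i
    simp only [hui, Finset.sum_const, Finset.card_univ, nsmul_eq_mul, sq] at h
    exact eq_inv_of_mul_eq_one_right h
  have hrd' : r = d := by
    have h := hse i
    rw [hi, mul_comm] at h
    exact mul_right_cancel₀ hsi h
  refine ⟨fun x => U x j, hs0 j hij.symm, hnorm j, fun x y => ?_⟩
  have hAA : G.adjMatrix ℝ * G.adjMatrix ℝ = U * diagonal e * diagonal e * Uᵀ := by
    calc _ = G.adjMatrix ℝ * (G.adjMatrix ℝ * (U * Uᵀ)) := by rw [hU, mul_one]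
      _ = _ := by
        rw [← mul_assoc (G.adjMatrix ℝ) U, hAU, mul_assoc U, ← mul_assoc, hAU]
        simp only [mul_assoc]
  have hdiff : (G.adjMatrix ℝ * G.adjMatrix ℝ) x y - m ^ 2 * (1 : Matrix V V ℝ) x y =
      ∑ l, (e l ^ 2 - m ^ 2) * (U x l * U y l) := by
    rw [hAA, ← hU, mul_apply, mul_apply, Finset.mul_sum, ← Finset.sum_sub_distrib]
    refine Finset.sum_congr rfl fun l _ => ?_
    rw [mul_diagonal, mul_diagonal, transpose_apply]
    ring
  rw [Finset.sum_eq_add i j hij (fun l _ hl => by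
    rcases he l hl.1 hl.2 with h | h <;> rw [h] <;> ring) (by simp) (by simp), hi, hj, hui, hui,
    hcard, hrd'] at hdiff
  rw [div_eq_mul_inv]
  linarith

/-- A `d`-regular graph whose squared adjacency matrix has the form described in
`IsRegularOfDegree.adjMatrix_mul_self_apply_of_eigenvalues` has at most four vertices. -/
lemma IsRegularOfDegree.card_le_four_of_adjMatrix_mul_self {d : ℕ} (hd : G.IsRegularOfDegree d)
    {m : ℝ} (hm : 0 < m) {z : V → ℝ} (hz : ∑ x, z x = 0) (hz1 : ∑ x, z x ^ 2 = 1)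
    (h : ∀ x y, (G.adjMatrix ℝ * G.adjMatrix ℝ) x y = m ^ 2 * (1 : Matrix V V ℝ) x y +
      (d ^ 2 - m ^ 2) / Fintype.card V - m ^ 2 * (z x * z y)) :
    Fintype.card V ≤ 4 := by
  by_contra! hcard
  have hn : (5 : ℝ) ≤ Fintype.card V := by exact_mod_cast hcard
  generalize hndef : (Fintype.card V : ℝ) = n at hn h
  have hn0 : n ≠ 0 := by linarith
  have hdiag : ∀ x, (d : ℝ) = m ^ 2 + (d ^ 2 - m ^ 2) / n - m ^ 2 * z x ^ 2 := fun x => by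
    have := h x x
    rw [adjMatrix_mul_self_apply_self, hd x, one_apply_eq] at this
    linarith
  have : Nonempty V := Fintype.card_pos_iff.mp (by lia)
  have hm2 : (0 : ℝ) < m ^ 2 := by positivity
  have hsq : ∀ x, z x ^ 2 = 1 / n := fun x => by
    have hc : ∀ y, z y ^ 2 = z x ^ 2 := fun y => by
      have : m ^ 2 * z y ^ 2 = m ^ 2 * z x ^ 2 := by linarith [hdiag x, hdiag y]
      exact mul_left_cancel₀ hm2.ne' this
    rw [Finset.sum_congr rfl fun y _ => hc y] at hz1
    simp only [Finset.sum_const, Finset.card_univ, nsmul_eq_mul, hndef] at hz1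
    rw [eq_div_iff hn0, mul_comm]
    exact hz1
  have hznz : ∀ x, z x ≠ 0 := fun x hx => by
    have hpos : 0 < 1 / n := by positivity
    rw [← hsq x, hx] at hpos
    norm_num at hpos
  obtain ⟨p, -, hp⟩ := Finset.exists_pos_of_sum_zero_of_exists_nonzero z hz
    ⟨Classical.arbitrary V, Finset.mem_univ _, hznz _⟩
  obtain ⟨q, -, hq⟩ := Finset.exists_pos_of_sum_zero_of_exists_nonzero (fun x => -z x)
    (by simp [hz]) ⟨Classical.arbitrary V, Finset.mem_univ _, neg_ne_zero.mpr (hznz _)⟩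
  have hpq : z p * z q = -(1 / n) := by
    have h1 : (z p - z q) * (z p + z q) = 0 := by linarith [hsq p, hsq q]
    have h2 : z p + z q = 0 := (mul_eq_zero.mp h1).resolve_left (by linarith)
    rw [← hsq p, eq_neg_of_add_eq_zero_right h2]
    ring
  obtain ⟨a, b, hab, hs⟩ := Fintype.exists_ne_map_eq_of_card_lt (fun x => decide (0 < z x))
    (by rw [Fintype.card_bool]; lia)
  have hzab : z a * z b = 1 / n := by
    have h1 : (z a - z b) * (z a + z b) = 0 := by linarith [hsq a, hsq b]
    have h2 : z a + z b ≠ 0 := by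
      simp only [decide_eq_decide] at hs
      by_cases ha : 0 < z a
      · linarith [hs.mp ha]
      · have hb := mt hs.mpr ha
        have := lt_of_le_of_ne (not_lt.mp ha) (hznz a)
        linarith [not_lt.mp hb]
    have h3 := (mul_eq_zero.mp h1).resolve_right h2
    rw [← hsq a, ← sub_eq_zero.mp h3, sq]
  have hnat : ∀ x y, ∃ c : ℕ, (G.adjMatrix ℝ * G.adjMatrix ℝ) x y = c := fun x y =>
    ⟨_, by rw [← sq, adjMatrix_pow_apply_eq_card_walk]⟩
  obtain ⟨c, hc⟩ := hnat p q
  obtain ⟨c', hc'⟩ := hnat a b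
  rw [h, hpq, one_apply_ne (by rintro rfl; linarith)] at hc
  rw [h, hzab, one_apply_ne hab] at hc'
  have hcc : (c : ℝ) - c' = 2 * m ^ 2 / n := by rw [← hc, ← hc']; ring
  have hlt : c' < c := by
    have : (0 : ℝ) < 2 * m ^ 2 / n := by positivity
    exact_mod_cast (by linarith : (c' : ℝ) < c)
  have hle : (c' : ℝ) + 1 ≤ c := by exact_mod_cast hlt
  have hnm : n ≤ 2 * m ^ 2 := by
    have : 1 ≤ 2 * m ^ 2 / n := by linarith
    rwa [le_div_iff₀ (by linarith), one_mul] at this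
  have key : d * n = m ^ 2 * n + d ^ 2 - 2 * m ^ 2 := by
    have := hdiag p
    rw [hsq] at this
    field_simp at this
    linarith
  nlinarith [sq_nonneg (n - 2 * d)]

end SimpleGraph

/-- Let `G` be a connected regular simple graph on `n` vertices whose
adjacency matrix has characteristic polynomial `(X - λ)(X - μ)^(n-k-t-1) X^t (X + μ)^k`,
where `t, k ≥ 1`, `t + k ≤ n - 2` and `λ > μ > 0`.  Then `t ≥ 2`, i.e. `0` is not a
simple eigenvalue of `G`. -/
theorem stmt11 {n t k : ℕ} (G : SimpleGraph (Fin n)) [DecidableRel G.Adj]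
    (hconn : G.Connected) (hreg : ∃ d : ℕ, G.IsRegularOfDegree d)
    (lam mu : ℝ) (hlm : mu < lam) (hmu : 0 < mu)
    (ht : 1 ≤ t) (hk : 1 ≤ k) (htk : t + k ≤ n - 2)
    (hchar : (G.adjMatrix ℝ).charpoly =
      (X - C lam) * (X - C mu) ^ (n - k - t - 1) * X ^ t * (X + C mu) ^ k) :
    2 ≤ t := by
  by_contra! hlt
  obtain rfl : t = 1 := by lia
  obtain ⟨d, hd⟩ := hreg
  obtain ⟨U, e, hU, hU', hAU, hroots⟩ :=
    (G.isSymm_adjMatrix (α := ℝ)).exists_orthogonal_diagonalization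
  have hXmu : (X + C mu : ℝ[X]) = X - C (-mu) := by simp
  have hne : (G.adjMatrix ℝ).charpoly ≠ 0 := (Matrix.charpoly_monic _).ne_zero
  have hmul : (G.adjMatrix ℝ).charpoly.roots =
      {lam} + (n - k - 1 - 1) • {mu} + {0} + k • {-mu} := by
    rw [hchar] at hne ⊢
    rw [roots_mul hne, roots_mul (left_ne_zero_of_mul hne),
      roots_mul (left_ne_zero_of_mul (left_ne_zero_of_mul hne)), hXmu, pow_one, roots_pow, roots_pow,
      roots_X, roots_X_sub_C, roots_X_sub_C, roots_X_sub_C]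
  have hn : n = 4 := by
    have hcount : ∀ r, (Finset.univ.filter fun l => r = e l).card =
        ({lam} + (n - k - 1 - 1) • {mu} + {0} + k • {-mu} : Multiset ℝ).count r := fun r => by
      rw [← hmul, hroots, Multiset.count_map]; rfl
    have hlam := hcount lam
    have hzero := hcount 0
    simp only [Multiset.count_add, Multiset.count_nsmul, Multiset.count_singleton] at hlam hzero
    rw [if_pos trivial, if_neg hlm.ne', if_neg (by linarith), if_neg (by linarith)] at hlam
    rw [if_pos trivial, if_neg (by linarith), if_neg hmu.ne, if_neg (by linarith)] at hzero
    simp only [mul_zero, add_zero, zero_add] at hlam hzero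
    obtain ⟨i, hi⟩ := Finset.card_eq_one.mp hlam
    obtain ⟨j, hj⟩ := Finset.card_eq_one.mp hzero
    have hi' : ∀ l, lam = e l ↔ l = i := fun l => by simpa using Finset.ext_iff.mp hi l
    have hj' : ∀ l, 0 = e l ↔ l = j := fun l => by simpa using Finset.ext_iff.mp hj l
    have he : ∀ l, l ≠ i → l ≠ j → e l = mu ∨ e l = -mu := fun l hli hlj => by
      have hmem : e l ∈ (G.adjMatrix ℝ).charpoly.roots := by rw [hroots]; simp
      rw [hmul] at hmem
      simp only [Multiset.mem_add, Multiset.mem_singleton, Multiset.mem_nsmul] at hmem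
      have h1 := mt (hi' l).mp hli
      have h2 := mt (hj' l).mp hlj
      tauto
    have hle : lam ≤ d := hd.eigenvalue_le (by rw [hmul]; simp)
    obtain ⟨z, hz, hz1, hA⟩ := hd.adjMatrix_mul_self_apply_of_eigenvalues hmu hlm hU hU' hAU hle
      ((hi' i).mpr rfl).symm ((hj' j).mpr rfl).symm he
    have := hd.card_le_four_of_adjMatrix_mul_self hmu hz hz1 hA
    rw [Fintype.card_fin] at this
    lia
  subst hn
  obtain rfl : k = 1 := by lia
  have htrace : Matrix.trace (G.adjMatrix ℝ) = (G.adjMatrix ℝ).charpoly.roots.sum := by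
    refine Matrix.trace_eq_sum_roots_charpoly_of_splits ?_
    rw [splits_iff_card_roots, hmul, Matrix.charpoly_natDegree_eq_dim]
    simp
  rw [hmul, SimpleGraph.trace_adjMatrix] at htrace
  simp at htrace
  linarith
end

section
/- Let G be a connected regular simple graph on n vertices whose adjacency matrix has characteristic polynomial (X − λ)·(X − μ)^(n−k−t−1)·X^t·(X + μ)^k, where t, k ≥ 1, t + k ≤ n−2, and λ > μ > 0, and suppose μ is a simple eigenvalue, i.e., n − k − t − 1 = 1. Then μ is even, λ = 2μ, n = 4μ, k = 3, and t = n − 5. -/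
open Polynomial

open scoped Matrix in
/-- A real symmetric matrix has an orthonormal eigenbasis, described in coordinates. -/
theorem Matrix.IsHermitian.exists_orthonormal_eigenvectors {V : Type*} [Fintype V] [DecidableEq V]
    {A : Matrix V V ℝ} (hA : A.IsHermitian) :
    ∃ u : V → V → ℝ, (∀ r, A *ᵥ u r = hA.eigenvalues r • u r) ∧
      (∀ i j, ∑ r, u r i * u r j = if i = j then 1 else 0) ∧
      ∀ r s, ∑ i, u r i * u s i = if r = s then 1 else 0 := by
  refine ⟨fun r => ⇑(hA.eigenvectorBasis r), hA.mulVec_eigenvectorBasis, fun i j => ?_,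
    fun r s => ?_⟩
  · have h := congrFun₂ (Unitary.coe_mul_star_self hA.eigenvectorUnitary) i j
    simpa [Matrix.mul_apply, Matrix.star_apply, Matrix.one_apply] using h
  · have h := congrFun₂ (Unitary.coe_star_mul_self hA.eigenvectorUnitary) r s
    simpa [Matrix.mul_apply, Matrix.star_apply, Matrix.one_apply] using h

open scoped Matrix in
/-- An eigenvector of a symmetric matrix with constant row sums `d` has zero coordinate sum, unless
its eigenvalue is `d`. -/
theorem Matrix.IsSymm.sum_eigenvector_eq_zero {V : Type*} [Fintype V]
    {A : Matrix V V ℝ} (hA : A.IsSymm) {d e : ℝ} (hrow : ∀ i, ∑ j, A i j = d)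
    {u : V → ℝ} (hu : A *ᵥ u = e • u) (hed : e ≠ d) : ∑ i, u i = 0 := by
  have h : e * ∑ i, u i = d * ∑ i, u i := by
    calc e * ∑ i, u i = ∑ i, ∑ j, A i j * u j := by
          rw [Finset.mul_sum]
          exact Finset.sum_congr rfl fun i _ => (congrFun hu i).symm
      _ = ∑ j, (∑ i, A j i) * u j := by
          rw [Finset.sum_comm]
          exact Finset.sum_congr rfl fun j _ => by
            rw [Finset.sum_mul]
            exact Finset.sum_congr rfl fun i _ => by rw [hA.apply]
      _ = d * ∑ i, u i := by simp_rw [hrow, Finset.mul_sum]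
  by_contra hne
  exact hed (mul_right_cancel₀ hne h)

/-- The row sums of the adjacency matrix of a `d`-regular graph are `d`. -/
theorem SimpleGraph.IsRegularOfDegree.sum_adjMatrix {V : Type*} [Fintype V]
    {G : SimpleGraph V} [DecidableRel G.Adj] {d : ℕ} (hreg : G.IsRegularOfDegree d) (i : V) :
    ∑ j, G.adjMatrix ℝ i j = d := by
  simpa [Matrix.mulVec, dotProduct] using
    SimpleGraph.adjMatrix_mulVec_const_apply_of_regular (α := ℝ) (a := 1) hreg (v := i)

open scoped Matrix in
/-- The eigenvalues of a `d`-regular graph are at most `d`. -/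
theorem SimpleGraph.IsRegularOfDegree.eigenvalue_le_s12 {V : Type*} [Fintype V] [DecidableEq V]
    {G : SimpleGraph V} [DecidableRel G.Adj] {d : ℕ} (hreg : G.IsRegularOfDegree d)
    {e : ℝ} {u : V → ℝ} (hu : G.adjMatrix ℝ *ᵥ u = e • u) (hu0 : u ≠ 0) : e ≤ d := by
  have he : Module.End.HasEigenvalue (Matrix.toLin' (G.adjMatrix ℝ)) e :=
    Module.End.hasEigenvalue_of_hasEigenvector (x := u)
      ⟨Module.End.mem_eigenspace_iff.2 (by rwa [Matrix.toLin'_apply]), hu0⟩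
  obtain ⟨i, hi⟩ := eigenvalue_mem_ball he
  rw [Metric.mem_closedBall, Real.dist_eq] at hi
  have hsum : ∑ j ∈ Finset.univ.erase i, ‖G.adjMatrix ℝ i j‖ ≤ d := by
    calc _ ≤ ∑ j, ‖G.adjMatrix ℝ i j‖ :=
          Finset.sum_le_sum_of_subset_of_nonneg (Finset.erase_subset _ _)
            fun _ _ _ => norm_nonneg _
      _ = ∑ j, G.adjMatrix ℝ i j := Finset.sum_congr rfl fun j _ => by
          by_cases h : G.Adj i j <;> simp [h]
      _ = d := hreg.sum_adjMatrix i
  have h0 : G.adjMatrix ℝ i i = 0 := by simp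
  rw [h0, sub_zero] at hi
  exact (le_abs_self e).trans (hi.trans hsum)

open scoped Matrix in
/-- If the spectrum of a symmetric matrix `A` with constant row sums `lam` is `lam`, `mu`, both
simple, together with `0` and `-mu`, then `A² + mu A` is explicit in terms of a unit
`mu`-eigenvector `v`. -/
theorem Matrix.IsHermitian.exists_sq_add_eq {V : Type*} [Fintype V] [DecidableEq V]
    {A : Matrix V V ℝ} (hA : A.IsHermitian) {lam mu : ℝ} (hrow : ∀ i, ∑ j, A i j = lam)
    {p q : V} (hpq : p ≠ q) (hmu : 0 < mu) (hlm : mu < lam)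
    (hp : hA.eigenvalues p = lam) (hq : hA.eigenvalues q = mu)
    (hrest : ∀ r, r ≠ p → r ≠ q → hA.eigenvalues r = 0 ∨ hA.eigenvalues r = -mu) :
    ∃ v : V → ℝ, A *ᵥ v = mu • v ∧ ∑ i, v i = 0 ∧ ∑ i, v i ^ 2 = 1 ∧
      ∀ i j, ∑ l, A i l * A j l + mu * A i j =
        lam * (lam + mu) / Fintype.card V + 2 * mu ^ 2 * (v i * v j) := by
  have hsymm : A.IsSymm := (Matrix.conjTranspose_eq_transpose_of_trivial A).symm.trans hA
  obtain ⟨u, hu, hcol, hrowu⟩ := hA.exists_orthonormal_eigenvectors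
  have hzero : ∀ r, r ≠ p → ∑ i, u r i = 0 := fun r hr => by
    refine hsymm.sum_eigenvector_eq_zero hrow (hu r) ?_
    by_cases hrq : r = q
    · rw [hrq, hq]; exact hlm.ne
    · rcases hrest r hr hrq with h | h <;> rw [h] <;> linarith
  have hone : ∀ i, (∑ l, u p l) * u p i = 1 := fun i => by
    calc (∑ l, u p l) * u p i = ∑ r, (∑ l, u r l) * u r i := by
          symm
          apply Finset.sum_eq_single p
          · intro r _ hr
            rw [hzero r hr, zero_mul]
          · simp
      _ = ∑ l, ∑ r, u r l * u r i := by simp_rw [Finset.sum_mul]; exact Finset.sum_comm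
      _ = 1 := by simp [hcol]
  set w := ∑ l, u p l
  have hw0 : w ≠ 0 := fun h => by simpa [h] using hone p
  have hup : ∀ i, u p i = w⁻¹ := fun i => eq_inv_of_mul_eq_one_right (hone i)
  have hcard : w⁻¹ * w⁻¹ = 1 / (Fintype.card V : ℝ) := by
    have h := hrowu p p
    simp only [hup, Finset.sum_const, Finset.card_univ, nsmul_eq_mul, if_true] at h
    exact eq_one_div_of_mul_eq_one_right h
  have hentry : ∀ r i, ∑ j, A i j * u r j = hA.eigenvalues r * u r i :=
    fun r i => congrFun (hu r) i
  have hsq : ∀ i j, ∑ l, A i l * A j l =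
      ∑ r, hA.eigenvalues r ^ 2 * (u r i * u r j) := fun i j => by
    have h : ∀ r, hA.eigenvalues r ^ 2 * (u r i * u r j) =
        ∑ l, ∑ m, A i l * A j m * (u r l * u r m) := fun r => by
      calc _ = (hA.eigenvalues r * u r i) * (hA.eigenvalues r * u r j) := by ring
        _ = _ := by
          rw [← hentry, ← hentry, Finset.sum_mul_sum]
          exact Finset.sum_congr rfl fun l _ => Finset.sum_congr rfl fun m _ => by ring
    simp_rw [h]
    rw [Finset.sum_comm]
    refine Finset.sum_congr rfl fun l _ => ?_
    rw [Finset.sum_comm]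
    simp_rw [← Finset.mul_sum, hcol]
    simp
  have hlin : ∀ i j, A i j = ∑ r, hA.eigenvalues r * (u r i * u r j) := fun i j => by
    simp_rw [← mul_assoc, ← hentry, Finset.sum_mul]
    rw [Finset.sum_comm]
    simp_rw [mul_assoc, ← Finset.mul_sum, hcol]
    simp
  refine ⟨u q, hq ▸ hu q, hzero q hpq.symm, by simpa [sq] using hrowu q q, fun i j => ?_⟩
  rw [hsq, hlin i j, Finset.mul_sum, ← Finset.sum_add_distrib,
    Finset.sum_eq_add p q hpq ?_ (by simp) (by simp), hp, hq, hup i, hup j, hcard]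
  · ring
  · rintro r - ⟨hrp, hrq⟩
    rcases hrest r hrp hrq with h | h <;> rw [h] <;> ring

/-- A balanced `±1` eigenvector `s` for which `A² + mu A` is a combination of `J` and `s sᵀ`
determines the order of the graph, and the parity of `lam - mu`. -/
theorem SimpleGraph.card_eq_of_sign_eigenvector {V : Type*} [Fintype V] [DecidableEq V]
    [Nonempty V] (G : SimpleGraph V) [DecidableRel G.Adj] {lam mu a b : ℝ} {s : V → ℝ}
    (hmu : 0 < mu) (hlm : mu < lam) (hrow : ∀ i, ∑ j, G.adjMatrix ℝ i j = lam)
    (hs : ∀ i, s i = 1 ∨ s i = -1) (hsum : ∑ i, s i = 0)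
    (hAs : ∀ i, ∑ j, G.adjMatrix ℝ i j * s j = mu * s i) (hab : a + b = lam)
    (hM : ∀ i j, ∑ l, G.adjMatrix ℝ i l * G.adjMatrix ℝ j l + mu * G.adjMatrix ℝ i j =
      a + b * (s i * s j)) :
    (Fintype.card V : ℝ) = lam + 2 * mu ∧ ∃ c : ℕ, lam - mu = 2 * c := by
  set A := G.adjMatrix ℝ with hA
  have h01 : ∀ i j, A i j = 0 ∨ A i j = 1 := fun i j => by
    by_cases h : G.Adj i j <;> simp [hA, h]
  have hsymm : ∀ i j, A i j = A j i := fun i j => by simp [hA, G.adj_comm]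
  have hss : ∀ i, s i * s i = 1 := fun i => by rcases hs i with h | h <;> simp [h]
  have hle : ∀ i l, s i = s l → A i l = 0 → ∀ j, A i j ≤ A l j := fun i l hil h0 j => by
    have h := hM i l
    rw [h0, ← hil, hss, mul_one, hab, mul_zero, add_zero, ← hrow i] at h
    have h' : ∑ j, (A i j - A i j * A l j) = 0 := by rw [Finset.sum_sub_distrib, h, sub_self]
    have hnn : ∀ j ∈ Finset.univ, 0 ≤ A i j - A i j * A l j := fun j _ => by
      rcases h01 i j with h | h <;> rcases h01 l j with h2 | h2 <;> simp [h, h2]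
    have := (Finset.sum_eq_zero_iff_of_nonneg hnn).1 h' j (Finset.mem_univ j)
    rcases h01 i j with h | h <;> rcases h01 l j with h2 | h2 <;> simp [h, h2] at this ⊢
  have htwin : ∀ i l, s i = s l → A i l = 0 → ∀ j, A i j = A l j := fun i l hil h0 j =>
    (hle i l hil h0 j).antisymm (hle l i hil.symm (hsymm i l ▸ h0) j)
  have hhalf : ∀ i j, s i * s j = -1 → ∑ l, (1 + s i * s l) / 2 * (A i l * A j l) =
      (lam - mu) / 2 - A i j * (Fintype.card V - lam - mu) / 2 := fun i j hij => by
    calc _ = ∑ l, (1 + s i * s l) / 2 * (A j l - (1 - A i l) * A i j) := by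
          refine Finset.sum_congr rfl fun l _ => ?_
          by_cases hil : s i = s l
          · rcases h01 i l with h | h
            · rw [h, htwin i l hil h j, hsymm l j]; ring
            · rw [h]; ring
          · have : s i * s l = -1 := by
              rcases hs i with h | h <;> rcases hs l with h2 | h2 <;> simp [h, h2] at hil ⊢
            rw [this]; ring
      _ = ∑ l, (A j l / 2 + s i / 2 * (A j l * s l) - A i j / 2 - A i j * s i / 2 * s l
            + A i j / 2 * A i l + A i j * s i / 2 * (A i l * s l)) :=
          Finset.sum_congr rfl fun l _ => by ring
      _ = _ := by
          simp only [Finset.sum_add_distrib, Finset.sum_sub_distrib, ← Finset.mul_sum,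
            ← Finset.sum_div, hrow, hAs, hsum, Finset.sum_const, Finset.card_univ, nsmul_eq_mul]
          linear_combination (mu / 2) * hij + (A i j * mu / 2) * hss i
  have hcross : ∀ i j, s i * s j = -1 →
      lam - mu - A i j * (Fintype.card V - lam - 2 * mu) = a - b := fun i j hij => by
    have h1 := hhalf i j hij
    have h2 := hhalf j i (by rw [mul_comm, hij])
    have h3 : ∑ l, A i l * A j l = ∑ l, (1 + s i * s l) / 2 * (A i l * A j l) +
        ∑ l, (1 + s j * s l) / 2 * (A j l * A i l) := by
      rw [← Finset.sum_add_distrib]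
      refine Finset.sum_congr rfl fun l _ => ?_
      have : s j = - s i := by
        rcases hs i with h | h <;> rcases hs j with h2 | h2 <;> simp [h, h2] at hij ⊢ <;> linarith
      rw [this]; ring
    have h4 := hM i j
    rw [h3, h1, h2, hsymm j i, hij] at h4
    linear_combination h4
  obtain ⟨i⟩ := ‹Nonempty V›
  have hdeg : ∑ j, (1 - s i * s j) / 2 * A i j = (lam - mu) / 2 := by
    calc _ = ∑ j, (A i j / 2 - s i / 2 * (A i j * s j)) :=
          Finset.sum_congr rfl fun j _ => by ring
      _ = _ := by
          rw [Finset.sum_sub_distrib, ← Finset.sum_div, ← Finset.mul_sum, hrow, hAs]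
          linear_combination (-mu / 2) * hss i
  constructor
  · by_contra hne
    obtain ⟨x, hx⟩ : ∃ x : ℝ, ∀ j, s i * s j = -1 → A i j = x := by
      refine ⟨(lam - mu - (a - b)) / (Fintype.card V - lam - 2 * mu), fun j hj => ?_⟩
      rw [eq_div_iff fun h => hne (by linarith)]
      linarith [hcross i j hj]
    have hxn : x * Fintype.card V = lam - mu := by
      have : ∑ j, (1 - s i * s j) / 2 * A i j = ∑ j, (x / 2 - x * s i / 2 * s j) := by
        refine Finset.sum_congr rfl fun j _ => ?_
        by_cases hj : s i * s j = -1
        · rw [hx j hj]; ring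
        · have h1 : s i * s j = 1 := by
            rcases hs i with h | h <;> rcases hs j with h2 | h2 <;> simp [h, h2] at hj ⊢
          linear_combination (x / 2 - A i j / 2) * h1
      rw [hdeg, Finset.sum_sub_distrib, ← Finset.mul_sum, hsum] at this
      simp at this
      linarith
    obtain ⟨j, hj⟩ : ∃ j, s i * s j = -1 := by
      by_contra! hall
      have : ∑ j, s i * s j = ∑ _j : V, (1 : ℝ) := Finset.sum_congr rfl fun j _ => by
        have := hall j
        rcases hs i with h | h <;> rcases hs j with h2 | h2 <;> simp [h, h2] at this ⊢
      rw [← Finset.mul_sum, hsum] at this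
      simp only [mul_zero, Finset.sum_const, Finset.card_univ, nsmul_eq_mul, mul_one] at this
      exact Fintype.card_ne_zero (α := V) (by exact_mod_cast this.symm)
    have hlamle : lam ≤ Fintype.card V := by
      rw [← hrow i]
      calc _ ≤ ∑ _j : V, (1 : ℝ) := Finset.sum_le_sum fun j _ => by
            rcases h01 i j with h | h <;> simp [h]
        _ = _ := by simp
    rcases h01 i j with h | h <;> rw [← hx j hj, h] at hxn <;> linarith
  · refine ⟨(Finset.univ.filter fun j => s i * s j = -1 ∧ A i j = 1).card, ?_⟩
    rw [Finset.card_filter]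
    push_cast
    have : ∑ j, (1 - s i * s j) / 2 * A i j =
        ∑ j, if s i * s j = -1 ∧ A i j = 1 then (1 : ℝ) else 0 := by
      refine Finset.sum_congr rfl fun j _ => ?_
      rcases h01 i j with h | h <;> rcases hs i with h1 | h1 <;> rcases hs j with h2 | h2 <;>
        norm_num [h, h1, h2]
    linarith

/-- Let `G` be a connected regular simple graph on `n` vertices whose
adjacency matrix has characteristic polynomial `(X - λ)(X - μ)^(n-k-t-1) X^t (X + μ)^k`,
where `t, k ≥ 1`, `t + k ≤ n - 2` and `λ > μ > 0`, and suppose `μ` is a simple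
eigenvalue, i.e. `n - k - t - 1 = 1`.  Then `μ` is even, `λ = 2μ`, `n = 4μ`, `k = 3`
and `t = n - 5`. -/
theorem stmt12 {n t k : ℕ} (G : SimpleGraph (Fin n)) [DecidableRel G.Adj]
    (hconn : G.Connected) (hreg : ∃ d : ℕ, G.IsRegularOfDegree d)
    (lam mu : ℝ) (hlm : mu < lam) (hmu : 0 < mu)
    (ht : 1 ≤ t) (hk : 1 ≤ k) (htk : t + k ≤ n - 2)
    (hchar : (G.adjMatrix ℝ).charpoly =
      (X - C lam) * (X - C mu) ^ (n - k - t - 1) * X ^ t * (X + C mu) ^ k)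
    (hsimple : n - k - t - 1 = 1) :
    (∃ c : ℤ, mu = 2 * (c : ℝ)) ∧ lam = 2 * mu ∧ (n : ℝ) = 4 * mu ∧
      k = 3 ∧ t = n - 5 := by
  obtain ⟨d, hreg⟩ := hreg
  have : Nonempty (Fin n) := hconn.nonempty
  have hA := G.isHermitian_adjMatrix ℝ
  have hroots : Finset.univ.val.map hA.eigenvalues =
      lam ::ₘ mu ::ₘ (Multiset.replicate t 0 + Multiset.replicate k (-mu)) := by
    have h := hA.roots_charpoly_eq_eigenvalues
    have hX : (X + C mu : ℝ[X]) = X - C (-mu) := by simp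
    have h1 : (X - C lam : ℝ[X]) ≠ 0 := X_sub_C_ne_zero _
    have h2 : (X - C mu : ℝ[X]) ≠ 0 := X_sub_C_ne_zero _
    have h3 : (X - C (-mu) : ℝ[X]) ≠ 0 := X_sub_C_ne_zero _
    rw [hchar, hsimple, pow_one, hX, roots_mul (by simp [h1, h2, h3, -map_neg]),
      roots_mul (by simp [h1, h2]), roots_mul (by simp [h1, h2])] at h
    simp only [roots_X_sub_C, roots_pow, roots_X, Multiset.nsmul_singleton] at h
    exact Eq.trans h.symm (by
      simp [← Multiset.singleton_add, add_assoc])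
  obtain ⟨p, -, hp⟩ : ∃ p ∈ Finset.univ.val, hA.eigenvalues p = lam :=
    Multiset.mem_map.1 (by simp [hroots])
  obtain ⟨q, -, hq⟩ : ∃ q ∈ Finset.univ.val, hA.eigenvalues q = mu :=
    Multiset.mem_map.1 (by simp [hroots])
  have hpq : p ≠ q := by rintro rfl; linarith
  have hrest : ∀ r, r ≠ p → r ≠ q → hA.eigenvalues r = 0 ∨ hA.eigenvalues r = -mu := by
    intro r hrp hrq
    have hval : (Finset.univ : Finset (Fin n)).val =
        p ::ₘ q ::ₘ ((Finset.univ.erase p).erase q).val := by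
      rw [Finset.erase_val, Multiset.cons_erase (Finset.mem_erase.2 ⟨hpq.symm, Finset.mem_univ q⟩), Finset.erase_val,
        Multiset.cons_erase (by simp)]
    rw [hval, Multiset.map_cons, Multiset.map_cons, hp, hq, Multiset.cons_inj_right,
      Multiset.cons_inj_right] at hroots
    have hmem : hA.eigenvalues r ∈ Multiset.replicate t 0 + Multiset.replicate k (-mu) :=
      hroots ▸ Multiset.mem_map_of_mem _ 
        (Finset.mem_erase.2 ⟨hrq, Finset.mem_erase.2 ⟨hrp, Finset.mem_univ r⟩⟩)
    rw [Multiset.mem_add] at hmem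
    exact hmem.imp Multiset.eq_of_mem_replicate Multiset.eq_of_mem_replicate
  have htrace : lam + mu = k * mu := by
    have h := hA.trace_eq_sum_eigenvalues
    have h' : ∑ i, hA.eigenvalues i = (Finset.univ.val.map hA.eigenvalues).sum := rfl
    rw [G.trace_adjMatrix ℝ] at h
    simp only [RCLike.ofReal_real_eq_id, id_eq] at h
    rw [h', hroots] at h
    simp at h
    linarith
  have hd : (d : ℝ) = lam := by
    obtain ⟨u, hu, hcol, hrowu⟩ := hA.exists_orthonormal_eigenvectors
    have hle : lam ≤ d := by
      refine hreg.eigenvalue_le_s12 (u := u p) (hp ▸ hu p) fun h => ?_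
      simpa [h] using hrowu p p
    by_contra hne
    have hlt : lam < d := lt_of_le_of_ne hle (Ne.symm hne)
    have hz : ∀ r, ∑ l, u r l = 0 := fun r => by
      refine (G.isSymm_adjMatrix (α := ℝ)).sum_eigenvector_eq_zero hreg.sum_adjMatrix (hu r) ?_
      by_cases hrp : r = p
      · rw [hrp, hp]; exact hlt.ne
      by_cases hrq : r = q
      · rw [hrq, hq]; exact (hlm.trans hlt).ne
      rcases hrest r hrp hrq with h | h <;> rw [h] <;> linarith
    have : ∑ l, ∑ r, u r l * u r p = 0 := by
      rw [Finset.sum_comm]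
      simp [← Finset.sum_mul, hz]
    simp [hcol] at this
  have hrow : ∀ i, ∑ j, G.adjMatrix ℝ i j = lam := fun i => (hreg.sum_adjMatrix i).trans hd
  obtain ⟨v, hv, hv0, hv1, hM⟩ := hA.exists_sq_add_eq hrow hpq hmu hlm hp hq hrest
  have hn0 : (0 : ℝ) < n := by
    have := Fin.pos p
    exact_mod_cast this
  rw [Fintype.card_fin] at hM
  have hdiag : ∀ i, lam = lam * (lam + mu) / n + 2 * mu ^ 2 * v i ^ 2 := fun i => by
    have h : ∑ l, G.adjMatrix ℝ i l * G.adjMatrix ℝ i l = lam := by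
      rw [← hrow i]
      exact Finset.sum_congr rfl fun l _ => by by_cases h : G.Adj i l <;> simp [h]
    have h0 : G.adjMatrix ℝ i i = 0 := by simp
    have := hM i i
    rw [h, h0] at this
    linear_combination this
  have hdiag_sum : (n : ℝ) * lam = lam * (lam + mu) + 2 * mu ^ 2 := by
    have : ∑ _i : Fin n, lam = ∑ i, (lam * (lam + mu) / n + 2 * mu ^ 2 * v i ^ 2) :=
      Finset.sum_congr rfl fun i _ => hdiag i
    rw [Finset.sum_add_distrib, ← Finset.mul_sum, hv1] at this
    simp only [Finset.sum_const, Finset.card_univ, Fintype.card_fin, nsmul_eq_mul, mul_one] at this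
    rwa [mul_div_cancel₀ _ hn0.ne'] at this
  have hvsq : ∀ i, (n : ℝ) * v i ^ 2 = 1 := fun i => by
    have h := hdiag i
    field_simp at h
    have h2 : 2 * mu ^ 2 * (n * v i ^ 2) = 2 * mu ^ 2 * 1 := by linear_combination hdiag_sum - h
    exact mul_left_cancel₀ (by positivity) h2
  have hsqrt : √(n : ℝ) * √(n : ℝ) = n := Real.mul_self_sqrt hn0.le
  obtain ⟨hcard, c, hc⟩ := G.card_eq_of_sign_eigenvector (s := fun i => √(n : ℝ) * v i)
    (a := lam * (lam + mu) / n) (b := 2 * mu ^ 2 / n) hmu hlm hrow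
    (fun i => sq_eq_one_iff.1 (by
      linear_combination hvsq i + v i ^ 2 * hsqrt))
    (by rw [← Finset.mul_sum, hv0, mul_zero])
    (fun i => by
      have h : ∑ j, G.adjMatrix ℝ i j * v j = mu * v i := congrFun hv i
      calc _ = √(n : ℝ) * ∑ j, G.adjMatrix ℝ i j * v j := by
            rw [Finset.mul_sum]
            exact Finset.sum_congr rfl fun j _ => by ring
        _ = _ := by rw [h]; ring)
    (by field_simp; linear_combination -hdiag_sum)
    (fun i j => by
      rw [hM i j]
      field_simp
      linear_combination (-2 * mu ^ 2 * v i * v j) * hsqrt)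
  rw [Fintype.card_fin] at hcard
  have hlam : lam = 2 * mu := by
    rw [hcard] at hdiag_sum
    exact mul_left_cancel₀ hmu.ne' (by linear_combination hdiag_sum)
  have hk3 : k = 3 := by
    have h : (k : ℝ) * mu = 3 * mu := by linear_combination hlam - htrace
    exact_mod_cast mul_right_cancel₀ hmu.ne' h
  refine ⟨⟨c, ?_⟩, hlam, by rw [hcard, hlam]; ring, hk3, by omega⟩
  push_cast
  linear_combination hc - hlam
end

section
/- Let G be a finite simple graph (possibly disconnected) and let λ > 0 be a real number. Then every nonzero eigenvalue of G has absolute value λ if and only if every connected component of G, regarded as an induced subgraph, is either a single vertex or is isomorphic to a complete bipartite graph K_{p,q} with p·q = λ². -/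
open Polynomial
open scoped Matrix

namespace SimpleGraph

variable {V : Type*} (G : SimpleGraph V)

theorem adjMatrix_pow_three_of_roots [Fintype V] [DecidableEq V] [DecidableRel G.Adj] (lam : ℝ)
    (h : ∀ x ∈ (G.adjMatrix ℝ).charpoly.roots, x ≠ 0 → |x| = lam) :
    G.adjMatrix ℝ ^ 3 = lam ^ 2 • G.adjMatrix ℝ := by
  have hA : (G.adjMatrix ℝ).IsHermitian := by
    rw [Matrix.IsHermitian, Matrix.conjTranspose_eq_transpose_of_trivial, transpose_adjMatrix]
  have hd : (Matrix.diagonal (RCLike.ofReal ∘ hA.eigenvalues) : Matrix V V ℝ) ^ 3 =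
      lam ^ 2 • Matrix.diagonal (RCLike.ofReal ∘ hA.eigenvalues) := by
    rw [Matrix.diagonal_pow, ← Matrix.diagonal_smul]
    congr 1
    ext i
    have hi : hA.eigenvalues i ∈ (G.adjMatrix ℝ).charpoly.roots := by
      rw [hA.roots_charpoly_eq_eigenvalues]
      simp
    by_cases h0 : hA.eigenvalues i = 0
    · simp [h0]
    · simp only [Pi.pow_apply, Function.comp_apply, Pi.smul_apply, smul_eq_mul, ← h _ hi h0, sq_abs]
      simp
      ring
  rw [hA.spectral_theorem, ← map_pow, hd, map_smul]

theorem sq_eq_degree_mul_degree_of_mulVec [Fintype V] [DecidableRel G.Adj] {x : V → ℝ} {μ : ℝ}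
    (hμ : μ ≠ 0) (hx : x ≠ 0)
    (hclosed : ∀ u a b v, G.Adj u a → G.Adj a b → G.Adj b v → G.Adj u v)
    (h : G.adjMatrix ℝ *ᵥ x = μ • x) :
    ∃ u v, G.Adj u v ∧ μ ^ 2 = (G.degree u : ℝ) * G.degree v := by
  have hs (u : V) : ∑ w ∈ G.neighborFinset u, x w = μ * x u := by
    rw [← adjMatrix_mulVec_apply, h]; rfl
  have hc {u v : V} (huv : G.Adj u v) : μ * x u = G.degree u * x v := by
    rw [← hs, ← card_neighborFinset_eq_degree, ← nsmul_eq_mul]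
    refine Finset.sum_eq_card_nsmul fun w hw => ?_
    rw [mem_neighborFinset] at hw
    apply mul_left_cancel₀ hμ
    rw [← hs, ← hs]
    congr 1
    ext y
    simp only [mem_neighborFinset]
    exact ⟨fun hy => hclosed _ _ _ _ huv.symm hw hy, fun hy => hclosed _ _ _ _ hw.symm huv hy⟩
  obtain ⟨u, hu⟩ := Function.ne_iff.1 hx
  have hne : ∑ w ∈ G.neighborFinset u, x w ≠ 0 := by rw [hs]; exact mul_ne_zero hμ hu
  obtain ⟨v, hv, -⟩ := Finset.exists_ne_zero_of_sum_ne_zero hne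
  rw [mem_neighborFinset] at hv
  refine ⟨u, v, hv, mul_right_cancel₀ hu ?_⟩
  linear_combination μ * hc hv + (G.degree u : ℝ) * hc hv.symm

theorem adj_of_adjMatrix_pow_three [Fintype V] [DecidableEq V] [DecidableRel G.Adj] {r : ℝ}
    (h : G.adjMatrix ℝ ^ 3 = r • G.adjMatrix ℝ)
    {u a b v : V} (hua : G.Adj u a) (hab : G.Adj a b) (hbv : G.Adj b v) : G.Adj u v := by
  by_contra hn
  have h1 := congr_fun₂ h u v
  rw [adjMatrix_pow_apply_eq_card_walk, Matrix.smul_apply, adjMatrix_apply, if_neg hn,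
    smul_zero, Nat.cast_eq_zero, Fintype.card_eq_zero_iff] at h1
  exact h1.elim ⟨.cons hua (.cons hab (.cons hbv .nil)), rfl⟩

theorem degree_mul_degree_of_adjMatrix_pow_three [Fintype V] [DecidableEq V]
    [DecidableRel G.Adj] {r : ℝ} (h : G.adjMatrix ℝ ^ 3 = r • G.adjMatrix ℝ)
    {u v : V} (huv : G.Adj u v) : (G.degree u : ℝ) * G.degree v = r := by
  have h1 := congr_fun₂ h u v
  rw [Matrix.smul_apply, adjMatrix_apply, if_pos huv, smul_eq_mul, mul_one, pow_succ, pow_two,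
    mul_adjMatrix_apply] at h1
  rw [← h1, mul_comm, ← card_neighborFinset_eq_degree G v, ← nsmul_eq_mul]
  refine (Finset.sum_eq_card_nsmul fun w hw => ?_).symm
  rw [mem_neighborFinset] at hw
  rw [adjMatrix_mul_apply, ← card_neighborFinset_eq_degree, Finset.cast_card]
  refine Finset.sum_congr rfl fun a ha => ?_
  rw [mem_neighborFinset] at ha
  rw [adjMatrix_apply, if_pos (G.adj_of_adjMatrix_pow_three h ha.symm huv hw)]

/-- In a graph where vertices joined by a walk of length three are adjacent, the component of an
edge is complete bipartite, its parts being the neighborhoods of the two endpoints. -/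
theorem nonempty_iso_completeBipartiteGraph_of_adj [Fintype V] [DecidableRel G.Adj]
    (hclosed : ∀ u a b v, G.Adj u a → G.Adj a b → G.Adj b v → G.Adj u v) {v w : V}
    (hvw : G.Adj v w) :
    Nonempty (G.induce (G.connectedComponentMk v).supp ≃g
      completeBipartiteGraph (Fin (G.degree w)) (Fin (G.degree v))) := by
  have htri {a b c : V} (hab : G.Adj a b) (hbc : G.Adj b c) (hca : G.Adj c a) : False :=
    G.loopless.irrefl a (hclosed _ _ _ _ hab hbc hca)
  have hcover {x : V} (hx : G.Reachable v x) : G.Adj w x ∨ G.Adj v x := by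
    induction (reachable_iff_reflTransGen v x).1 hx with
    | refl => exact .inl hvw.symm
    | tail h1 h2 ih =>
      rcases ih ((reachable_iff_reflTransGen _ _).2 h1) with ih | ih
      · exact .inr (hclosed _ _ _ _ hvw ih h2)
      · exact .inl (hclosed _ _ _ _ hvw.symm ih h2)
  have hw (a : G.neighborSet w) : a.1 ∈ (G.connectedComponentMk v).supp :=
    ConnectedComponent.sound (hvw.reachable.trans a.2.reachable).symm
  have hv (a : G.neighborSet v) : a.1 ∈ (G.connectedComponentMk v).supp :=
    ConnectedComponent.sound a.2.reachable.symm
  let f : G.neighborSet w ⊕ G.neighborSet v → (G.connectedComponentMk v).supp :=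
    Sum.elim (fun a => ⟨a, hw a⟩) (fun a => ⟨a, hv a⟩)
  have hf : f.Bijective := by
    constructor
    · rintro (⟨a, ha⟩ | ⟨a, ha⟩) (⟨b, hb⟩ | ⟨b, hb⟩) hab <;>
        obtain rfl : a = b := congrArg Subtype.val hab
      · rfl
      · exact (htri hvw ha hb.symm).elim
      · exact (htri hvw hb ha.symm).elim
      · rfl
    · rintro ⟨x, hx⟩
      rcases hcover (ConnectedComponent.exact hx).symm with h | h
      · exact ⟨.inl ⟨x, h⟩, rfl⟩
      · exact ⟨.inr ⟨x, h⟩, rfl⟩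
  let e : completeBipartiteGraph (G.neighborSet w) (G.neighborSet v) ≃g
      G.induce (G.connectedComponentMk v).supp :=
    { toEquiv := Equiv.ofBijective f hf
      map_rel_iff' := by
        rintro (⟨a, ha⟩ | ⟨a, ha⟩) (⟨b, hb⟩ | ⟨b, hb⟩) <;>
          simp only [Equiv.ofBijective_apply, completeBipartiteGraph_adj, comap_adj, f,
            Sum.elim_inl, Sum.elim_inr, Function.Embedding.subtype_apply, Sum.isLeft_inl,
            Sum.isLeft_inr, Sum.isRight_inl, Sum.isRight_inr, Bool.false_eq_true, and_false,
            or_self, iff_false, and_true, or_false, false_or, iff_true]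
        · exact fun hab => htri ha hab hb.symm
        · exact hclosed _ _ _ _ ha.symm hvw.symm hb
        · exact hclosed _ _ _ _ ha.symm hvw hb
        · exact fun hab => htri ha hab hb.symm }
  have e₁ (u : V) : G.neighborSet u ≃ Fin (G.degree u) :=
    Fintype.equivFinOfCardEq (G.card_neighborSet_eq_degree u)
  exact ⟨e.symm.trans (completeBipartiteGraphCongr (e₁ w) (e₁ v))⟩

namespace ConnectedComponent

variable {G}

theorem adj_of_iso_completeBipartiteGraph {α β : Type*} (c : G.ConnectedComponent)
    (φ : G.induce c.supp ≃g completeBipartiteGraph α β) {u a b v : V} (hu : u ∈ c.supp)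
    (hua : G.Adj u a) (hab : G.Adj a b) (hbv : G.Adj b v) : G.Adj u v := by
  have ha := c.mem_supp_of_adj_mem_supp hu hua
  have hb := c.mem_supp_of_adj_mem_supp ha hab
  have hv := c.mem_supp_of_adj_mem_supp hb hbv
  have key (x y : c.supp) : G.Adj x y ↔ (completeBipartiteGraph α β).Adj (φ x) (φ y) :=
    φ.map_rel_iff.symm
  have h1 := (key ⟨u, hu⟩ ⟨a, ha⟩).1 hua
  have h2 := (key ⟨a, ha⟩ ⟨b, hb⟩).1 hab
  have h3 := (key ⟨b, hb⟩ ⟨v, hv⟩).1 hbv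
  refine (key ⟨u, hu⟩ ⟨v, hv⟩).2 ?_
  generalize φ ⟨u, hu⟩ = x at *
  generalize φ ⟨a, ha⟩ = y at *
  generalize φ ⟨b, hb⟩ = z at *
  generalize φ ⟨v, hv⟩ = t at *
  cases x <;> cases y <;> cases z <;> cases t <;> simp_all

theorem degree_eq_card_of_iso_eq_inl [Fintype V] [DecidableRel G.Adj] {α β : Type*} [Fintype β]
    (c : G.ConnectedComponent)
    (φ : G.induce c.supp ≃g completeBipartiteGraph α β) {u : c.supp} {i : α}
    (hi : φ u = .inl i) : G.degree u = Fintype.card β := by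
  let f : β ↪ V := ⟨fun j => (φ.symm (.inr j)).1, fun j k hjk => by
    simpa using φ.symm.injective (Subtype.val_injective hjk)⟩
  have hN : G.neighborFinset u = Finset.univ.map f := by
    ext w
    simp only [mem_neighborFinset, Finset.mem_map, Finset.mem_univ, true_and]
    constructor
    · intro hw
      have hadj := (φ.map_rel_iff (a := u)
        (b := ⟨w, c.mem_supp_of_adj_mem_supp u.2 hw⟩)).2 hw
      rw [hi] at hadj
      rcases hj : φ ⟨w, c.mem_supp_of_adj_mem_supp u.2 hw⟩ with j | j
      · simp [hj] at hadj
      · exact ⟨j, congrArg Subtype.val ((φ.symm_apply_eq).2 hj.symm)⟩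
    · rintro ⟨j, rfl⟩
      have hadj : (completeBipartiteGraph α β).Adj (φ u) (φ (φ.symm (.inr j))) := by
        simp [hi]
      exact φ.map_rel_iff.1 hadj
  rw [← card_neighborFinset_eq_degree, hN, Finset.card_map, Finset.card_univ]

theorem degree_mul_degree_of_iso_completeBipartiteGraph [Fintype V] [DecidableRel G.Adj]
    {α β : Type*} [Fintype α] [Fintype β] (c : G.ConnectedComponent)
    (φ : G.induce c.supp ≃g completeBipartiteGraph α β) {u v : V}
    (hu : u ∈ c.supp) (huv : G.Adj u v) :
    G.degree u * G.degree v = Fintype.card α * Fintype.card β := by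
  have hv := c.mem_supp_of_adj_mem_supp hu huv
  let ψ : G.induce c.supp ≃g completeBipartiteGraph β α :=
    φ.trans ⟨Equiv.sumComm α β, by rintro (a | a) (b | b) <;> simp⟩
  have hψ (x : c.supp) : ψ x = (φ x).swap := rfl
  have hadj : (completeBipartiteGraph α β).Adj (φ ⟨u, hu⟩) (φ ⟨v, hv⟩) := φ.map_rel_iff.2 huv
  rcases hi : φ ⟨u, hu⟩ with i | i <;> rcases hj : φ ⟨v, hv⟩ with j | j
  · simp [hi, hj] at hadj
  · rw [c.degree_eq_card_of_iso_eq_inl φ hi,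
      c.degree_eq_card_of_iso_eq_inl ψ (u := ⟨v, hv⟩) (i := j) (by rw [hψ, hj]; rfl), mul_comm]
  · rw [c.degree_eq_card_of_iso_eq_inl φ hj,
      c.degree_eq_card_of_iso_eq_inl ψ (u := ⟨u, hu⟩) (i := i) (by rw [hψ, hi]; rfl)]
  · simp [hi, hj] at hadj

end ConnectedComponent

end SimpleGraph

/-- Let `G` be a finite simple graph (possibly disconnected) and
`λ > 0`.  Every nonzero eigenvalue of `G` has absolute value `λ` iff every connected
component of `G` (as an induced subgraph) is either a single vertex or isomorphic to a
complete bipartite graph `K_{p,q}` with `p·q = λ²`. -/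
theorem stmt14 {V : Type*} [Fintype V] [DecidableEq V] (G : SimpleGraph V)
    [DecidableRel G.Adj] (lam : ℝ) (hlam : 0 < lam) :
    (∀ x ∈ (G.adjMatrix ℝ).charpoly.roots, x ≠ 0 → |x| = lam) ↔
      ∀ c : G.ConnectedComponent,
        Nat.card c.supp = 1 ∨
          ∃ p q : ℕ, 1 ≤ p ∧ 1 ≤ q ∧ ((p : ℝ) * q = lam ^ 2) ∧
            Nonempty ((G.induce c.supp) ≃g completeBipartiteGraph (Fin p) (Fin q)) := by
  constructor
  · intro h c
    have hA := G.adjMatrix_pow_three_of_roots lam h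
    have hclosed u a b v (h1 : G.Adj u a) (h2 : G.Adj a b) (h3 : G.Adj b v) : G.Adj u v :=
      G.adj_of_adjMatrix_pow_three hA h1 h2 h3
    induction c using SimpleGraph.ConnectedComponent.ind with | _ v
    by_cases hv : ∃ w, G.Adj v w
    · obtain ⟨w, hvw⟩ := hv
      refine .inr ⟨G.degree w, G.degree v, ?_, ?_,
        G.degree_mul_degree_of_adjMatrix_pow_three hA hvw.symm,
        G.nonempty_iso_completeBipartiteGraph_of_adj hclosed hvw⟩
      · exact (G.degree_pos_iff_exists_adj w).2 ⟨v, hvw.symm⟩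
      · exact (G.degree_pos_iff_exists_adj v).2 ⟨w, hvw⟩
    · refine .inl ?_
      have hs : (G.connectedComponentMk v).supp = {v} := by
        ext x
        refine ⟨fun hx => ?_, fun hx => hx ▸ rfl⟩
        by_contra hne
        obtain ⟨p⟩ := (SimpleGraph.ConnectedComponent.exact hx).symm
        cases p with
        | nil => exact hne rfl
        | cons hadj _ => exact hv ⟨_, hadj⟩
      simp [hs]
  · intro h x hx hx0
    have key {u v : V} (huv : G.Adj u v) : ∃ p q : ℕ, (p : ℝ) * q = lam ^ 2 ∧
        Nonempty (G.induce (G.connectedComponentMk u).supp ≃g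
          completeBipartiteGraph (Fin p) (Fin q)) := by
      rcases h (G.connectedComponentMk u) with h1 | ⟨p, q, -, -, hpq, hφ⟩
      · have hss := (Nat.card_eq_one_iff_unique.1 h1).1
        have huv' := congrArg Subtype.val (Subsingleton.elim
          (⟨u, rfl⟩ : (G.connectedComponentMk u).supp)
          ⟨v, SimpleGraph.ConnectedComponent.sound huv.symm.reachable⟩)
        exact (huv.ne huv').elim
      · exact ⟨p, q, hpq, hφ⟩
    have hroot := (mem_roots'.1 hx).2
    rw [IsRoot.def, Matrix.eval_charpoly] at hroot
    obtain ⟨y, hy0, hy⟩ := Matrix.exists_mulVec_eq_zero_iff.2 hroot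
    have hyx : G.adjMatrix ℝ *ᵥ y = x • y := by
      rw [Matrix.sub_mulVec, sub_eq_zero] at hy
      rw [← hy]
      ext i
      simp [Matrix.scalar_apply, Matrix.mulVec_diagonal]
    obtain ⟨u, v, huv, hdeg⟩ := G.sq_eq_degree_mul_degree_of_mulVec hx0 hy0
      (fun u a b v hua hab hbv => by
        obtain ⟨p, q, -, ⟨φ⟩⟩ := key hua
        exact (G.connectedComponentMk u).adj_of_iso_completeBipartiteGraph φ rfl hua hab hbv) hyx
    obtain ⟨p, q, hpq, ⟨φ⟩⟩ := key huv
    have hd := (G.connectedComponentMk u).degree_mul_degree_of_iso_completeBipartiteGraph φ rfl huv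
    rw [Fintype.card_fin, Fintype.card_fin] at hd
    rw [← Nat.cast_mul, hd, Nat.cast_mul, hpq, sq_eq_sq_iff_abs_eq_abs, abs_of_pos hlam] at hdeg
    exact hdeg
end

section
/- For integers p, q ≥ 1, the complete bipartite graph K_{p,q} has adjacency characteristic polynomial X^(p+q−2)·(X² − pq); equivalently, its eigenvalues are √(pq) and −√(pq), each with multiplicity 1, and 0 with multiplicity p + q − 2. -/
open Polynomial

/-- Adjacency of a complete bipartite graph is decidable. -/
instance (V W : Type*) : DecidableRel (completeBipartiteGraph V W).Adj := fun v w =>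
  inferInstanceAs (Decidable (v.isLeft ∧ w.isRight ∨ v.isRight ∧ w.isLeft))

/-- The adjacency matrix of a complete bipartite graph factors through a two-dimensional space. -/
theorem adjMatrix_completeBipartiteGraph_eq_mul (V W R : Type*) [NonAssocSemiring R] :
    (completeBipartiteGraph V W).adjMatrix R =
      (Matrix.of (Sum.elim (fun _ => ![1, 0]) (fun _ => ![0, 1])) : Matrix (V ⊕ W) (Fin 2) R) *
        (Matrix.of ![Sum.elim (fun _ => 0) (fun _ => 1), Sum.elim (fun _ => 1) (fun _ => 0)] :
          Matrix (Fin 2) (V ⊕ W) R) := by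
  ext (i | i) (j | j) <;> simp [Matrix.mul_apply, SimpleGraph.adjMatrix_apply]

/-- For `p, q ≥ 1`, the complete bipartite graph `K_{p,q}` has adjacency
characteristic polynomial `X^(p+q-2) * (X² - pq)`. -/
theorem stmt15 (p q : ℕ) (hp : 1 ≤ p) (hq : 1 ≤ q) :
    ((completeBipartiteGraph (Fin p) (Fin q)).adjMatrix ℝ).charpoly =
      X ^ (p + q - 2) * (X ^ 2 - C ((p : ℝ) * q)) := by
  have hle : Fintype.card (Fin 2) ≤ Fintype.card (Fin p ⊕ Fin q) := by
    simp only [Fintype.card_fin, Fintype.card_sum]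
    lia
  rw [adjMatrix_completeBipartiteGraph_eq_mul, Matrix.charpoly_mul_comm_of_le _ _ hle,
    Matrix.charpoly_fin_two]
  simp [Matrix.trace_fin_two, Matrix.det_fin_two, Matrix.vecMul, dotProduct, mul_comm, sub_eq_add_neg]
end

section
/- Let G be a connected simple graph on n ≥ 2 vertices. Then G is isomorphic to a complete r-partite graph (for some r ≥ 1 and some part sizes) if and only if the second largest eigenvalue λ₂ of G satisfies λ₂ ≤ 0. -/
open Polynomial

/-- The quadratic form of a real symmetric matrix, diagonalized in its eigenvector basis. -/
theorem Matrix.IsHermitian.dotProduct_mulVec_eq_sum {V : Type*} [Fintype V] [DecidableEq V]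
    {A : Matrix V V ℝ} (hA : A.IsHermitian) (v : V → ℝ) :
    v ⬝ᵥ A.mulVec v =
      ∑ i, hA.eigenvalues i * ((hA.eigenvectorBasis i).ofLp ⬝ᵥ v) ^ 2 := by
  have h := hA.eigenvectorBasis.sum_inner_mul_inner (WithLp.toLp 2 v) (WithLp.toLp 2 (A.mulVec v))
  simp only [EuclideanSpace.inner_eq_star_dotProduct, star_trivial] at h
  rw [dotProduct_comm, ← h]
  refine Finset.sum_congr rfl fun i _ => ?_
  have hT : A.transpose = A := by rwa [Matrix.isHermitian_iff_isSymm] at hA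
  have : A.mulVec v ⬝ᵥ (hA.eigenvectorBasis i).ofLp
      = hA.eigenvalues i * ((hA.eigenvectorBasis i).ofLp ⬝ᵥ v) := by
    rw [dotProduct_comm, Matrix.dotProduct_mulVec, ← Matrix.mulVec_transpose, hT,
      hA.mulVec_eigenvectorBasis, smul_dotProduct, smul_eq_mul]
  rw [this]
  ring

/-- A symmetric matrix that is negative semidefinite on the hyperplane of vectors orthogonal
to `w` has at most one positive eigenvalue. -/
theorem Matrix.IsHermitian.eigenvalues_nonpos_or_of_hyperplane {V : Type*} [Fintype V]
    [DecidableEq V] {A : Matrix V V ℝ} (hA : A.IsHermitian) (w : V → ℝ)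
    (h : ∀ v, w ⬝ᵥ v = 0 → v ⬝ᵥ A.mulVec v ≤ 0) {i j : V} (hij : i ≠ j) :
    hA.eigenvalues i ≤ 0 ∨ hA.eigenvalues j ≤ 0 := by
  by_contra! ⟨hi, hj⟩
  set x := (hA.eigenvectorBasis i).ofLp with hx
  set y := (hA.eigenvectorBasis j).ofLp with hy
  have hortho := orthonormal_iff_ite.1 hA.eigenvectorBasis.orthonormal
  simp only [EuclideanSpace.inner_eq_star_dotProduct, star_trivial] at hortho
  have hxx : x ⬝ᵥ x = 1 := by simpa using hortho i i
  have hyy : y ⬝ᵥ y = 1 := by simpa using hortho j j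
  have hyx : y ⬝ᵥ x = 0 := by simpa [hij] using hortho i j
  have hxy : x ⬝ᵥ y = 0 := by rw [dotProduct_comm, hyx]
  have key : ∀ a b : ℝ, a * (w ⬝ᵥ x) + b * (w ⬝ᵥ y) = 0 →
      a ^ 2 * hA.eigenvalues i + b ^ 2 * hA.eigenvalues j ≤ 0 := by
    intro a b hab
    have := h (a • x + b • y) (by simpa [dotProduct_add, dotProduct_smul] using hab)
    rw [Matrix.mulVec_add, Matrix.mulVec_smul, Matrix.mulVec_smul, hA.mulVec_eigenvectorBasis,
      hA.mulVec_eigenvectorBasis, ← hx, ← hy] at this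
    simp only [dotProduct_add, add_dotProduct, dotProduct_smul, smul_dotProduct, smul_eq_mul,
      hxx, hyy, hxy, hyx] at this
    linarith
  by_cases h0 : w ⬝ᵥ x = 0
  · have := key 1 0 (by simp [h0])
    linarith
  · have h1 := key (w ⬝ᵥ y) (-(w ⬝ᵥ x)) (by ring)
    have h2 : 0 < (-(w ⬝ᵥ x)) ^ 2 := sq_pos_of_ne_zero (neg_ne_zero.2 h0)
    nlinarith [mul_pos h2 hj, mul_nonneg (sq_nonneg (w ⬝ᵥ y)) hi.le]

/-- A symmetric matrix with at most one positive eigenvalue is not positive definite on any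
plane. -/
theorem Matrix.IsHermitian.exists_dotProduct_mulVec_nonpos {V : Type*} [Fintype V]
    [DecidableEq V] {A : Matrix V V ℝ} (hA : A.IsHermitian)
    (h : ∀ i j, i ≠ j → hA.eigenvalues i ≤ 0 ∨ hA.eigenvalues j ≤ 0) (p q : V → ℝ) :
    ∃ a b : ℝ, (a ≠ 0 ∨ b ≠ 0) ∧
      (a • p + b • q) ⬝ᵥ A.mulVec (a • p + b • q) ≤ 0 := by
  by_cases hpos : ∃ i, 0 < hA.eigenvalues i
  · obtain ⟨i, hi⟩ := hpos
    have hj : ∀ j, j ≠ i → hA.eigenvalues j ≤ 0 := fun j hji =>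
      (h j i hji).resolve_right hi.not_ge
    set x := (hA.eigenvectorBasis i).ofLp with hx
    obtain ⟨a, b, hab, h0⟩ : ∃ a b : ℝ, (a ≠ 0 ∨ b ≠ 0) ∧ x ⬝ᵥ (a • p + b • q) = 0 := by
      by_cases hp : x ⬝ᵥ p = 0
      · exact ⟨1, 0, by simp, by simp [hp]⟩
      · refine ⟨x ⬝ᵥ q, -(x ⬝ᵥ p), by simp [hp], ?_⟩
        simp only [dotProduct_add, dotProduct_smul, smul_eq_mul]
        ring
    refine ⟨a, b, hab, ?_⟩
    rw [hA.dotProduct_mulVec_eq_sum]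
    refine Finset.sum_nonpos fun j _ => ?_
    by_cases hji : j = i
    · rw [hji, ← hx, h0]
      simp
    · exact mul_nonpos_of_nonpos_of_nonneg (hj j hji) (sq_nonneg _)
  · push Not at hpos
    refine ⟨1, 0, by simp, ?_⟩
    rw [hA.dotProduct_mulVec_eq_sum]
    exact Finset.sum_nonpos fun j _ => mul_nonpos_of_nonpos_of_nonneg (hpos j) (sq_nonneg _)

/-- The second largest eigenvalue is nonpositive iff at most one eigenvalue is positive. -/
theorem Matrix.IsHermitian.second_eigenvalue_nonpos_iff {n : ℕ} (hn : 2 ≤ n)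
    {A : Matrix (Fin n) (Fin n) ℝ} (hA : A.IsHermitian) (e : ℕ → ℝ)
    (hanti : ∀ i j, i ≤ j → j < n → e j ≤ e i)
    (hroots : A.charpoly.roots = (Multiset.range n).map e) :
    e 1 ≤ 0 ↔ ∀ i j, i ≠ j → hA.eigenvalues i ≤ 0 ∨ hA.eigenvalues j ≤ 0 := by
  have hcard : (Finset.univ.filter fun i => 0 < hA.eigenvalues i).card
      = ((Finset.range n).filter fun k => 0 < e k).card := by
    have h := congrArg (Multiset.countP (0 < ·))
      (hA.roots_charpoly_eq_eigenvalues.symm.trans hroots)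
    rw [Multiset.countP_map, Multiset.countP_map] at h
    exact h
  have h1 : (∀ i j, i ≠ j → hA.eigenvalues i ≤ 0 ∨ hA.eigenvalues j ≤ 0) ↔
      (Finset.univ.filter fun i => 0 < hA.eigenvalues i).card ≤ 1 := by
    simp only [Finset.card_le_one, Finset.mem_filter, Finset.mem_univ, true_and]
    grind
  rw [h1, hcard, Finset.card_le_one]
  simp only [Finset.mem_filter, Finset.mem_range]
  constructor
  · intro h a ha b hb
    have hz : ∀ k, k < n → 0 < e k → k = 0 := fun k hk hk' => by
      by_contra hk0
      have := hanti 1 k (by omega) hk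
      linarith
    rw [hz a ha.1 ha.2, hz b hb.1 hb.2]
  · intro h
    by_contra! h1
    have := h 0 ⟨by omega, h1.trans_le (hanti 0 1 (by omega) (by omega))⟩ 1 ⟨by omega, h1⟩
    omega

/-- A complete multipartite graph on a finite vertex set is isomorphic to a standard one. -/
theorem SimpleGraph.IsCompleteMultipartite.exists_iso_fin {V : Type*} [Fintype V] [Nonempty V]
    {G : SimpleGraph V} (h : G.IsCompleteMultipartite) :
    ∃ (r : ℕ) (_ : 1 ≤ r) (p : Fin r → ℕ), (∀ i, 1 ≤ p i) ∧
      Nonempty (G ≃g SimpleGraph.completeMultipartiteGraph fun i => Fin (p i)) := by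
  classical
  let f := Fintype.equivFin (Quotient h.setoid)
  let g : V → Fin (Fintype.card (Quotient h.setoid)) := fun v => f (Quotient.mk h.setoid v)
  have hg : ∀ v w, g v = g w ↔ ¬ G.Adj v w := fun v w => by
    rw [f.injective.eq_iff, Quotient.eq]
    rfl
  refine ⟨Fintype.card (Quotient h.setoid),
    Fintype.card_pos_iff.2 ⟨Quotient.mk _ (Classical.arbitrary V)⟩,
    fun k => Fintype.card {v // g v = k}, fun k => ?_, ⟨⟨(Equiv.sigmaFiberEquiv g).symm.trans
      (Equiv.sigmaCongrRight fun k => Fintype.equivFin _), ?_⟩⟩⟩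
  · obtain ⟨v, hv⟩ := Quotient.exists_rep (f.symm k)
    exact Fintype.card_pos_iff.2 ⟨v, by simp [g, hv]⟩
  · intro v w
    change g v ≠ g w ↔ _
    rw [ne_eq, hg, not_not]

/-- The quadratic form of a complete multipartite graph is negative semidefinite on the vectors
with zero coordinate sum. -/
theorem SimpleGraph.dotProduct_adjMatrix_mulVec_nonpos {V ι : Type*} [Fintype V] [Fintype ι]
    [DecidableEq ι] (G : SimpleGraph V) [DecidableRel G.Adj] (c : V → ι)
    (hc : ∀ v w, G.Adj v w ↔ c v ≠ c w) (x : V → ℝ) (hx : ∑ v, x v = 0) :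
    x ⬝ᵥ (G.adjMatrix ℝ).mulVec x ≤ 0 := by
  have key : x ⬝ᵥ (G.adjMatrix ℝ).mulVec x =
      (∑ v, x v) ^ 2 - ∑ k, (∑ v, if c v = k then x v else 0) ^ 2 := by
    simp only [sq, Finset.sum_mul_sum]
    rw [Finset.sum_comm (s := (Finset.univ : Finset ι)), ← Finset.sum_sub_distrib]
    refine Finset.sum_congr rfl fun v _ => ?_
    rw [Finset.sum_comm (s := (Finset.univ : Finset ι)), ← Finset.sum_sub_distrib,
      Matrix.mulVec, dotProduct, Finset.mul_sum]
    refine Finset.sum_congr rfl fun w _ => ?_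
    by_cases h : c v = c w <;> simp [SimpleGraph.adjMatrix_apply, hc, h, eq_comm]
  rw [key, hx]
  have : 0 ≤ ∑ k, (∑ v, if c v = k then x v else 0) ^ 2 :=
    Finset.sum_nonneg fun k _ => sq_nonneg _
  linarith

/-- In a graph with an edge `w₁ w₂` and a non-isolated vertex adjacent to neither end, the
quadratic form is positive definite on some plane. -/
theorem SimpleGraph.exists_posDef_plane {V : Type*} [Fintype V] [DecidableEq V]
    (G : SimpleGraph V) [DecidableRel G.Adj] {v w₁ w₂ u : V}
    (hP : G.IsPathGraph3Compl v w₁ w₂) (hu : G.Adj v u) :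
    ∃ p q : V → ℝ, ∀ a b : ℝ, (a ≠ 0 ∨ b ≠ 0) →
      0 < (a • p + b • q) ⬝ᵥ (G.adjMatrix ℝ).mulVec (a • p + b • q) := by
  refine ⟨Pi.single v 2 + Pi.single u 1, Pi.single w₁ 1 + Pi.single w₂ 1, fun a b hab => ?_⟩
  have h12 := hP.adj
  have hv1 := hP.not_adj_fst
  have hv2 := hP.not_adj_snd
  have h12' := hP.adj.symm
  have hu' := hu.symm
  simp only [Matrix.mulVec_add, Matrix.mulVec_smul, dotProduct_add, add_dotProduct,
    dotProduct_smul, smul_dotProduct, smul_eq_mul, single_dotProduct, Matrix.mulVec_single,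
    SimpleGraph.adjMatrix_apply, h12, h12', hv1, hv2, hu, hu', G.adj_comm w₁ u,
    G.adj_comm w₂ u, G.adj_comm w₁ v, G.adj_comm w₂ v, Matrix.col_apply,
    MulOpposite.smul_eq_mul_unop, MulOpposite.unop_op, G.irrefl, if_true, if_false]
  have hpos : 0 < a ^ 2 + b ^ 2 := by
    rcases hab with h | h <;> positivity
  split_ifs <;> nlinarith [sq_nonneg (a + b), sq_nonneg (3 * a + 2 * b), sq_nonneg a, sq_nonneg b]

/-- Let `G` be a connected simple graph on `n ≥ 2` vertices, with
eigenvalues `e 0 ≥ e 1 ≥ ⋯ ≥ e (n-1)` listed in nonincreasing order.  Then `G` is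
isomorphic to a complete `r`-partite graph (for some `r ≥ 1` and some part sizes) iff
the second largest eigenvalue `e 1` satisfies `e 1 ≤ 0`. -/
theorem stmt18 {n : ℕ} (hn : 2 ≤ n) (G : SimpleGraph (Fin n)) [DecidableRel G.Adj]
    (hconn : G.Connected)
    (e : ℕ → ℝ) (hanti : ∀ i j, i ≤ j → j < n → e j ≤ e i)
    (hroots : (G.adjMatrix ℝ).charpoly.roots = (Multiset.range n).map e) :
    (∃ (r : ℕ) (_ : 1 ≤ r) (p : Fin r → ℕ), (∀ i, 1 ≤ p i) ∧
        Nonempty (G ≃g SimpleGraph.completeMultipartiteGraph fun i => Fin (p i))) ↔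
      e 1 ≤ 0 := by
  have hA : (G.adjMatrix ℝ).IsHermitian :=
    Matrix.isHermitian_iff_isSymm.2 (G.isSymm_adjMatrix (α := ℝ))
  rw [hA.second_eigenvalue_nonpos_iff hn e hanti hroots]
  constructor
  · rintro ⟨r, -, p, -, ⟨f⟩⟩ i j hij
    refine hA.eigenvalues_nonpos_or_of_hyperplane (fun _ => 1) (fun x hx => ?_) hij
    refine G.dotProduct_adjMatrix_mulVec_nonpos (fun v => (f v).1) (fun v w => ?_) x
      (by simpa [dotProduct] using hx)
    exact f.map_adj_iff.symm
  · intro h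
    have : Nontrivial (Fin n) := Fin.nontrivial_iff_two_le.2 hn
    have := hconn.nonempty
    refine SimpleGraph.IsCompleteMultipartite.exists_iso_fin ?_
    by_contra hG
    obtain ⟨v, w₁, w₂, hP⟩ :=
      SimpleGraph.exists_isPathGraph3Compl_of_not_isCompleteMultipartite hG
    obtain ⟨u, hu⟩ := hconn.preconnected.exists_adj_of_nontrivial v
    obtain ⟨p, q, hpq⟩ := G.exists_posDef_plane hP hu
    obtain ⟨a, b, hab, hle⟩ := hA.exists_dotProduct_mulVec_nonpos h p q
    exact hle.not_gt (hpq a b hab)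
end

section
/- Let G be a connected regular simple graph of order n whose adjacency matrix has exactly four distinct eigenvalues, and suppose the complement graph of G is disconnected. Then every connected component of the complement of G, regarded as an induced subgraph, is a strongly regular graph, and any two connected components of the complement are cospectral (their adjacency matrices have the same characteristic polynomial). -/
open Polynomial

namespace Matrix

variable {n : Type*} [Fintype n] [DecidableEq n]

/-- A polynomial in a real symmetric matrix is diagonalized by the same eigenvectors. -/
lemma IsHermitian.aeval_eq {A : Matrix n n ℝ} (hA : A.IsHermitian) (p : ℝ[X]) :
    aeval A p = Unitary.conjStarAlgAut ℝ _ hA.eigenvectorUnitary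
      (diagonal fun i => p.eval (hA.eigenvalues i)) := by
  have h1 : aeval (diagonal hA.eigenvalues) p = diagonal fun i => p.eval (hA.eigenvalues i) := by
    have := aeval_algHom_apply (diagonalAlgHom (n := n) (α := ℝ) ℝ) hA.eigenvalues p
    simp only [diagonalAlgHom_apply] at this
    rw [this]
    congr 1
    ext i
    simp
  conv_lhs => rw [hA.spectral_theorem]
  have h2 := aeval_algHom_apply
    (Unitary.conjStarAlgAut ℝ (Matrix n n ℝ) hA.eigenvectorUnitary).toAlgEquiv.toAlgHom
    (diagonal hA.eigenvalues) p
  rw [h1] at h2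
  exact h2

lemma IsHermitian.aeval_eq_zero_iff {A : Matrix n n ℝ} (hA : A.IsHermitian) (p : ℝ[X]) :
    aeval A p = 0 ↔ ∀ i, p.eval (hA.eigenvalues i) = 0 := by
  rw [hA.aeval_eq, EmbeddingLike.map_eq_zero_iff, diagonal_eq_zero, funext_iff]
  rfl

lemma IsHermitian.trace_aeval_s19 {A : Matrix n n ℝ} (hA : A.IsHermitian) (p : ℝ[X]) :
    (aeval A p).trace = (A.charpoly.roots.map p.eval).sum := by
  rw [hA.aeval_eq, Unitary.conjStarAlgAut_apply, trace_mul_comm, ← mul_assoc,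
    hA.roots_charpoly_eq_eigenvalues]
  simp [trace_diagonal]

lemma IsHermitian.eval_eq_zero_of_mem_roots_charpoly {A : Matrix n n ℝ} (hA : A.IsHermitian)
    {p : ℝ[X]} (hp : aeval A p = 0) {t : ℝ} (ht : t ∈ A.charpoly.roots) : p.eval t = 0 := by
  rw [hA.roots_charpoly_eq_eigenvalues] at ht
  obtain ⟨i, -, rfl⟩ := Multiset.mem_map.1 ht
  exact (hA.aeval_eq_zero_iff p).1 hp i

lemma mem_roots_charpoly_iff {A : Matrix n n ℝ} {t : ℝ} :
    t ∈ A.charpoly.roots ↔ ∃ v : n → ℝ, v ≠ 0 ∧ A *ᵥ v = t • v := by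
  rw [mem_roots A.charpoly_monic.ne_zero, IsRoot.def, eval_charpoly, ← exists_mulVec_eq_zero_iff]
  refine exists_congr fun v => and_congr_right fun _ => ?_
  rw [sub_mulVec, sub_eq_zero, scalar_apply, ← smul_one_eq_diagonal, smul_mulVec, one_mulVec,
    eq_comm]

end Matrix

lemma Multiset.sum_map_sub_mul_sub {s : Multiset ℝ} {x y z : ℝ} (hxy : x ≠ y) (hxz : x ≠ z)
    (hs : ∀ t ∈ s, t = x ∨ t = y ∨ t = z) :
    (s.map fun t => (t - y) * (t - z)).sum = s.count x * ((x - y) * (x - z)) := by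
  induction s using Multiset.induction with
  | empty => simp
  | cons a s ih =>
    have := ih fun t ht => hs t (Multiset.mem_cons_of_mem ht)
    rw [Multiset.map_cons, Multiset.sum_cons, this]
    rcases hs a (Multiset.mem_cons_self a s) with rfl | rfl | rfl
    · rw [Multiset.count_cons_self]; push_cast; ring
    · rw [Multiset.count_cons_of_ne hxy]; ring
    · rw [Multiset.count_cons_of_ne hxz]; ring

namespace Matrix

variable {n m : Type*} [Fintype n] [DecidableEq n] [Fintype m] [DecidableEq m]

/-- Two real symmetric matrices annihilated by the same cubic with simple roots are cospectral
as soon as they agree in size, in trace and in the trace of their squares. -/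
lemma IsHermitian.charpoly_eq_of_cubic {A : Matrix n n ℝ} {B : Matrix m m ℝ}
    (hA : A.IsHermitian) (hB : B.IsHermitian) {x y z : ℝ} (hxy : x ≠ y) (hxz : x ≠ z) (hyz : y ≠ z)
    (hAp : aeval A ((X - C x) * (X - C y) * (X - C z)) = 0)
    (hBp : aeval B ((X - C x) * (X - C y) * (X - C z)) = 0)
    (hcard : Fintype.card n = Fintype.card m) (htr : A.trace = B.trace)
    (htr2 : (A * A).trace = (B * B).trace) : A.charpoly = B.charpoly := by
  have hA' : ∀ t ∈ A.charpoly.roots, t = x ∨ t = y ∨ t = z := fun t ht => by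
    simpa [sub_eq_zero, or_assoc] using hA.eval_eq_zero_of_mem_roots_charpoly hAp ht
  have hB' : ∀ t ∈ B.charpoly.roots, t = x ∨ t = y ∨ t = z := fun t ht => by
    simpa [sub_eq_zero, or_assoc] using hB.eval_eq_zero_of_mem_roots_charpoly hBp ht
  have hquad (a b : ℝ) : (A.charpoly.roots.map fun t => (t - a) * (t - b)).sum =
      (B.charpoly.roots.map fun t => (t - a) * (t - b)).sum := by
    have h1 := hA.trace_aeval_s19 ((X - C a) * (X - C b))
    have h2 := hB.trace_aeval_s19 ((X - C a) * (X - C b))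
    simp only [eval_mul, eval_sub, eval_X, eval_C, map_mul, map_sub, aeval_X, aeval_C,
      Algebra.algebraMap_eq_smul_one, sub_mul, mul_sub, smul_mul_assoc, mul_smul_comm, one_mul,
      mul_one, trace_sub, trace_smul, trace_one] at h1 h2
    simp only [sub_mul, mul_sub]
    rw [← h1, ← h2, htr, htr2, hcard]
  have hcount {a b c : ℝ} (hab : a ≠ b) (hac : a ≠ c)
      (h1 : ∀ t ∈ A.charpoly.roots, t = a ∨ t = b ∨ t = c)
      (h2 : ∀ t ∈ B.charpoly.roots, t = a ∨ t = b ∨ t = c) :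
      A.charpoly.roots.count a = B.charpoly.roots.count a := by
    have h := hquad b c
    rw [Multiset.sum_map_sub_mul_sub hab hac h1, Multiset.sum_map_sub_mul_sub hab hac h2] at h
    exact_mod_cast mul_right_cancel₀ (mul_ne_zero (sub_ne_zero.2 hab) (sub_ne_zero.2 hac)) h
  have hroots : A.charpoly.roots = B.charpoly.roots := by
    ext t
    by_cases ht : t = x ∨ t = y ∨ t = z
    · rcases ht with rfl | rfl | rfl
      · exact hcount hxy hxz hA' hB'
      · exact hcount hxy.symm hyz (by grind) (by grind)
      · exact hcount hxz.symm hyz.symm (by grind) (by grind)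
    · rw [Multiset.count_eq_zero_of_notMem (mt (hA' t) ht),
        Multiset.count_eq_zero_of_notMem (mt (hB' t) ht)]
  rw [hA.splits_charpoly.eq_prod_roots_of_monic A.charpoly_monic,
    hB.splits_charpoly.eq_prod_roots_of_monic B.charpoly_monic, hroots]

end Matrix

namespace SimpleGraph

open Matrix

variable {V : Type*} [Fintype V] [DecidableEq V] {G : SimpleGraph V} [DecidableRel G.Adj]

lemma IsRegularOfDegree.adjMatrix_mulVec_eq_iff {k : ℕ} (h : G.IsRegularOfDegree k) {x : V → ℝ} :
    G.adjMatrix ℝ *ᵥ x = (k : ℝ) • x ↔ ∀ i j, G.Reachable i j → x i = x j := by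
  rw [← lapMatrix_mulVec_eq_zero_iff_forall_reachable, funext_iff, funext_iff]
  refine forall_congr' fun i => ?_
  rw [lapMatrix_mulVec_apply, h i, adjMatrix_mulVec_apply, Pi.smul_apply, Pi.zero_apply,
    smul_eq_mul, sub_eq_zero, eq_comm]

omit [DecidableEq V] in
lemma IsRegularOfDegree.sum_adjMatrix_mulVec {k : ℕ} (h : G.IsRegularOfDegree k) (x : V → ℝ) :
    ∑ i, (G.adjMatrix ℝ *ᵥ x) i = k * ∑ i, x i := by
  have h1 : (1 : V → ℝ) ᵥ* G.adjMatrix ℝ = (k : ℝ) • 1 := by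
    ext i
    simp [h i]
  have h2 := dotProduct_mulVec (1 : V → ℝ) (G.adjMatrix ℝ) x
  rw [h1, smul_dotProduct, one_dotProduct, one_dotProduct] at h2
  exact h2

lemma adjMatrix_mulVec_add_compl (x : V → ℝ) (i : V) :
    (G.adjMatrix ℝ *ᵥ x) i + (Gᶜ.adjMatrix ℝ *ᵥ x) i = ∑ j, x j - x i := by
  have h := G.one_add_adjMatrix_add_compl_adjMatrix_eq_of_one ℝ
  rw [G.compl_adjMatrix_eq_adjMatrix_compl ℝ] at h
  have h2 := congr_fun (congr_arg (· *ᵥ x) h) i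
  simp only [add_mulVec, one_mulVec, Pi.add_apply] at h2
  have h3 : ((of 1 : Matrix V V ℝ) *ᵥ x) i = ∑ j, x j := by simp [mulVec, dotProduct]
  rw [h3] at h2
  linarith

/-- A connected regular graph whose adjacency matrix is annihilated by a cubic vanishing at the
degree satisfies a quadratic equation modulo the all-ones matrix. -/
lemma IsRegularOfDegree.adjMatrix_mul_self_apply {k : ℕ} (h : G.IsRegularOfDegree k)
    (hG : G.Connected) {x y : ℝ}
    (hp : aeval (G.adjMatrix ℝ) ((X - C (k : ℝ)) * (X - C x) * (X - C y)) = 0) (i j : V) :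
    (G.adjMatrix ℝ * G.adjMatrix ℝ) i j =
      (x + y) * G.adjMatrix ℝ i j - x * y * (1 : Matrix V V ℝ) i j + (k + x * y) := by
  set A := G.adjMatrix ℝ with hA
  set R := A * A - (x + y) • A + (x * y) • (1 : Matrix V V ℝ) with hR
  have hR' : A * R = (k : ℝ) • R := by
    have : A * R - (k : ℝ) • R = 0 := by
      rw [← hp, hR]
      simp only [map_mul, map_sub, aeval_X, aeval_C, Algebra.algebraMap_eq_smul_one]
      simp only [mul_sub, sub_mul, mul_add, smul_mul_assoc, mul_smul_comm, one_mul, mul_one,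
        smul_sub, smul_add, smul_smul, mul_assoc]
      module
    exact sub_eq_zero.1 this
  have hsymm : Rᵀ = R := by simp [hR, hA]
  have hcol (i i' j : V) : R i j = R i' j := by
    refine (h.adjMatrix_mulVec_eq_iff (x := fun i => R i j)).1 ?_ i i' (hG.preconnected i i')
    ext l
    exact congr_fun (congr_fun hR' l) j
  have hdiag : R j j = k + x * y := by
    have h1 : (A * A) j j = k := by rw [hA, adjMatrix_mul_self_apply_self, h j]
    have h2 : A j j = 0 := by simp [hA]
    simp [hR, h1, h2]
  have hij : R i j = k + x * y := (hcol i j j).trans hdiag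
  simp only [hR, Matrix.add_apply, Matrix.sub_apply, Matrix.smul_apply, smul_eq_mul] at hij
  linarith

lemma IsRegularOfDegree.card_mul_of_cubic {k : ℕ} (h : G.IsRegularOfDegree k)
    (hG : G.Connected) {x y : ℝ}
    (hp : aeval (G.adjMatrix ℝ) ((X - C (k : ℝ)) * (X - C x) * (X - C y)) = 0) :
    Fintype.card V * (k + x * y) = (k - x) * (k - y) := by
  obtain ⟨i⟩ := hG.nonempty
  have hrow (l : V) : ∑ j, G.adjMatrix ℝ l j = k := by simp [← h l, ← card_neighborFinset_eq_degree, neighborFinset_eq_filter]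
  have h1 : ∑ j, (G.adjMatrix ℝ * G.adjMatrix ℝ) i j = k * k := by
    simp only [Matrix.mul_apply]
    rw [Finset.sum_comm]
    simp only [← Finset.mul_sum, hrow, ← Finset.sum_mul]
  simp only [h.adjMatrix_mul_self_apply hG hp, Finset.sum_add_distrib, Finset.sum_sub_distrib,
    ← Finset.mul_sum, hrow, Matrix.one_apply] at h1
  simp at h1
  linarith

omit [DecidableEq V] in
lemma adjMatrix_mul_self_apply_eq_card_commonNeighbors (i j : V) :
    (G.adjMatrix ℝ * G.adjMatrix ℝ) i j = Fintype.card (G.commonNeighbors i j) := by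
  rw [← Set.toFinset_card, Matrix.mul_apply]
  simp only [adjMatrix_apply, mul_ite, mul_one, mul_zero, ← ite_and]
  rw [Finset.sum_boole]
  congr 2
  ext l
  simp [mem_commonNeighbors, adj_comm, and_comm]

lemma IsRegularOfDegree.isSRGWith_of_cubic {k : ℕ} (h : G.IsRegularOfDegree k)
    (hG : G.Connected) {x y : ℝ}
    (hp : aeval (G.adjMatrix ℝ) ((X - C (k : ℝ)) * (X - C x) * (X - C y)) = 0) :
    G.IsSRGWith (Fintype.card V) k ⌊x + y + (k + x * y)⌋₊ ⌊k + x * y⌋₊ where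
  card := rfl
  regular := h
  of_adj v w hvw := by
    have := h.adjMatrix_mul_self_apply hG hp v w
    rw [adjMatrix_mul_self_apply_eq_card_commonNeighbors] at this
    simp only [adjMatrix_apply, hvw, if_true, one_apply_ne hvw.ne, mul_one, mul_zero,
      sub_zero] at this
    rw [← this, Nat.floor_natCast]
  of_not_adj v w hne hvw := by
    have := h.adjMatrix_mul_self_apply hG hp v w
    rw [adjMatrix_mul_self_apply_eq_card_commonNeighbors] at this
    simp only [adjMatrix_apply, hvw, if_false, one_apply_ne hne, mul_zero, sub_zero,
      zero_add] at this
    rw [← this, Nat.floor_natCast]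

omit [DecidableEq V] in
lemma IsRegularOfDegree.eq_top_iff {k : ℕ} [Nonempty V] (h : G.IsRegularOfDegree k) :
    G = ⊤ ↔ Fintype.card V = k + 1 := by
  rw [eq_top_iff_forall_isUniversal]
  have hpos : 0 < Fintype.card V := Fintype.card_pos
  simp only [← degree_eq_card_sub_one, h.degree_eq, forall_const]
  omega

/-- Restricting an annihilating polynomial of the adjacency matrix to a connected component. -/
lemma ConnectedComponent.aeval_adjMatrix_induce (c : G.ConnectedComponent)
    [Fintype c.supp] [DecidableEq c.supp] [DecidableRel (G.induce c.supp).Adj] (p : ℝ[X]) :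
    aeval ((G.induce c.supp).adjMatrix ℝ) p =
      (aeval (G.adjMatrix ℝ) p).submatrix Subtype.val Subtype.val := by
  have hmul (Y : Matrix V V ℝ) :
      (G.adjMatrix ℝ * Y).submatrix Subtype.val Subtype.val =
        (G.induce c.supp).adjMatrix ℝ * Y.submatrix Subtype.val (Subtype.val : c.supp → V) := by
    ext i j
    simp only [submatrix_apply, Matrix.mul_apply]
    refine (Fintype.sum_of_injective Subtype.val Subtype.val_injective _ _ (fun l hl => ?_)
      fun l => ?_).symm
    · have : ¬ G.Adj i l := fun hadj =>
        hl ⟨⟨l, c.mem_supp_of_adj_mem_supp i.2 hadj⟩, rfl⟩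
      simp [this]
    · simp
  have hpow (r : ℕ) : (G.induce c.supp).adjMatrix ℝ ^ r =
      (G.adjMatrix ℝ ^ r).submatrix Subtype.val Subtype.val := by
    induction r with
    | zero => simp [submatrix_one _ Subtype.val_injective]
    | succ r ih => rw [pow_succ', pow_succ', hmul, ih]
  induction p using Polynomial.induction_on' with
  | add p q hp hq => rw [map_add, map_add, hp, hq, submatrix_add]; rfl
  | monomial r a =>
    simp only [aeval_monomial, Algebra.algebraMap_eq_smul_one, smul_mul_assoc, one_mul, hpow,
      submatrix_smul]
    rfl

lemma IsRegularOfDegree.induce_supp {k : ℕ} (h : G.IsRegularOfDegree k)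
    (c : G.ConnectedComponent) [Fintype c.supp] [DecidableRel (G.induce c.supp).Adj] :
    (G.induce c.supp).IsRegularOfDegree k := by
  intro v
  rw [← h v]
  convert degree_induce_of_neighborSet_subset
    (fun w hw => c.mem_supp_of_adj_mem_supp v.2 hw : G.neighborSet v ⊆ c.supp)

/-- If every connected component of a regular graph is complete, then the only eigenvalues of the
graph are its degree and `-1`. -/
lemma IsRegularOfDegree.eq_or_eq_neg_one {k : ℕ} (h : G.IsRegularOfDegree k)
    (hG : ∀ c : G.ConnectedComponent, G.induce c.supp = ⊤) {t : ℝ} {v : V → ℝ} (hv : v ≠ 0)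
    (ht : G.adjMatrix ℝ *ᵥ v = t • v) : t = k ∨ t = -1 := by
  have hadj (i j : V) (hij : G.Reachable i j) (hne : i ≠ j) : G.Adj i j := by
    have h1 : (G.induce (G.connectedComponentMk i).supp).Adj ⟨i, rfl⟩
        ⟨j, ConnectedComponent.sound hij.symm⟩ := by
      rw [hG, top_adj]
      exact fun h => hne (congrArg Subtype.val h)
    simpa using h1
  have hnbr (i l : V) : l ∈ insert i (G.neighborFinset i) ↔ G.Reachable i l := by
    rw [Finset.mem_insert, mem_neighborFinset]
    refine ⟨?_, fun hl => ?_⟩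
    · rintro (rfl | hl)
      exacts [Reachable.refl _, hl.reachable]
    · by_cases hil : l = i
      exacts [Or.inl hil, Or.inr (hadj i l hl (Ne.symm hil))]
  have hsum (i : V) : ((t + 1) • v) i = ∑ l ∈ insert i (G.neighborFinset i), v l := by
    rw [Finset.sum_insert (G.notMem_neighborFinset_self i), ← adjMatrix_mulVec_apply, ht,
      Pi.smul_apply, Pi.smul_apply, smul_eq_mul, smul_eq_mul]
    ring
  have hk : G.adjMatrix ℝ *ᵥ ((t + 1) • v) = (k : ℝ) • ((t + 1) • v) :=
    h.adjMatrix_mulVec_eq_iff.2 fun i j hij => by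
      rw [hsum, hsum]
      congr 1
      ext l
      rw [hnbr, hnbr]
      exact ⟨hij.symm.trans, hij.trans⟩
  rw [mulVec_smul, ht, smul_smul, smul_smul] at hk
  have := smul_left_injective ℝ hv hk
  have h0 : (t - k) * (t + 1) = 0 := by linarith
  rcases mul_eq_zero.1 h0 with h0 | h0
  exacts [Or.inl (by linarith), Or.inr (by linarith)]

lemma IsRegularOfDegree.mulVec_compl_of_eigenvector {d : ℕ} (h : G.IsRegularOfDegree d) {t : ℝ}
    {v : V → ℝ} (ht : G.adjMatrix ℝ *ᵥ v = t • v) (hne : t ≠ d) :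
    Gᶜ.adjMatrix ℝ *ᵥ v = (-1 - t) • v := by
  have h1 := h.sum_adjMatrix_mulVec v
  simp only [ht, Pi.smul_apply, smul_eq_mul, ← Finset.mul_sum] at h1
  have h2 : ∑ i, v i = 0 := (mul_eq_mul_right_iff.1 h1).resolve_left hne
  ext i
  have h3 := G.adjMatrix_mulVec_add_compl v i
  rw [h2, ht] at h3
  simp only [Pi.smul_apply, smul_eq_mul] at h3 ⊢
  linarith

/-- The eigenvalues of the complement of a connected regular graph with four distinct
eigenvalues, if this complement is disconnected. -/
lemma IsRegularOfDegree.exists_compl_cubic {d : ℕ} (h : G.IsRegularOfDegree d)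
    (hconn : G.Connected) (h4 : (G.adjMatrix ℝ).charpoly.roots.toFinset.card = 4)
    (hdisc : ¬ Gᶜ.Connected) :
    ∃ k : ℕ, ∃ x y : ℝ, Gᶜ.IsRegularOfDegree k ∧ (k : ℝ) ≠ x ∧ (k : ℝ) ≠ y ∧ x ≠ y ∧
      aeval (Gᶜ.adjMatrix ℝ) ((X - C (k : ℝ)) * (X - C x) * (X - C y)) = 0 ∧
      (∃ v : V → ℝ, v ≠ 0 ∧ Gᶜ.adjMatrix ℝ *ᵥ v = x • v) ∧
      ∃ v : V → ℝ, v ≠ 0 ∧ Gᶜ.adjMatrix ℝ *ᵥ v = y • v := by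
  have := hconn.nonempty
  obtain ⟨k, hk⟩ : ∃ k, Gᶜ.IsRegularOfDegree k := ⟨_, h.compl⟩
  set S := (G.adjMatrix ℝ).charpoly.roots.toFinset with hS
  have hmem (t : ℝ) : t ∈ S ↔ ∃ v : V → ℝ, v ≠ 0 ∧ G.adjMatrix ℝ *ᵥ v = t • v := by
    rw [hS, Multiset.mem_toFinset, mem_roots_charpoly_iff]
  have hd : (d : ℝ) ∈ S :=
    (hmem _).2 ⟨1, one_ne_zero, h.adjMatrix_mulVec_eq_iff.2 fun _ _ _ => rfl⟩
  have hcomp {t : ℝ} {v : V → ℝ} (ht : Gᶜ.adjMatrix ℝ *ᵥ v = t • v) (hv : ∑ i, v i = 0) :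
      G.adjMatrix ℝ *ᵥ v = (-1 - t) • v := by
    ext i
    have h3 := G.adjMatrix_mulVec_add_compl v i
    rw [hv, ht] at h3
    simp only [Pi.smul_apply, smul_eq_mul] at h3 ⊢
    linarith
  have he : (-1 - k : ℝ) ∈ S := by
    obtain ⟨u, w, huw⟩ : ∃ u w, ¬ Gᶜ.Reachable u w := by
      by_contra! hcon
      exact hdisc ⟨hcon⟩
    classical
    set f : V → ℝ := fun i => if Gᶜ.Reachable u i then 1 else 0 with hf
    set v : V → ℝ := fun i => Fintype.card V * f i - ∑ j, f j with hv
    refine (hmem _).2 ⟨v, fun h0 => ?_, hcomp (hk.adjMatrix_mulVec_eq_iff.2 ?_) ?_⟩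
    · have h1 := congr_fun h0 u
      have h2 := congr_fun h0 w
      simp only [hv, Pi.zero_apply] at h1 h2
      have h3 : f u = 1 := if_pos (Reachable.refl u)
      have h4 : f w = 0 := if_neg huw
      have h5 : (0 : ℝ) < Fintype.card V := by exact_mod_cast Fintype.card_pos
      rw [h3] at h1
      rw [h4] at h2
      linarith
    · intro i j hij
      have : Gᶜ.Reachable u i ↔ Gᶜ.Reachable u j :=
        ⟨fun h => h.trans hij, fun h => h.trans hij.symm⟩
      simp only [hv, hf, this]
    · simp [hv, Finset.sum_sub_distrib, ← Finset.mul_sum]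
  have hde : (-1 - k : ℝ) ≠ d := by
    have h1 : (0 : ℝ) ≤ d := d.cast_nonneg
    have h2 : (0 : ℝ) ≤ k := k.cast_nonneg
    linarith
  obtain ⟨a, b, hab, hSab⟩ := Finset.card_eq_two.1
    (show ((S.erase d).erase (-1 - k)).card = 2 by
      rw [Finset.card_erase_of_mem (Finset.mem_erase.2 ⟨hde, he⟩), Finset.card_erase_of_mem hd, h4])
  have hSmem (t : ℝ) : (t ≠ -1 - k ∧ t ≠ d ∧ t ∈ S) ↔ t = a ∨ t = b := by
    rw [← Finset.mem_erase, ← Finset.mem_erase, hSab, Finset.mem_insert, Finset.mem_singleton]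
  obtain ⟨hak, had, haS⟩ := (hSmem a).2 (Or.inl rfl)
  obtain ⟨hbk, hbd, hbS⟩ := (hSmem b).2 (Or.inr rfl)
  refine ⟨k, -1 - a, -1 - b, hk, fun h => hak (by linarith), fun h => hbk (by linarith),
    fun h => hab (by linarith), ?_, ?_, ?_⟩
  · have hM : (Gᶜ.adjMatrix ℝ).IsHermitian := Gᶜ.isHermitian_adjMatrix ℝ
    rw [hM.aeval_eq_zero_iff]
    intro i
    obtain ⟨v, hv0, hv⟩ := mem_roots_charpoly_iff.1 <| show hM.eigenvalues i ∈
      (Gᶜ.adjMatrix ℝ).charpoly.roots by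
        rw [hM.roots_charpoly_eq_eigenvalues]
        exact Multiset.mem_map_of_mem _ (Finset.mem_univ i)
    generalize hM.eigenvalues i = t at hv
    suffices t = k ∨ t = -1 - a ∨ t = -1 - b by
      simpa [sub_eq_zero, or_assoc] using this
    by_contra! hcon
    obtain ⟨htk, hta, htb⟩ := hcon
    have hsum : ∑ i, v i = 0 := by
      have h1 := hk.sum_adjMatrix_mulVec v
      simp only [hv, Pi.smul_apply, smul_eq_mul, ← Finset.mul_sum] at h1
      exact (mul_eq_mul_right_iff.1 h1).resolve_left htk
    have hGv := hcomp hv hsum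
    have htS := (hmem _).2 ⟨v, hv0, hGv⟩
    have htd : -1 - t = (d : ℝ) := by
      by_contra hne
      rcases (hSmem _).1 ⟨fun h => htk (by linarith), hne, htS⟩ with h | h
      exacts [hta (by linarith), htb (by linarith)]
    rw [htd, h.adjMatrix_mulVec_eq_iff] at hGv
    refine hv0 (funext fun i => ?_)
    have : ∑ j, v j = Fintype.card V * v i := by
      rw [Finset.sum_congr rfl fun j _ => hGv j i (hconn.preconnected j i)]
      simp
    rw [hsum, zero_eq_mul] at this
    exact this.resolve_left (by exact_mod_cast Fintype.card_ne_zero)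
  · obtain ⟨v, hv0, hv⟩ := (hmem a).1 haS
    exact ⟨v, hv0, h.mulVec_compl_of_eigenvector hv had⟩
  · obtain ⟨v, hv0, hv⟩ := (hmem b).1 hbS
    exact ⟨v, hv0, h.mulVec_compl_of_eigenvector hv hbd⟩

end SimpleGraph

open scoped Classical in
/-- Let `G` be a connected regular simple graph whose adjacency matrix
has exactly four distinct eigenvalues, and suppose the complement `Gᶜ` is disconnected.
Then every connected component of `Gᶜ` (as an induced subgraph) is a strongly regular
graph (in particular neither complete nor empty), and any two connected components of
`Gᶜ` are cospectral. -/
theorem stmt19 {V : Type*} [Fintype V] [DecidableEq V] (G : SimpleGraph V)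
    [DecidableRel G.Adj] (hconn : G.Connected)
    (hreg : ∃ d : ℕ, G.IsRegularOfDegree d)
    (h4 : (G.adjMatrix ℝ).charpoly.roots.toFinset.card = 4)
    (hdisc : ¬ Gᶜ.Connected) :
    (∀ c : Gᶜ.ConnectedComponent,
        ∃ ν k α β : ℕ, (Gᶜ.induce c.supp).IsSRGWith ν k α β ∧
          Gᶜ.induce c.supp ≠ ⊤ ∧ Gᶜ.induce c.supp ≠ ⊥) ∧
      ∀ c d : Gᶜ.ConnectedComponent,
        ((Gᶜ.induce c.supp).adjMatrix ℝ).charpoly =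
          ((Gᶜ.induce d.supp).adjMatrix ℝ).charpoly := by
  classical
  obtain ⟨d, hd⟩ := hreg
  obtain ⟨k, x, y, hk, hkx, hky, hxy, hcubic, ⟨v, hv0, hv⟩, w, hw0, hw⟩ :=
    hd.exists_compl_cubic hconn h4 hdisc
  have hreg' (c : Gᶜ.ConnectedComponent) : (Gᶜ.induce c.supp).IsRegularOfDegree k :=
    hk.induce_supp c
  have hconn' (c : Gᶜ.ConnectedComponent) : (Gᶜ.induce c.supp).Connected :=
    c.connected_toSimpleGraph
  have hcubic' (c : Gᶜ.ConnectedComponent) : aeval ((Gᶜ.induce c.supp).adjMatrix ℝ)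
      ((X - C (k : ℝ)) * (X - C x) * (X - C y)) = 0 := by
    rw [c.aeval_adjMatrix_induce, hcubic, Matrix.submatrix_zero]
    rfl
  have hcard (c : Gᶜ.ConnectedComponent) := (hreg' c).card_mul_of_cubic (hconn' c) (hcubic' c)
  have hprod : ((k : ℝ) - x) * (k - y) ≠ 0 := mul_ne_zero (sub_ne_zero.2 hkx) (sub_ne_zero.2 hky)
  have hcardeq (c c' : Gᶜ.ConnectedComponent) :
      Fintype.card c.supp = Fintype.card c'.supp := by
    have hne : (k + x * y : ℝ) ≠ 0 := right_ne_zero_of_mul ((hcard c).trans_ne hprod)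
    exact_mod_cast mul_right_cancel₀ hne ((hcard c).trans (hcard c').symm)
  have hnot (c : Gᶜ.ConnectedComponent) : Fintype.card c.supp ≠ k + 1 := by
    intro hc
    have htop (c' : Gᶜ.ConnectedComponent) : Gᶜ.induce c'.supp = ⊤ := by
      have := (hconn' c').nonempty
      exact (hreg' c').eq_top_iff.2 ((hcardeq c' c).trans hc)
    have h1 := (hk.eq_or_eq_neg_one htop hv0 hv).resolve_left hkx.symm
    have h2 := (hk.eq_or_eq_neg_one htop hw0 hw).resolve_left hky.symm
    exact hxy (h1.trans h2.symm)
  refine ⟨fun c => ⟨_, k, _, _, (hreg' c).isSRGWith_of_cubic (hconn' c) (hcubic' c), ?_, ?_⟩,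
    fun c c' => ?_⟩
  · intro htop
    have := (hconn' c).nonempty
    exact hnot c ((hreg' c).eq_top_iff.1 htop)
  · intro hbot
    obtain ⟨i⟩ := (hconn' c).nonempty
    have hk0 : k = 0 := by
      rw [← hreg' c i, SimpleGraph.degree_eq_zero]
      simp [hbot]
    have h1 := hcard c
    subst hk0
    refine hnot c ?_
    have h2 : (Fintype.card c.supp : ℝ) * (x * y) = 1 * (x * y) := by
      push_cast at h1
      linarith
    have h3 : x * y ≠ 0 := by
      push_cast at hprod
      simpa using hprod
    simpa using mul_right_cancel₀ h3 h2
  · have htr2 (c : Gᶜ.ConnectedComponent) :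
        ((Gᶜ.induce c.supp).adjMatrix ℝ * (Gᶜ.induce c.supp).adjMatrix ℝ).trace =
          Fintype.card c.supp * k := by
      simp only [Matrix.trace, Matrix.diag_apply, SimpleGraph.adjMatrix_mul_self_apply_self,
        (hreg' c).degree_eq]
      simp
    refine ((Gᶜ.induce c.supp).isHermitian_adjMatrix ℝ).charpoly_eq_of_cubic
      ((Gᶜ.induce c'.supp).isHermitian_adjMatrix ℝ) hkx hky hxy (hcubic' c) (hcubic' c')
      (hcardeq c c') ?_ ?_
    · rw [SimpleGraph.trace_adjMatrix, SimpleGraph.trace_adjMatrix]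
    · rw [htr2, htr2, hcardeq c c']
end
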